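/- There are infinitely many cubic fields K that are not Galois over ℚ whose Dedekind zeta function has negative central value; precisely, for every real B there exists a number field K of degree 3 over ℚ such that |Δ(K)| > B, K is not a Galois extension of ℚ, and ζ_K(1/2) < 0 (the analytic continuation of ζ_K takes a negative real value at s = 1/2). -/

import Mathlib

open scoped Classical
noncomputable section

/-- The Dedekind zeta series of a number field `K`: `∑ N(I)^{-s}` over nonzero ideals `I`
of the ring of integers, convergent for `Re s > 1`. -/
def dedekindSeries (K : Type*) [Field K] [NumberField K] (s : ℂ) : ℂ :=
  ∑' I : {I : Ideal (NumberField.RingOfIntegers K) // I ≠ ⊥},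
    (Ideal.absNorm I.1 : ℂ) ^ (-s)

/-- `g` is (the) analytic continuation of the Dedekind zeta function of `K`:
analytic on `ℂ ∖ {1}` and agreeing with the Dirichlet series on `Re s > 1`. -/
def IsDedekindZeta (K : Type*) [Field K] [NumberField K] (g : ℂ → ℂ) : Prop :=
  DifferentiableOn ℂ g {(1 : ℂ)}ᶜ ∧ ∀ s : ℂ, 1 < s.re → g s = dedekindSeries K s

open QuadraticAlgebra

/-- The Eisenstein algebra `R[ω]` with `ω ^ 2 = -1 - ω`. -/
abbrev Eis (R : Type*) [CommRing R] := QuadraticAlgebra R (-1) (-1)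

namespace Eis

variable {R S : Type*} [CommRing R] [CommRing S]

/-- The map on Eisenstein algebras induced by a ring homomorphism. -/
def map (f : R →+* S) : Eis R →+* Eis S where
  toFun z := ⟨f z.re, f z.im⟩
  map_one' := by ext <;> simp [re_one, im_one]
  map_mul' x y := by ext <;> simp
  map_zero' := by ext <;> simp
  map_add' x y := by ext <;> simp

@[simp] lemma re_map (f : R →+* S) (z : Eis R) : (map f z).re = f z.re := rfl
@[simp] lemma im_map (f : R →+* S) (z : Eis R) : (map f z).im = f z.im := rfl

lemma map_star (f : R →+* S) (z : Eis R) : map f (star z) = star (map f z) := by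
  ext <;> simp

lemma norm_map (f : R →+* S) (z : Eis R) : norm (map f z) = f (norm z) := by
  simp [norm_def]

lemma norm_eq (z : Eis R) : norm z = z.re ^ 2 - z.re * z.im + z.im ^ 2 := by
  rw [norm_def]; ring

lemma mul_star_self (z : Eis R) : z * star z = algebraMap R (Eis R) (norm z) :=
  (algebraMap_norm_eq_mul_star z).symm

/-- Reduction modulo `n` of Eisenstein integers. -/
abbrev red (n : ℕ) : Eis ℤ →+* Eis (ZMod n) := map (Int.castRingHom (ZMod n))

instance [Fintype R] : Fintype (Eis R) := Fintype.ofEquiv _ (equivProd _ _).symm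

/-- The distinguished cube root of unity. -/
abbrev om : Eis R := ⟨0, 1⟩

lemma om_sq : (om : Eis R) ^ 2 = ⟨-1, -1⟩ := by ext <;> simp [sq]
lemma om_cube : (om : Eis R) ^ 3 = 1 := by
  rw [pow_succ, om_sq]; ext <;> simp [re_one, im_one]

lemma eq_om_pow_of_cube {F : Type*} [Field F] (h3 : (3 : F) ≠ 0) (z : Eis F)
    (hz : z ^ 3 = 1) (hn : z * star z = 1) : ∃ i < 3, z = om ^ i := by
  have h1 : z ^ 2 = star z := by
    calc z ^ 2 = z ^ 2 * (z * star z) := by rw [hn, mul_one]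
      _ = z ^ 3 * star z := by ring
      _ = star z := by rw [hz, one_mul]
  obtain ⟨x, y⟩ := z
  have e1 := congrArg QuadraticAlgebra.re h1
  have e2 := congrArg QuadraticAlgebra.im h1
  have e3 := congrArg QuadraticAlgebra.re hn
  simp [sq, re_one] at e1 e2 e3
  have h5 : y * (2 * x - y + 1) = 0 := by linear_combination e2
  rcases mul_eq_zero.1 h5 with rfl | h6
  · have h7 : x * (x - 1) = 0 := by linear_combination e1
    rcases mul_eq_zero.1 h7 with rfl | h8
    · simp at e3
    · refine ⟨0, by norm_num, ?_⟩
      rw [sub_eq_zero] at h8; subst h8; rfl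
  · have hy : y = 2 * x + 1 := by linear_combination -h6
    subst hy
    have h8 : 3 * (x * (x + 1)) = 0 := by linear_combination -e1
    rcases mul_eq_zero.1 ((mul_eq_zero.1 h8).resolve_left h3) with rfl | h9
    · exact ⟨1, by norm_num, by simp⟩
    · refine ⟨2, by norm_num, ?_⟩
      have : x = -1 := by linear_combination h9
      subst this
      rw [om_sq]; ext <;> simp; norm_num

/-- A primitive cube root of unity in `ℂ`. -/
def zeta3 : ℂ := Complex.exp (2 * Real.pi * Complex.I / 3)

lemma zeta3_primitive : IsPrimitiveRoot zeta3 3 := by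
  have := Complex.isPrimitiveRoot_exp 3 (by norm_num)
  simpa [zeta3] using this

lemma zeta3_cube : zeta3 ^ 3 = 1 := zeta3_primitive.pow_eq_one

/-- The value in `ℂ` attached to a cube root of unity in an Eisenstein algebra. -/
def cubeVal (z : Eis R) : ℂ := if z = 1 then 1 else if z = om then zeta3 else zeta3 ^ 2

lemma cubeVal_om_pow [Nontrivial R] (i : ℕ) : cubeVal ((om : Eis R) ^ i) = zeta3 ^ i := by
  rw [pow_eq_pow_mod i om_cube, pow_eq_pow_mod i zeta3_cube]
  have : i % 3 < 3 := Nat.mod_lt _ (by norm_num)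
  have h1 : (om : Eis R) ≠ 1 := by
    intro h; have := congrArg QuadraticAlgebra.im h; simp [im_one] at this
  interval_cases i % 3
  · simp [cubeVal]
  · simp [cubeVal, h1]
  · have h2 : (om : Eis R) ^ 2 ≠ 1 := by
      rw [om_sq]
      intro h; have := congrArg QuadraticAlgebra.im h; simp [im_one] at this
    have h3 : (om : Eis R) ^ 2 ≠ om := by
      rw [om_sq]
      intro h; have := congrArg QuadraticAlgebra.re h; simp at this
    simp [cubeVal, h2, h3]

/-- Conjugation on units. -/
def conjUnit : (Eis R)ˣ →* (Eis R)ˣ := Units.map (starRingEnd (Eis R)).toMonoidHom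

@[simp] lemma coe_conjUnit (u : (Eis R)ˣ) :
    ((conjUnit u : (Eis R)ˣ) : Eis R) = star (u : Eis R) := rfl

lemma conjUnit_conjUnit (u : (Eis R)ˣ) : conjUnit (conjUnit u) = u := by
  ext1; simp

/-- The cubic power residue map on units modulo `q`. -/
def cubicPow (q : ℕ) : (Eis (ZMod q))ˣ →* (Eis (ZMod q))ˣ :=
  if q % 3 = 1 then (powMonoidHom ((q - 1) / 3)).comp (MonoidHom.id _ / conjUnit)
  else (powMonoidHom ((q + 1) / 3)).comp (conjUnit / MonoidHom.id _)

lemma cubicPow_of_mod_one {q : ℕ} (h : q % 3 = 1) (u : (Eis (ZMod q))ˣ) :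
    cubicPow q u = (u / conjUnit u) ^ ((q - 1) / 3) := by
  simp [cubicPow, h, div_pow]

lemma cubicPow_of_mod_two {q : ℕ} (h : q % 3 = 2) (u : (Eis (ZMod q))ˣ) :
    cubicPow q u = (conjUnit u / u) ^ ((q + 1) / 3) := by
  simp [cubicPow, h, div_pow]

lemma mod_three_cases {q : ℕ} (hq : q.Prime) (h3 : q ≠ 3) : q % 3 = 1 ∨ q % 3 = 2 := by
  have : ¬ 3 ∣ q := fun h => h3 ((Nat.prime_dvd_prime_iff_eq Nat.prime_three hq).1 h).symm
  omega

lemma three_ne_zero {q : ℕ} (hq : q.Prime) (h3 : q ≠ 3) : (3 : ZMod q) ≠ 0 := by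
  intro h
  have : ((3 : ℕ) : ZMod q) = 0 := by exact_mod_cast h
  rw [ZMod.natCast_eq_zero_iff] at this
  exact h3 ((Nat.prime_dvd_prime_iff_eq hq Nat.prime_three).1 this)

lemma eq_add_om (z : Eis R) : z = algebraMap R (Eis R) z.re + algebraMap R (Eis R) z.im * om := by
  ext <;> simp

/-- Frobenius on the Eisenstein algebra modulo `q`. -/
lemma pow_prime {q : ℕ} (hq : q.Prime) (h3 : q ≠ 3) (z : Eis (ZMod q)) :
    z ^ q = if q % 3 = 1 then z else star z := by
  have := Fact.mk hq
  have : CharP (Eis (ZMod q)) q := charP_of_injective_algebraMap algebraMap_injective q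
  conv_lhs => rw [eq_add_om z]
  rw [add_pow_char, mul_pow, ← map_pow, ← map_pow, ZMod.pow_card, ZMod.pow_card]
  rw [pow_eq_pow_mod q om_cube]
  rcases mod_three_cases hq h3 with h | h
  · rw [h]; simp only [pow_one, if_true]; exact (eq_add_om z).symm
  · rw [h, om_sq]
    ext <;> simp

lemma pow_prime_sq {q : ℕ} (hq : q.Prime) (h3 : q ≠ 3) (z : Eis (ZMod q)) :
    z ^ (q ^ 2) = z := by
  rw [sq, pow_mul, pow_prime hq h3, pow_prime hq h3]
  split_ifs <;> simp

lemma cubicPow_cube {q : ℕ} (hq : q.Prime) (h3 : q ≠ 3) (u : (Eis (ZMod q))ˣ) :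
    (cubicPow q u) ^ 3 = 1 := by
  rcases mod_three_cases hq h3 with h | h
  · rw [cubicPow_of_mod_one h, ← pow_mul, Nat.div_mul_cancel (by omega)]
    have key : (u / conjUnit u) ^ q = u / conjUnit u := by
      ext1; rw [Units.val_pow_eq_pow_val, pow_prime hq h3, if_pos h]
    have h1 : (u / conjUnit u) ^ q = (u / conjUnit u) ^ (q - 1) * (u / conjUnit u) := by
      rw [← pow_succ, Nat.sub_add_cancel hq.one_lt.le]
    rw [h1] at key
    simpa using key
  · rw [cubicPow_of_mod_two h, ← pow_mul, Nat.div_mul_cancel (by omega)]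
    have key : (conjUnit u / u) ^ q = u / conjUnit u := by
      rw [div_pow]
      congr 1 <;> ext1 <;> simp [pow_prime hq h3, h]
    rw [pow_succ, key]; simp

lemma cubicPow_conjUnit (q : ℕ) (u : (Eis (ZMod q))ˣ) :
    cubicPow q (conjUnit u) = (cubicPow q u)⁻¹ := by
  unfold cubicPow
  split_ifs <;> simp [conjUnit_conjUnit]

lemma conjUnit_cubicPow (q : ℕ) (u : (Eis (ZMod q))ˣ) :
    conjUnit (cubicPow q u) = (cubicPow q u)⁻¹ := by
  rw [← cubicPow_conjUnit]
  unfold cubicPow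
  split_ifs <;> simp [conjUnit_conjUnit]

lemma exists_cubicPow_eq {q : ℕ} (hq : q.Prime) (h3 : q ≠ 3) (u : (Eis (ZMod q))ˣ) :
    ∃ i < 3, (cubicPow q u : Eis (ZMod q)) = om ^ i := by
  have := Fact.mk hq
  apply eq_om_pow_of_cube (three_ne_zero hq h3)
  · rw [← Units.val_pow_eq_pow_val, cubicPow_cube hq h3]; rfl
  · rw [← coe_conjUnit, conjUnit_cubicPow, Units.mul_inv]

/-- The cubic residue symbol modulo a prime `q ≠ 3` as a multiplicative character. -/
def cubicChar (q : ℕ) : MulChar (Eis (ZMod q)) ℂ :=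
  if h : q.Prime ∧ q ≠ 3 then
    MulChar.ofUnitHom (MonoidHom.toHomUnits
      { toFun := fun u => cubeVal (cubicPow q u : Eis (ZMod q))
        map_one' := by simp [cubeVal]
        map_mul' := fun u v => by
          have := Fact.mk h.1
          obtain ⟨i, -, hi⟩ := exists_cubicPow_eq h.1 h.2 u
          obtain ⟨j, -, hj⟩ := exists_cubicPow_eq h.1 h.2 v
          rw [map_mul, Units.val_mul, hi, hj, ← pow_add, cubeVal_om_pow, cubeVal_om_pow,
            cubeVal_om_pow, pow_add] })
  else 1

lemma cubicChar_coe {q : ℕ} (hq : q.Prime) (h3 : q ≠ 3) (u : (Eis (ZMod q))ˣ) :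
    cubicChar q u = cubeVal (cubicPow q u : Eis (ZMod q)) := by
  rw [cubicChar, dif_pos ⟨hq, h3⟩]
  rw [MulChar.ofUnitHom_coe]; rfl

lemma cubicChar_of_om_pow {q : ℕ} (hq : q.Prime) (h3 : q ≠ 3) (u : (Eis (ZMod q))ˣ) {i : ℕ}
    (h : (cubicPow q u : Eis (ZMod q)) = om ^ i) : cubicChar q u = zeta3 ^ i := by
  have := Fact.mk hq
  rw [cubicChar_coe hq h3, h, cubeVal_om_pow]

lemma cubicChar_cube {q : ℕ} {u : Eis (ZMod q)} (hu : IsUnit u) :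
    cubicChar q u ^ 3 = 1 := by
  obtain ⟨u, rfl⟩ := hu
  by_cases h : q.Prime ∧ q ≠ 3
  · obtain ⟨i, -, hi⟩ := exists_cubicPow_eq h.1 h.2 u
    rw [cubicChar_of_om_pow h.1 h.2 u hi, ← pow_mul, mul_comm, pow_mul, zeta3_cube, one_pow]
  · rw [cubicChar, dif_neg h]; simp [MulChar.one_apply_coe]

lemma cubicChar_norm {q : ℕ} {u : Eis (ZMod q)} (hu : IsUnit u) : ‖cubicChar q u‖ = 1 := by
  have := congrArg (fun z : ℂ => ‖z‖) (cubicChar_cube hu)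
  rw [_root_.norm_pow, CStarRing.norm_one] at this
  exact (pow_eq_one_iff_of_nonneg (norm_nonneg _) (by norm_num)).1 this

lemma cubicChar_star {q : ℕ} (u : Eis (ZMod q)) :
    cubicChar q (star u) = (starRingEnd ℂ) (cubicChar q u) := by
  by_cases hu : IsUnit u
  · have hn := cubicChar_norm hu
    have h1 : (starRingEnd ℂ) (cubicChar q u) = (cubicChar q u)⁻¹ := by
      rw [Complex.inv_def, Complex.normSq_eq_norm_sq, hn]; simp
    rw [h1]
    obtain ⟨u, rfl⟩ := hu
    by_cases h : q.Prime ∧ q ≠ 3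
    · have := Fact.mk h.1
      obtain ⟨i, -, hi⟩ := exists_cubicPow_eq h.1 h.2 u
      rw [cubicChar_of_om_pow h.1 h.2 u hi, ← coe_conjUnit]
      have h2 : (cubicPow q (conjUnit u) : Eis (ZMod q)) = om ^ (2 * i) := by
        have h5 : (cubicPow q u)⁻¹ = cubicPow q u ^ 2 :=
          inv_eq_of_mul_eq_one_left (by rw [← pow_succ, cubicPow_cube h.1 h.2])
        rw [cubicPow_conjUnit, h5, Units.val_pow_eq_pow_val, hi, ← pow_mul, mul_comm]
      rw [cubicChar_of_om_pow h.1 h.2 _ h2, eq_comm, inv_eq_iff_eq_inv]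
      apply eq_inv_of_mul_eq_one_left
      rw [← pow_add, show i + 2 * i = 3 * i by ring, pow_mul, zeta3_cube, one_pow]
    · rw [cubicChar, dif_neg h, ← coe_conjUnit]; simp only [MulChar.one_apply_coe, inv_one]
  · rw [MulChar.map_nonunit _ hu, MulChar.map_nonunit, map_zero]
    intro h
    apply hu
    have := h.star
    simpa using this

end Eis

namespace Eis
variable {R S : Type*} [CommRing R] [CommRing S]

lemma cubicPow_coe_eq_one {q : ℕ} (u : (Eis (ZMod q))ˣ) (h : (u : Eis (ZMod q)).im = 0) :
    cubicPow q u = 1 := by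
  have h1 : conjUnit u = u := by
    ext1; rw [coe_conjUnit]; ext <;> simp [h]
  unfold cubicPow
  split_ifs <;> simp [h1]

/-- The cubic symbol is trivial on rational integers. -/
lemma cubicChar_of_im_eq_zero {q : ℕ} {u : Eis (ZMod q)} (hu : IsUnit u) (h : u.im = 0) :
    cubicChar q u = 1 := by
  obtain ⟨u, rfl⟩ := hu
  by_cases hq : q.Prime ∧ q ≠ 3
  · rw [cubicChar_of_om_pow hq.1 hq.2 u (i := 0), pow_zero]
    rw [cubicPow_coe_eq_one u h]; rfl
  · rw [cubicChar, dif_neg hq]; simp [MulChar.one_apply_coe]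

/-- `om` as a unit. -/
def omUnit : (Eis R)ˣ := ⟨om, om ^ 2, by rw [← pow_succ', om_cube], by rw [← pow_succ, om_cube]⟩

lemma omUnit_cube : (omUnit : (Eis R)ˣ) ^ 3 = 1 := by
  ext1; rw [Units.val_pow_eq_pow_val]; exact om_cube

lemma conjUnit_omUnit : conjUnit (omUnit : (Eis R)ˣ) = omUnit⁻¹ := by
  rw [eq_comm, inv_eq_iff_mul_eq_one]
  ext1
  simp only [omUnit, Units.val_mul, coe_conjUnit]
  ext <;> simp [re_one, im_one]

lemma cubicChar_om {q : ℕ} (hq : q.Prime) (h3 : q ≠ 3) :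
    cubicChar q om = zeta3 ^ ((q ^ 2 - 1) / 3) := by
  have h0 : (om : Eis (ZMod q)) = (omUnit : (Eis (ZMod q))ˣ) := rfl
  rw [h0]
  apply cubicChar_of_om_pow hq h3
  rw [h0, ← Units.val_pow_eq_pow_val]
  congr 1
  have hc := omUnit_cube (R := ZMod q)
  rcases mod_three_cases hq h3 with h | h
  · rw [cubicPow_of_mod_one h, conjUnit_omUnit, div_inv_eq_mul, ← pow_two, ← pow_mul]
    obtain ⟨k, hk⟩ : ∃ k, q = 3 * k + 1 := ⟨q / 3, by omega⟩
    have e1 : (q - 1) / 3 = k := by omega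
    have e2 : (q ^ 2 - 1) / 3 = 3 * (k * k) + 2 * k := by
      have : q ^ 2 = 3 * (3 * (k * k) + 2 * k) + 1 := by rw [hk]; ring
      omega
    rw [e1, e2, pow_add, pow_mul _ 3, hc, one_pow, one_mul]
  · rw [cubicPow_of_mod_two h, conjUnit_omUnit]
    obtain ⟨k, hk⟩ : ∃ k, q = 3 * k + 2 := ⟨q / 3, by omega⟩
    have e1 : (q + 1) / 3 = k + 1 := by omega
    have e2 : (q ^ 2 - 1) / 3 = 3 * (k * k + k) + (k + 1) := by
      have : q ^ 2 = 3 * (3 * (k * k + k) + (k + 1)) + 1 := by rw [hk]; ring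
      omega
    have e3 : (omUnit⁻¹ / omUnit : (Eis (ZMod q))ˣ) = omUnit := by
      rw [div_eq_iff_eq_mul, inv_eq_iff_mul_eq_one, ← hc, pow_succ, pow_two, mul_assoc]
    rw [e1, e2, e3, pow_add _ (3 * _), pow_mul _ 3, hc, one_pow, one_mul]

/-- The character modulo `m` built from the cubic symbols of the prime factors of `m`. -/
def chi (m : ℕ) (x : Eis (ZMod m)) : ℂ :=
  ∏ p ∈ m.primeFactors, cubicChar p ⟨x.re.cast, x.im.cast⟩ ^ m.factorization p

/-- Reduction `Eis (ZMod m) → Eis (ZMod d)` for `d ∣ m`. -/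
abbrev redTo {m d : ℕ} (h : d ∣ m) : Eis (ZMod m) →+* Eis (ZMod d) := map (ZMod.castHom h (ZMod d))

lemma redTo_red {m d : ℕ} (h : d ∣ m) (α : Eis ℤ) : redTo h (red m α) = red d α := by
  ext <;> simp

lemma redTo_redTo {m d e : ℕ} (h : d ∣ m) (h' : e ∣ d) (x : Eis (ZMod m)) :
    redTo h' (redTo h x) = redTo (h'.trans h) x := by
  have H : ((ZMod.castHom h' (ZMod e)).comp (ZMod.castHom h (ZMod d))) =
      ZMod.castHom (h'.trans h) (ZMod e) :=
    RingHom.ext_zmod _ _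
  ext
  · exact congrArg (fun f => f x.re) H
  · exact congrArg (fun f => f x.im) H

lemma chi_eq_prod_attach (m : ℕ) (x : Eis (ZMod m)) :
    chi m x = ∏ p ∈ m.primeFactors.attach,
      cubicChar p.1 (redTo (Nat.dvd_of_mem_primeFactors p.2) x) ^ m.factorization p.1 := by
  rw [chi, ← Finset.prod_attach]; rfl

lemma chi_mul (m : ℕ) (x y : Eis (ZMod m)) : chi m (x * y) = chi m x * chi m y := by
  simp only [chi_eq_prod_attach, map_mul, mul_pow, Finset.prod_mul_distrib]

lemma chi_one (m : ℕ) : chi m 1 = 1 := by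
  simp only [chi_eq_prod_attach, map_one, one_pow, Finset.prod_const_one]

lemma chi_norm {m : ℕ} {x : Eis (ZMod m)} (hx : IsUnit x) : ‖chi m x‖ = 1 := by
  rw [chi_eq_prod_attach, norm_prod]
  apply Finset.prod_eq_one
  intro p _
  rw [_root_.norm_pow, cubicChar_norm (hx.map _), one_pow]

lemma chi_cube {m : ℕ} {x : Eis (ZMod m)} (hx : IsUnit x) : chi m x ^ 3 = 1 := by
  rw [chi_eq_prod_attach, ← Finset.prod_pow]
  apply Finset.prod_eq_one
  intro p _
  rw [← pow_mul, mul_comm, pow_mul, cubicChar_cube (hx.map _), one_pow]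

lemma chi_star (m : ℕ) (x : Eis (ZMod m)) : chi m (star x) = (starRingEnd ℂ) (chi m x) := by
  simp only [chi_eq_prod_attach, map_prod, map_pow, map_star, cubicChar_star]

lemma chi_of_im_eq_zero {m : ℕ} {x : Eis (ZMod m)} (hx : IsUnit x) (h : x.im = 0) :
    chi m x = 1 := by
  rw [chi_eq_prod_attach]
  apply Finset.prod_eq_one
  intro p _
  rw [cubicChar_of_im_eq_zero (hx.map _) (by simp [h]), one_pow]

lemma isUnit_zmod_iff {m : ℕ} (hm : m ≠ 0) (a : ZMod m) :
    IsUnit a ↔ ∀ p (h : p ∈ m.primeFactors),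
      ZMod.castHom (Nat.dvd_of_mem_primeFactors h) (ZMod p) a ≠ 0 := by
  obtain ⟨n, rfl⟩ : ∃ n : ℕ, (n : ZMod m) = a := by
    have : NeZero m := ⟨hm⟩
    exact ⟨a.val, ZMod.natCast_zmod_val a⟩
  rw [ZMod.isUnit_iff_coprime]
  constructor
  · intro h p hp
    rw [map_natCast, Ne, ZMod.natCast_eq_zero_iff]
    intro hd
    have := Nat.dvd_gcd hd (Nat.dvd_of_mem_primeFactors hp)
    rw [h] at this
    exact (Nat.prime_of_mem_primeFactors hp).one_lt.ne' (Nat.dvd_one.1 this)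
  · intro h
    apply Nat.coprime_of_dvd
    intro p hp h1 h2
    have := h p (Nat.mem_primeFactors.2 ⟨hp, h2, hm⟩)
    rw [map_natCast, Ne, ZMod.natCast_eq_zero_iff] at this
    exact this h1

lemma isUnit_iff_forall {m : ℕ} (hm : m ≠ 0) (x : Eis (ZMod m)) :
    IsUnit x ↔ ∀ p (h : p ∈ m.primeFactors), IsUnit (redTo (Nat.dvd_of_mem_primeFactors h) x) := by
  rw [isUnit_iff_norm_isUnit, isUnit_zmod_iff hm]
  apply forall_congr'; intro p
  apply forall_congr'; intro h
  have := Fact.mk (Nat.prime_of_mem_primeFactors h)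
  rw [isUnit_iff_norm_isUnit, norm_map, isUnit_iff_ne_zero]

lemma chi_nonunit {m : ℕ} (hm : m ≠ 0) {x : Eis (ZMod m)} (hx : ¬ IsUnit x) : chi m x = 0 := by
  rw [isUnit_iff_forall hm] at hx
  push Not at hx
  obtain ⟨p, hp, hx⟩ := hx
  rw [chi_eq_prod_attach]
  apply Finset.prod_eq_zero (Finset.mem_attach _ ⟨p, hp⟩)
  rw [MulChar.map_nonunit _ hx, zero_pow]
  exact (Nat.prime_of_mem_primeFactors hp).factorization_pos_of_dvd hm
    (Nat.dvd_of_mem_primeFactors hp) |>.ne'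

lemma chi_coprime_mul {m n : ℕ} (h : m.Coprime n) (x : Eis (ZMod (m * n))) :
    chi (m * n) x = chi m (redTo (Dvd.intro _ rfl) x) * chi n (redTo (Dvd.intro_left _ rfl) x) := by
  rcases eq_or_ne m 0 with rfl | hm
  · have : n = 1 := by simpa using h
    subst this; simp [chi]
  rcases eq_or_ne n 0 with rfl | hn
  · have : m = 1 := by simpa using h
    subst this; simp [chi]
  rw [chi, h.primeFactors_mul, Finset.prod_union h.disjoint_primeFactors, chi, chi]
  congr 1
  · apply Finset.prod_congr rfl
    intro p hp
    have e1 : n.factorization p = 0 := by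
      apply Nat.factorization_eq_zero_of_not_dvd
      intro hd
      have := Nat.dvd_gcd (Nat.dvd_of_mem_primeFactors hp) hd
      rw [h] at this
      exact (Nat.prime_of_mem_primeFactors hp).one_lt.ne' (Nat.dvd_one.1 this)
    rw [Nat.factorization_mul hm hn, Finsupp.add_apply, e1, add_zero]
    congr 2
    have := redTo_redTo (Dvd.intro n rfl : m ∣ m * n) (Nat.dvd_of_mem_primeFactors hp) x
    exact this.symm
  · apply Finset.prod_congr rfl
    intro p hp
    have e1 : m.factorization p = 0 := by
      apply Nat.factorization_eq_zero_of_not_dvd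
      intro hd
      have := Nat.dvd_gcd hd (Nat.dvd_of_mem_primeFactors hp)
      rw [h] at this
      exact (Nat.prime_of_mem_primeFactors hp).one_lt.ne' (Nat.dvd_one.1 this)
    rw [Nat.factorization_mul hm hn, Finsupp.add_apply, e1, zero_add]
    congr 2
    have := redTo_redTo (Dvd.intro_left m rfl : n ∣ m * n) (Nat.dvd_of_mem_primeFactors hp) x
    exact this.symm

lemma chi_red (m : ℕ) (α : Eis ℤ) :
    chi m (red m α) = ∏ p ∈ m.primeFactors, cubicChar p (red p α) ^ m.factorization p := by
  rw [chi_eq_prod_attach, ← Finset.prod_attach m.primeFactors]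
  apply Finset.prod_congr rfl
  intro p _
  rw [redTo_red]

lemma zeta3_pow_mul {a b : ℕ} (ha : a % 3 = 1) (hb : b % 3 = 1) :
    zeta3 ^ ((a * b - 1) / 3) = zeta3 ^ ((a - 1) / 3) * zeta3 ^ ((b - 1) / 3) := by
  obtain ⟨k, rfl⟩ : ∃ k, a = 3 * k + 1 := ⟨a / 3, by omega⟩
  obtain ⟨l, rfl⟩ : ∃ k, b = 3 * k + 1 := ⟨b / 3, by omega⟩
  have : (3 * k + 1) * (3 * l + 1) = 3 * (3 * (k * l) + (k + l)) + 1 := by ring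
  rw [this]
  simp only [Nat.add_sub_cancel, Nat.mul_div_cancel_left _ (show 0 < 3 by norm_num)]
  rw [pow_add, pow_mul, zeta3_cube, one_pow, one_mul, pow_add]

lemma zeta3_pow_pow {a : ℕ} (ha : a % 3 = 1) (k : ℕ) :
    zeta3 ^ ((a ^ k - 1) / 3) = (zeta3 ^ ((a - 1) / 3)) ^ k := by
  induction k with
  | zero => simp
  | succ k ih =>
    rw [pow_succ, zeta3_pow_mul (by rw [Nat.pow_mod, ha]; simp) ha, ih, pow_succ]

lemma sq_mod_three {a : ℕ} (h : ¬ 3 ∣ a) : a ^ 2 % 3 = 1 := by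
  have : a % 3 = 1 ∨ a % 3 = 2 := by omega
  rcases this with h | h <;> rw [Nat.pow_mod, h]

lemma chi_om {m : ℕ} (hm : ¬ 3 ∣ m) : chi m om = zeta3 ^ ((m ^ 2 - 1) / 3) := by
  have h0 : m ≠ 0 := by rintro rfl; simp at hm
  have e : (om : Eis (ZMod m)) = red m om := by ext <;> simp
  rw [e, chi_red]
  conv_rhs => rw [← Nat.prod_factorization_pow_eq_self h0, Finsupp.prod,
    Nat.support_factorization, ← Finset.prod_pow]
  have key : ∀ s ⊆ m.primeFactors, (∏ p ∈ s, (p ^ m.factorization p) ^ 2) % 3 = 1 ∧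
      ∏ p ∈ s, cubicChar p (red p om) ^ m.factorization p =
      zeta3 ^ ((∏ p ∈ s, (p ^ m.factorization p) ^ 2 - 1) / 3) := by
    intro s
    induction s using Finset.induction_on with
    | empty => intro; simp
    | insert p s hps ih =>
      intro hs
      obtain ⟨i1, i2⟩ := ih ((Finset.subset_insert _ _).trans hs)
      have hp := hs (Finset.mem_insert_self _ _)
      have hpp := Nat.prime_of_mem_primeFactors hp
      have hp3 : p ≠ 3 := by rintro rfl; exact hm (Nat.dvd_of_mem_primeFactors hp)
      have hd : ¬ 3 ∣ p := fun h => hp3 ((Nat.prime_dvd_prime_iff_eq Nat.prime_three hpp).1 h).symm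
      have h1 : (p ^ m.factorization p) ^ 2 % 3 = 1 :=
        sq_mod_three (fun h => hd (Nat.prime_three.dvd_of_dvd_pow h))
      rw [Finset.prod_insert hps, Finset.prod_insert hps]
      refine ⟨by rw [Nat.mul_mod, h1, i1], ?_⟩
      rw [zeta3_pow_mul h1 i1, ← i2]
      congr 1
      rw [← pow_mul, mul_comm _ 2, pow_mul, zeta3_pow_pow (sq_mod_three hd)]
      congr 1
      rw [← cubicChar_om hpp hp3]
      congr 1
      ext <;> simp
  exact (key _ subset_rfl).2

end Eis

section GaussSums

variable {p q : ℕ} [hp : Fact p.Prime] [hq : Fact q.Prime] {F : Type*} [Field F] [CharP F q]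

lemma MulChar.apply_neg_one_of_orderOf_eq_three {R : Type*} [CommRing R] {χ : MulChar (ZMod p) R}
    (h : orderOf χ = 3) : χ (-1) = 1 := by
  have h1 : χ (-1) ^ 3 = 1 := by
    rw [← MulChar.pow_apply' χ (by norm_num), ← h, pow_orderOf_eq_one]
    exact MulChar.one_apply (isUnit_one.neg)
  have h2 : χ (-1) ^ 2 = 1 := by rw [← map_pow]; simp
  rw [pow_succ, h2, one_mul] at h1; exact h1

lemma gaussSum_iterate_frob (χ : MulChar (ZMod p) F) (ψ : AddChar (ZMod p) F) (k : ℕ) :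
    gaussSum χ ψ ^ (q ^ k) = gaussSum (χ ^ (q ^ k)) (ψ ^ (q ^ k)) := by
  induction k with
  | zero => simp
  | succ k ih => rw [pow_succ, pow_mul, ih, gaussSum_frob, pow_mul, pow_mul]

lemma card_mul_jacobiSum_pow (hpq : p ≠ q) {χ : MulChar (ZMod p) F} (hχ : orderOf χ = 3)
    {ψ : AddChar (ZMod p) F} (hψ : ψ.IsPrimitive) {k : ℕ} (hk : q ^ k % 3 = 1) :
    ((p : F) * jacobiSum χ χ) ^ ((q ^ k - 1) / 3) = χ ((q : ZMod p) ^ k) ^ 2 := by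
  have h3 : gaussSum χ ψ ^ 3 = (p : F) * jacobiSum χ χ := by
    have := gaussSum_pow_eq_prod_jacobiSum (χ := χ) (ψ := ψ) (by omega) hψ
    rw [hχ, MulChar.apply_neg_one_of_orderOf_eq_three hχ] at this
    simpa [ZMod.card] using this
  have hpF : (p : F) ≠ 0 := by
    rw [Ne, CharP.cast_eq_zero_iff F q]
    exact fun h => hpq ((Nat.prime_dvd_prime_iff_eq hq.1 hp.1).1 h).symm
  have hχ1 : χ ≠ 1 := by rintro rfl; simp at hχ
  have h0 : gaussSum χ ψ ≠ 0 :=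
    gaussSum_ne_zero_of_nontrivial (by rwa [ZMod.card]) hχ1 hψ
  have hqp : IsUnit ((q : ZMod p) ^ k) := by
    apply IsUnit.pow
    rw [isUnit_iff_ne_zero, Ne, ZMod.natCast_eq_zero_iff]
    exact fun h => hpq ((Nat.prime_dvd_prime_iff_eq hp.1 hq.1).1 h)
  have hN := gaussSum_iterate_frob (q := q) χ ψ k
  have e1 : χ ^ (q ^ k) = χ := by
    conv_lhs => rw [← Nat.div_add_mod (q ^ k) 3, hk, pow_succ, pow_mul, ← hχ, pow_orderOf_eq_one]
    simp
  have e2 : ψ ^ (q ^ k) = ψ.mulShift (hqp.unit : ZMod p) := by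
    ext a; rw [AddChar.pow_apply, AddChar.mulShift_apply, ← AddChar.map_nsmul_eq_pow]
    congr 1; simp
  rw [e1, e2, gaussSum_mulShift_eq] at hN
  have e3 : χ⁻¹ = χ ^ 2 := by
    rw [eq_comm, ← mul_eq_one_iff_eq_inv, ← pow_succ]
    have h := pow_orderOf_eq_one χ
    rw [hχ] at h; exact h
  rw [e3, MulChar.pow_apply' _ (by norm_num), hqp.unit_spec] at hN
  have h1 : 1 ≤ q ^ k := Nat.one_le_pow _ _ hq.1.pos
  have e4 : q ^ k = 3 * ((q ^ k - 1) / 3) + 1 := by omega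
  rw [e4, pow_succ, pow_mul, h3] at hN
  exact mul_right_cancel₀ h0 hN

end GaussSums

namespace Eis

/-- Evaluation of Eisenstein integers at a root of `X ^ 2 + X + 1`. -/
def eval {A : Type*} [CommRing A] {R : Type*} [CommRing R] (f : R →+* A) (z : A)
    (hz : z * z = -1 - z) : Eis R →+* A where
  toFun x := f x.re + f x.im * z
  map_one' := by simp [re_one, im_one]
  map_mul' x y := by
    simp only [re_mul, im_mul, map_add, map_mul, map_neg, map_one]
    linear_combination (- f x.im * f y.im) * hz
  map_zero' := by simp
  map_add' x y := by simp; ring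

lemma eval_apply {A : Type*} [CommRing A] {R : Type*} [CommRing R] (f : R →+* A) (z : A)
    (hz : z * z = -1 - z) (x : Eis R) : eval f z hz x = f x.re + f x.im * z := rfl

lemma zeta3_mul_self : zeta3 * zeta3 = -1 - zeta3 := by
  have h := zeta3_primitive.geom_sum_eq_zero (by norm_num)
  simp [Finset.sum_range_succ] at h
  linear_combination h

/-- The embedding of the Eisenstein integers in `ℂ`. -/
def toC : Eis ℤ →+* ℂ := eval (Int.castRingHom ℂ) zeta3 zeta3_mul_self

lemma toC_om : toC om = zeta3 := by simp [toC, eval_apply]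

lemma conj_zeta3 : (starRingEnd ℂ) zeta3 = zeta3 ^ 2 := by
  have hn : ‖zeta3‖ = 1 := zeta3_primitive.norm'_eq_one (by norm_num)
  have h1 : (starRingEnd ℂ) zeta3 = zeta3⁻¹ := by
    rw [Complex.inv_def, Complex.normSq_eq_norm_sq, hn]; simp
  rw [h1, inv_eq_of_mul_eq_one_left]
  rw [← pow_succ, zeta3_cube]

lemma toC_star (x : Eis ℤ) : toC (star x) = (starRingEnd ℂ) (toC x) := by
  simp only [toC, eval_apply, map_add, map_mul, conj_zeta3]
  simp
  linear_combination (- (x.im : ℂ)) * zeta3_mul_self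

lemma norm_nonneg (x : Eis ℤ) : 0 ≤ norm x := by
  rw [norm_eq]; nlinarith [sq_nonneg (2 * x.re - x.im), sq_nonneg x.im]

lemma norm_eq_zero_iff (x : Eis ℤ) : norm x = 0 ↔ x = 0 := by
  refine ⟨fun h => ?_, fun h => by simp [h]⟩
  rw [norm_eq] at h
  have h1 : x.im = 0 := by nlinarith [sq_nonneg (2 * x.re - x.im), sq_nonneg x.im]
  have h2 : x.re = 0 := by rw [h1] at h; nlinarith
  ext <;> simp [h1, h2]

lemma toC_injective : Function.Injective toC := by
  rw [injective_iff_map_eq_zero]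
  intro x hx
  have h : toC (x * star x) = 0 := by rw [map_mul, hx, zero_mul]
  rw [mul_star_self, toC, eval_apply] at h
  simp at h
  exact (norm_eq_zero_iff x).1 h

instance : IsDomain (Eis ℤ) := toC_injective.isDomain

lemma om_primitive {R : Type*} [CommRing R] [Nontrivial R] : IsPrimitiveRoot (om : Eis R) 3 := by
  apply IsPrimitiveRoot.mk_of_lt _ (by norm_num) om_cube
  intro l h0 h3
  have h1 : (om : Eis R) ≠ 1 := by
    intro h; have := congrArg QuadraticAlgebra.im h; simp [im_one] at this
  interval_cases l
  · simpa using h1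
  · rw [om_sq]
    intro h; have := congrArg QuadraticAlgebra.im h; simp [im_one] at this

lemma eq_zero_of_eval {F : Type*} [Field F] {R : Type*} [CommRing R] {f : R →+* F}
    (hf : Function.Injective f) {z : F} (hz : IsPrimitiveRoot z 3)
    (h1 : z * z = -1 - z) (h2 : z ^ 2 * z ^ 2 = -1 - z ^ 2) (x y : Eis R)
    (e1 : eval f z h1 x = eval f z h1 y) (e2 : eval f _ h2 x = eval f _ h2 y) : x = y := by
  rw [eval_apply, eval_apply] at e1 e2
  have hne : z ^ 2 ≠ z := by
    intro h
    have h0 : z ≠ 0 := hz.ne_zero (by norm_num)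
    have : z = 1 := by
      have : z * z = z * 1 := by rw [← sq, h, mul_one]
      exact mul_left_cancel₀ h0 this
    exact hz.ne_one (by norm_num) this
  have h3 : (f x.im - f y.im) * (z ^ 2 - z) = 0 := by linear_combination e2 - e1
  have h4 : f x.im = f y.im :=
    sub_eq_zero.1 ((mul_eq_zero.1 h3).resolve_right (sub_ne_zero.2 hne))
  rw [h4] at e1
  ext
  · exact hf (add_right_cancel e1)
  · exact hf h4

lemma toMulChar_ringHomComp_orderOf {p : ℕ} {R S : Type*} [CommRing R]
    [CommRing S] {χ : MulChar (ZMod p) R} (hχ : χ ^ 3 = 1) {f : R →+* S} (h1 : χ.ringHomComp f ≠ 1) :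
    orderOf (χ.ringHomComp f) = 3 := by
  apply orderOf_eq_prime _ h1
  ext a
  have := congrArg (fun c : MulChar (ZMod p) R => f (c a)) hχ
  simpa [MulChar.pow_apply_coe, MulChar.ringHomComp_apply] using this

section Reciprocity

variable {p q : ℕ} [hp : Fact p.Prime]

lemma exists_apply_eq_om_pow {χ : MulChar (ZMod p) (Eis ℤ)} (hχ : χ ^ 3 = 1)
    (a : (ZMod p)ˣ) : ∃ i < 3, χ a = om ^ i := by
  have h : χ a ^ 3 = 1 := by
    have := congrArg (fun c : MulChar (ZMod p) (Eis ℤ) => c a) hχ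
    simpa [MulChar.pow_apply_coe] using this
  obtain ⟨i, hi, h⟩ := om_primitive.eq_pow_of_pow_eq_one h
  exact ⟨i, hi, h.symm⟩

lemma red_om_pow {n : ℕ} (i : ℕ) : red n (om ^ i) = om ^ i := by
  rw [map_pow]; congr 1; ext <;> simp

/-- Evaluation of the residue symbol of a Jacobi sum, before taking ratios. -/
lemma card_mul_jacobiSum_red_pow [hq : Fact q.Prime] (h3 : q ≠ 3) (hpq : p ≠ q)
    {χ : MulChar (ZMod p) (Eis ℤ)} (hχ : orderOf χ = 3) {k : ℕ} (hk : q ^ k % 3 = 1) :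
    red q ((p : Eis ℤ) * jacobiSum χ χ) ^ ((q ^ k - 1) / 3) =
      red q (χ ((q : ZMod p) ^ k) ^ 2) := by
  let F := AlgebraicClosure (ZMod q)
  let f : ZMod q →+* F := algebraMap (ZMod q) F
  have : CharP F q := charP_of_injective_algebraMap f.injective q
  have h3F : ((3 : ℕ) : F) ≠ 0 := by
    rw [Ne, CharP.cast_eq_zero_iff F q]
    exact fun h => h3 ((Nat.prime_dvd_prime_iff_eq hq.1 Nat.prime_three).1 h)
  have hpF : ((p : ℕ) : F) ≠ 0 := by
    rw [Ne, CharP.cast_eq_zero_iff F q]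
    exact fun h => hpq ((Nat.prime_dvd_prime_iff_eq hq.1 hp.1).1 h).symm
  have : NeZero ((3 : ℕ) : F) := ⟨h3F⟩
  have : NeZero ((p : ℕ) : F) := ⟨hpF⟩
  obtain ⟨z, hz⟩ : ∃ z : F, IsPrimitiveRoot z 3 := HasEnoughRootsOfUnity.exists_primitiveRoot F 3
  obtain ⟨y, hy⟩ : ∃ z : F, IsPrimitiveRoot z p := HasEnoughRootsOfUnity.exists_primitiveRoot F p
  have root : ∀ z : F, IsPrimitiveRoot z 3 → z * z = -1 - z := by
    intro z hz
    have h := hz.geom_sum_eq_zero (by norm_num)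
    simp [Finset.sum_range_succ] at h
    linear_combination h
  have hz2 : IsPrimitiveRoot (z ^ 2) 3 := hz.pow_of_coprime 2 (by norm_num)
  have key : ∀ z : F, ∀ hz : IsPrimitiveRoot z 3,
      eval f z (root z hz) (red q ((p : Eis ℤ) * jacobiSum χ χ) ^ ((q ^ k - 1) / 3)) =
      eval f z (root z hz) (red q (χ ((q : ZMod p) ^ k) ^ 2)) := by
    intro z hz
    let g : Eis ℤ →+* F := (eval f z (root z hz)).comp (red q)
    have hg : ∀ x, eval f z (root z hz) (red q x) = g x := fun x => rfl
    have hgo : g om = z := by simp [g, eval_apply]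
    have hχ3 : χ ^ 3 = 1 := by rw [← hχ, pow_orderOf_eq_one]
    have h1 : χ.ringHomComp g ≠ 1 := by
      intro h
      have : χ = 1 := by
        refine MulChar.ext fun a => ?_
        obtain ⟨i, hi, hia⟩ := exists_apply_eq_om_pow hχ3 a
        have h2 : g (χ a) = 1 := by
          rw [← MulChar.ringHomComp_apply, h, MulChar.one_apply_coe]
        rw [hia, map_pow, hgo] at h2
        have : i = 0 := by
          apply hz.pow_inj hi (by norm_num); rw [h2, pow_zero]
        rw [hia, this, pow_zero, MulChar.one_apply_coe]
      rw [this] at hχ; simp at hχ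
    have := card_mul_jacobiSum_pow (q := q) hpq (toMulChar_ringHomComp_orderOf hχ3 h1)
      (AddChar.zmodChar_primitive_of_primitive_root p hy) hk
    rw [jacobiSum_ringHomComp, MulChar.ringHomComp_apply] at this
    rw [map_pow, hg, hg, map_mul, map_natCast, this]
    exact (map_pow g _ 2).symm
  exact eq_zero_of_eval f.injective hz (root z hz) (root _ hz2) _ _ (key z hz) (key _ hz2)

end Reciprocity

end Eis

namespace Eis

section Reciprocity

lemma toMulChar_nontrivial {p : ℕ} [Fact p.Prime] {χ : MulChar (ZMod p) (Eis ℤ)}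
    (hχ : orderOf χ = 3) : orderOf (χ.ringHomComp toC) = 3 := by
  have hχ3 : χ ^ 3 = 1 := by rw [← hχ, pow_orderOf_eq_one]
  apply toMulChar_ringHomComp_orderOf hχ3
  intro h
  have : χ = 1 := by
    refine MulChar.ext fun a => toC_injective ?_
    rw [← MulChar.ringHomComp_apply, h]
    simp
  rw [this] at hχ; simp at hχ

lemma norm_jacobiSum {p : ℕ} [hp : Fact p.Prime]
    {χ : MulChar (ZMod p) (Eis ℤ)} (hχ : orderOf χ = 3) : norm (jacobiSum χ χ) = p := by
  have hC := toMulChar_nontrivial hχ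
  set ψ := χ.ringHomComp toC with hψ
  have hψ1 : ψ ≠ 1 := by rintro h; rw [h] at hC; simp at hC
  have hψ2 : ψ ^ 2 ≠ 1 := by
    intro h; have := orderOf_dvd_of_pow_eq_one h; rw [hC] at this; omega
  have h : toC (jacobiSum χ χ * star (jacobiSum χ χ)) = toC (p : Eis ℤ) := by
    have e : (starRingEnd ℂ) (toC (jacobiSum χ χ)) = jacobiSum ψ⁻¹ ψ⁻¹ := by
      rw [← jacobiSum_ringHomComp, ← jacobiSum_ringHomComp]
      congr 1 <;>
      · refine MulChar.ext fun a => ?_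
        exact MulChar.star_apply' ψ a
    rw [map_mul, toC_star, e, ← jacobiSum_ringHomComp, ← hψ, map_natCast]
    have := jacobiSum_mul_jacobiSum_inv (F := ZMod p) (F' := ℂ) (by
      rw [ZMod.ringChar_zmod_n]
      rw [ringChar.eq_zero (R := ℂ)]; exact hp.1.ne_zero.symm) hψ1 hψ1 (by rwa [← sq])
    simpa [ZMod.card] using this
  have h := toC_injective h
  rw [mul_star_self] at h
  have := congrArg QuadraticAlgebra.re h
  simpa using this

lemma exists_char_of_split {p : ℕ} [hp : Fact p.Prime] (hp1 : p % 3 = 1) :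
    ∃ (π : Eis ℤ) (χ : MulChar (ZMod p) ℂ), norm π = p ∧ (3 : Eis ℤ) ∣ π + 1 ∧
      orderOf χ = 3 ∧ ∀ q : ℕ, q.Prime → q ≠ 3 → cubicChar q (red q π) = χ q := by
  obtain ⟨χ, hχ⟩ : ∃ χ : MulChar (ZMod p) (Eis ℤ), orderOf χ = 3 :=
    MulChar.exists_mulChar_orderOf (ZMod p) (by rw [ZMod.card]; omega) om_primitive
  have hχ3 : χ ^ 3 = 1 := by rw [← hχ, pow_orderOf_eq_one]
  have hN := norm_jacobiSum hχ
  refine ⟨jacobiSum χ χ, χ.ringHomComp toC, hN, ?_, ?_, ?_⟩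
  · obtain ⟨z, -, hz⟩ := exists_jacobiSum_eq_neg_one_add (F := ZMod p) (n := 3) (by norm_num)
      (μ := (om : Eis ℤ)) hχ3 hχ3 (by rw [ZMod.card]; omega) om_primitive
    rw [hz]
    refine ⟨-om * z, ?_⟩
    have : (om : Eis ℤ) * om = -1 - om := by ext <;> simp [re_one, im_one]
    linear_combination z * this
  · exact toMulChar_nontrivial hχ
  · intro q hq h3
    have hqf := Fact.mk hq
    by_cases hpq : p = q
    · subst hpq
      rw [MulChar.map_nonunit, MulChar.map_nonunit]
      · simp
      · rw [isUnit_iff_norm_isUnit, norm_map, hN]; simp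
    have hu : IsUnit (red q (jacobiSum χ χ)) := by
      rw [isUnit_iff_norm_isUnit, norm_map, hN, isUnit_iff_ne_zero]
      simp only [Int.cast_natCast, eq_intCast, Ne, ZMod.natCast_eq_zero_iff]
      exact fun h => hpq ((Nat.prime_dvd_prime_iff_eq hq hp.1).1 h).symm
    have hup : IsUnit ((p : ZMod q)) := by
      rw [isUnit_iff_ne_zero, Ne, ZMod.natCast_eq_zero_iff]
      exact fun h => hpq ((Nat.prime_dvd_prime_iff_eq hq hp.1).1 h).symm
    have hup' : IsUnit ((p : Eis (ZMod q))) := by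
      have := hup.map (algebraMap (ZMod q) (Eis (ZMod q)))
      simpa using this
    have hqp : IsUnit (q : ZMod p) := by
      rw [isUnit_iff_ne_zero, Ne, ZMod.natCast_eq_zero_iff]
      exact fun h => hpq ((Nat.prime_dvd_prime_iff_eq hp.1 hq).1 h)
    obtain ⟨i, hi, hqi⟩ := exists_apply_eq_om_pow hχ3 hqp.unit
    rw [hqp.unit_spec] at hqi
    have hcp : cubicChar q (p : Eis (ZMod q)) = 1 :=
      cubicChar_of_im_eq_zero (by simpa using hup') (by simp)
    have hmul : cubicChar q (red q (jacobiSum χ χ)) =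
        cubicChar q (red q ((p : Eis ℤ) * jacobiSum χ χ)) := by
      rw [map_mul, map_mul, map_natCast, hcp, one_mul]
    obtain ⟨u, hu'⟩ : IsUnit (red q ((p : Eis ℤ) * jacobiSum χ χ)) := by
      rw [map_mul, map_natCast]; exact hup'.mul hu
    rw [hmul, ← hu', MulChar.ringHomComp_apply, hqi, map_pow, toC_om]
    apply cubicChar_of_om_pow hq h3
    rcases mod_three_cases hq h3 with h | h
    · have key := card_mul_jacobiSum_red_pow (k := 1) h3 hpq hχ (by simpa using h)
      rw [pow_one, pow_one, ← hu', hqi, map_pow, red_om_pow, ← pow_mul] at key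
      have key' := congrArg star key
      rw [cubicPow_of_mod_one h]
      have e : u ^ ((q - 1) / 3) = omUnit ^ (i * 2) := by
        ext1; simpa [omUnit] using key
      have e2 : conjUnit (omUnit : (Eis (ZMod q))ˣ) = omUnit ^ 2 := by
        ext1; simp only [omUnit, coe_conjUnit, Units.val_pow_eq_pow_val]; rw [om_sq]
        ext <;> simp
      have e3 : (omUnit : (Eis (ZMod q))ˣ) ^ 3 = 1 := by
        ext1; simp [omUnit]; exact om_cube
      have e4 : (u / conjUnit u) ^ ((q - 1) / 3) = (omUnit : (Eis (ZMod q))ˣ) ^ i := by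
        rw [div_pow, ← map_pow, e, map_pow, e2, div_eq_iff_eq_mul, ← pow_mul, ← pow_add]
        have : 2 * (i * 2) + i = i * 2 + 3 * i := by ring
        rw [add_comm i, this, pow_add, pow_mul _ 3, e3]; simp
      rw [e4]
      simp [omUnit]
    · have key := card_mul_jacobiSum_red_pow (k := 2) h3 hpq hχ (by rw [Nat.pow_mod, h])
      rw [map_pow χ, hqi, ← hu', ← pow_mul, ← pow_mul, red_om_pow] at key
      rw [cubicPow_of_mod_two h]
      have e0 : (q ^ 2 - 1) / 3 = (q - 1) * ((q + 1) / 3) := by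
        apply Nat.div_eq_of_eq_mul_right (by norm_num)
        have : 3 * ((q + 1) / 3) = q + 1 := by omega
        rw [mul_left_comm, this, mul_comm, ← Nat.sq_sub_sq]
      have e1 : u ^ q = conjUnit u := by
        ext1; rw [Units.val_pow_eq_pow_val, pow_prime hq h3, if_neg (by omega)]; rfl
      have e2 : u ^ (q - 1) = conjUnit u / u := by
        rw [eq_div_iff_mul_eq', ← e1, ← pow_succ, Nat.sub_add_cancel hq.one_le]
      have e4 : ((conjUnit u / u) ^ ((q + 1) / 3) : (Eis (ZMod q))ˣ) = omUnit ^ i := by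
        rw [← e2, ← pow_mul, ← e0]
        ext1
        rw [Units.val_pow_eq_pow_val, key]
        simp only [omUnit, Units.val_pow_eq_pow_val]
        have : i * (2 * 2) = 3 * i + i := by ring
        rw [this, pow_add, pow_mul, om_cube]; simp
      rw [e4]
      simp [omUnit]

end Reciprocity

end Eis

namespace Eis

lemma natCast_dvd_iff (n : ℕ) (x : Eis ℤ) : (n : Eis ℤ) ∣ x ↔ (n : ℤ) ∣ x.re ∧ (n : ℤ) ∣ x.im := by
  constructor
  · rintro ⟨z, rfl⟩; simp
  · rintro ⟨⟨a, ha⟩, ⟨b, hb⟩⟩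
    exact ⟨⟨a, b⟩, by ext <;> simp [ha, hb]⟩

lemma red_eq_zero_iff (n : ℕ) (x : Eis ℤ) : red n x = 0 ↔ (n : Eis ℤ) ∣ x := by
  rw [natCast_dvd_iff, QuadraticAlgebra.ext_iff]
  simp [ZMod.intCast_zmod_eq_zero_iff_dvd]

/-- An inert prime dividing the norm divides the element. -/
lemma natCast_dvd_of_dvd_norm {p : ℕ} (hp : p.Prime) (h2 : p % 3 = 2) {x : Eis ℤ}
    (h : (p : ℤ) ∣ norm x) : (p : Eis ℤ) ∣ x := by
  have := Fact.mk hp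
  rw [← red_eq_zero_iff]
  have h3 : p ≠ 3 := by omega
  have hz : red p x * star (red p x) = 0 := by
    rw [mul_star_self, norm_map]
    have : ((norm x : ℤ) : ZMod p) = 0 := by rwa [ZMod.intCast_zmod_eq_zero_iff_dvd]
    simp [this]
  have hf := pow_prime hp h3 (red p x)
  rw [if_neg (by omega)] at hf
  rw [← hf, ← pow_succ'] at hz
  have hsq := pow_prime_sq hp h3 (red p x)
  rw [← hsq]
  have : p + 1 ≤ p ^ 2 := by nlinarith [hp.two_le]
  rw [← Nat.sub_add_cancel this, pow_add, hz, mul_zero]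

/-- A prime above a split prime dividing the norm, or its conjugate, divides the element. -/
lemma dvd_or_star_dvd_of_dvd_norm {p : ℕ} (hp : p.Prime) {π x : Eis ℤ} (hπ : norm π = p)
    (h : (p : ℤ) ∣ norm x) : π ∣ x ∨ star π ∣ x := by
  have hpz : Prime (p : ℤ) := Nat.prime_iff_prime_int.1 hp
  have key : ∀ σ : Eis ℤ, norm σ = p → (p : ℤ) ∣ (x * star σ).im → σ ∣ x := by
    intro σ hσ h1
    have hb : ¬ (p : ℤ) ∣ σ.im := by
      rintro ⟨b, hb⟩
      have h2 : (p : ℤ) ∣ σ.re ^ 2 := by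
        rw [norm_eq, hb] at hσ
        exact ⟨1 + σ.re * b - p * b ^ 2, by linear_combination hσ⟩
      obtain ⟨a, ha⟩ := hpz.dvd_of_dvd_pow h2
      rw [norm_eq, ha, hb] at hσ
      have : (p : ℤ) * (p * (a ^ 2 - a * b + b ^ 2)) = p * 1 := by linear_combination hσ
      have := mul_left_cancel₀ hpz.ne_zero this
      exact hpz.not_isUnit (IsUnit.of_mul_eq_one _ this)
    have h2 : (p : ℤ) ∣ (x * star σ).re := by
      apply (hpz.dvd_or_dvd (a := σ.im) _).resolve_left hb
      rw [norm_eq] at hσ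
      obtain ⟨c, hc⟩ := h1
      simp at hc ⊢
      exact ⟨x.im - (σ.re - σ.im) * c, by linear_combination x.im * hσ - (σ.re - σ.im) * hc⟩
    obtain ⟨z, hz⟩ := (natCast_dvd_iff p _).2 ⟨h2, h1⟩
    refine ⟨z, ?_⟩
    have h0 : star σ ≠ 0 := by
      intro h0
      have : norm (star σ) = 0 := by rw [h0]; simp
      rw [QuadraticAlgebra.norm_star, hσ] at this
      exact hpz.ne_zero this
    apply mul_right_cancel₀ h0
    rw [hz, mul_right_comm, mul_star_self, hσ]
    simp
  have hd : (p : ℤ) ∣ (x * star π).im * (x * star (star π)).im := by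
    obtain ⟨c, hc⟩ := h
    rw [norm_eq] at hπ hc
    simp
    exact ⟨-π.im ^ 2 * c + x.im ^ 2, by
      linear_combination (-π.im ^ 2) * hc + x.im ^ 2 * hπ⟩
  rcases hpz.dvd_or_dvd hd with h | h
  · exact Or.inl (key π hπ h)
  · exact Or.inr (key _ (by rw [QuadraticAlgebra.norm_star, hπ]) h)

lemma norm_mod_three {x : Eis ℤ} (h : (3 : Eis ℤ) ∣ x + 1 ∨ (3 : Eis ℤ) ∣ x - 1) :
    norm x % 3 = 1 := by
  have e : (3 : Eis ℤ) = (3 : ℕ) := by norm_num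
  rw [e, natCast_dvd_iff, natCast_dvd_iff] at h
  rw [norm_eq]
  have : x.im % 3 = 0 ∧ (x.re % 3 = 1 ∨ x.re % 3 = 2) := by
    rcases h with ⟨h1, h2⟩ | ⟨h1, h2⟩ <;> simp [re_one, im_one] at h1 h2 <;> omega
  obtain ⟨⟨a, ha⟩, hb⟩ : (∃ a, x.im = 3 * a) ∧ _ := ⟨⟨x.im / 3, by omega⟩, this.2⟩
  obtain ⟨b, hb⟩ : ∃ b, x.re = 3 * b + 1 ∨ x.re = 3 * b + 2 := ⟨x.re / 3, by omega⟩
  rw [ha]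
  rcases hb with hb | hb <;> rw [hb] <;> ring_nf <;> omega

/-- Primitive primary Eisenstein integers. -/
structure IsPrimary (y : Eis ℤ) : Prop where
  primitive : ∀ p : ℕ, p.Prime → ¬ (p : Eis ℤ) ∣ y
  mod_three : (3 : Eis ℤ) ∣ y + 1 ∨ (3 : Eis ℤ) ∣ y - 1

lemma IsPrimary.ne_zero {y : Eis ℤ} (h : IsPrimary y) : y ≠ 0 := by
  rintro rfl; exact h.primitive 2 Nat.prime_two (dvd_zero _)

lemma isUnit_red_iff {q : ℕ} (hq : q.Prime) (x : Eis ℤ) :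
    IsUnit (red q x) ↔ ¬ (q : ℤ) ∣ norm x := by
  have := Fact.mk hq
  rw [isUnit_iff_norm_isUnit, norm_map, isUnit_iff_ne_zero, Ne, ← ZMod.intCast_zmod_eq_zero_iff_dvd]
  rfl

/-- Cubic reciprocity: the residue symbol of a primitive primary number is a Dirichlet
character. -/
lemma IsPrimary.exists_char {y : Eis ℤ} (hy : IsPrimary y) :
    ∃ X : DirichletCharacter ℂ (norm y).natAbs,
      ∀ q : ℕ, q.Prime → q ≠ 3 → cubicChar q (red q y) = X q := by
  induction hn : (norm y).natAbs using Nat.strong_induction_on generalizing y with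
  | _ n ih =>
  have hnn : norm y = n := by rw [← hn, Int.natCast_natAbs, abs_of_nonneg (norm_nonneg y)]
  by_cases h1 : n = 1
  · subst h1
    refine ⟨1, fun q hq h3 => ?_⟩
    have hu : IsUnit (red q y) := by
      rw [isUnit_red_iff hq, hnn]
      intro h; exact hq.one_lt.ne' (by exact_mod_cast Int.eq_one_of_dvd_one (by positivity) h)
    rw [Subsingleton.elim ((q : ZMod 1)) 1, map_one]
    apply cubicChar_of_im_eq_zero hu
    have him : y.im = 0 := by
      have h3 : (3 : ℤ) ∣ y.im := by
        have h := hy.mod_three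
        have e : (3 : Eis ℤ) = (3 : ℕ) := by norm_num
        rw [e, natCast_dvd_iff, natCast_dvd_iff] at h
        rcases h with ⟨h1, h2⟩ | ⟨h1, h2⟩ <;> simpa [im_one] using h2
      obtain ⟨a, ha⟩ := h3
      rw [norm_eq, ha] at hnn
      have : a = 0 := by
        by_contra h
        have : 1 ≤ a ^ 2 := by
          have := sq_pos_of_ne_zero h
          omega
        push_cast at hnn
        nlinarith [sq_nonneg (2 * y.re - 3 * a)]
      rw [ha, this]; rfl
    simp [him]
  obtain ⟨p, hp, hpn⟩ := Nat.exists_prime_and_dvd h1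
  have hpy : (p : ℤ) ∣ norm y := by rw [hnn]; exact_mod_cast hpn
  have hn0 : 0 < n := by
    rcases Nat.eq_zero_or_pos n with h | h
    · rw [h, Nat.cast_zero, norm_eq_zero_iff] at hnn
      exact absurd hnn hy.ne_zero
    · exact h
  have := Fact.mk hp
  have hp3 : p % 3 = 1 := by
    have hm := norm_mod_three hy.mod_three
    rcases eq_or_ne p 3 with rfl | h3
    · push_cast at hpy; omega
    rcases mod_three_cases hp h3 with h | h
    · exact h
    · exact absurd (natCast_dvd_of_dvd_norm hp h hpy) (hy.primitive p hp)
  have key : ∃ (π : Eis ℤ) (χ : MulChar (ZMod p) ℂ), norm π = p ∧ (3 : Eis ℤ) ∣ π + 1 ∧ π ∣ y ∧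
      ∀ q : ℕ, q.Prime → q ≠ 3 → cubicChar q (red q π) = χ q := by
    obtain ⟨π, χ, hN, hπ3, hχ, H⟩ := exists_char_of_split hp3
    rcases dvd_or_star_dvd_of_dvd_norm hp hN hpy with h | h
    · exact ⟨π, χ, hN, hπ3, h, H⟩
    · refine ⟨star π, star χ, by rw [QuadraticAlgebra.norm_star, hN], ?_, h, ?_⟩
      · obtain ⟨z, hz⟩ := hπ3
        refine ⟨star z, ?_⟩
        have := congrArg star hz
        simp only [star_add, star_mul', star_one] at this
        rw [this]; congr 1
      · intro q hq h3
        rw [map_star, cubicChar_star, H q hq h3]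
        rfl
  obtain ⟨π, χ, hN, hπ3, ⟨z, rfl⟩, H⟩ := key
  have hz : IsPrimary z := by
    refine ⟨fun r hr h => hy.primitive r hr (h.mul_left _), ?_⟩
    obtain ⟨a, ha⟩ := hπ3
    rcases hy.mod_three with ⟨b, hb⟩ | ⟨b, hb⟩
    · exact Or.inr ⟨a * z - b, by linear_combination z * ha - hb⟩
    · exact Or.inl ⟨a * z - b, by linear_combination z * ha - hb⟩
  have hnz : n = p * (norm z).natAbs := by
    rw [← hn, map_mul, hN, Int.natAbs_mul]; simp
  obtain ⟨X, hX⟩ := ih _ (by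
    rw [hnz]; rw [hnz] at hn0
    have := Nat.pos_of_mul_pos_left hn0
    nlinarith [hp.two_le]) hz rfl
  have hd1 : p ∣ n := hpn
  have hd2 : (norm z).natAbs ∣ n := ⟨p, by rw [hnz, mul_comm]⟩
  refine ⟨DirichletCharacter.changeLevel hd1 χ * DirichletCharacter.changeLevel hd2 X,
    fun q hq h3 => ?_⟩
  by_cases hqn : q ∣ n
  · rw [MulChar.map_nonunit, MulChar.map_nonunit]
    · rw [ZMod.isUnit_iff_coprime]
      intro h; exact hq.one_lt.ne' (Nat.Coprime.eq_one_of_dvd h hqn)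
    · rw [isUnit_red_iff hq, hnn]; simpa using (by exact_mod_cast hqn)
  · have hu : IsUnit (q : ZMod n) := by
      rw [ZMod.isUnit_iff_coprime]; exact (Nat.Prime.coprime_iff_not_dvd hq).2 hqn
    rw [map_mul, map_mul, H q hq h3, hX q hq h3, MulChar.mul_apply, ← hu.unit_spec,
      DirichletCharacter.changeLevel_eq_cast_of_dvd, DirichletCharacter.changeLevel_eq_cast_of_dvd,
      hu.unit_spec, ZMod.cast_natCast hd1, ZMod.cast_natCast hd2]

end Eis

namespace Eis

/-- The weights attached to the order zeta functions: averages of the indicator functions of the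
lattices `{α : im (u α) ≡ 0 mod m}` against the character `chi m`. -/
def w (m : ℕ) (α : Eis ℤ) : ℂ :=
  (m.totient : ℂ)⁻¹ * ∑' u : Eis (ZMod m),
    if (u * red m α).im = 0 then (starRingEnd ℂ) (chi m u) else 0

lemma w_eq_sum (m : ℕ) [NeZero m] (α : Eis ℤ) :
    w m α = (m.totient : ℂ)⁻¹ * ∑ u : Eis (ZMod m),
      if (u * red m α).im = 0 then (starRingEnd ℂ) (chi m u) else 0 := by
  rw [w, tsum_fintype]

lemma w_one_left (α : Eis ℤ) : w 1 α = 1 := by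
  have : NeZero 1 := ⟨one_ne_zero⟩
  rw [w_eq_sum]
  have hs : Subsingleton (Eis (ZMod 1)) := ⟨fun a b => by
    ext <;> exact Subsingleton.elim _ _⟩
  have : ∀ u : Eis (ZMod 1), u = 1 := fun u => Subsingleton.elim _ _
  have hu : (Finset.univ : Finset (Eis (ZMod 1))) = {1} := by
    ext a; simp [this a]
  rw [hu, Finset.sum_singleton, if_pos (Subsingleton.elim _ _), chi_one]
  simp

lemma w_mul_of_isUnit {m : ℕ} (hm : m ≠ 0) {β : Eis ℤ} (hβ : IsUnit (red m β)) (α : Eis ℤ) :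
    w m (β * α) = chi m (red m β) * w m α := by
  have : NeZero m := ⟨hm⟩
  rw [w_eq_sum, w_eq_sum, mul_left_comm]
  congr 1
  rw [Finset.mul_sum]
  refine Fintype.sum_equiv (Units.mulRight hβ.unit) _ _ fun u => ?_
  have hn : chi m (red m β) * (starRingEnd ℂ) (chi m (red m β)) = 1 := by
    rw [Complex.mul_conj, Complex.normSq_eq_norm_sq, chi_norm hβ]; simp
  simp only [Units.mulRight_apply, IsUnit.unit_spec, map_mul, mul_assoc, chi_mul]
  split_ifs with h
  · linear_combination (- (starRingEnd ℂ) (chi m u)) * hn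
  · simp

lemma w_coprime_mul {m n : ℕ} (hm : m ≠ 0) (hn : n ≠ 0) (h : m.Coprime n) (α : Eis ℤ) :
    w (m * n) α = w m α * w n α := by
  have : NeZero m := ⟨hm⟩
  have : NeZero n := ⟨hn⟩
  have : NeZero (m * n) := ⟨mul_ne_zero hm hn⟩
  let hdm : m ∣ m * n := Dvd.intro _ rfl
  let hdn : n ∣ m * n := Dvd.intro_left _ rfl
  let f : Eis (ZMod (m * n)) → Eis (ZMod m) × Eis (ZMod n) := fun u => (redTo hdm u, redTo hdn u)
  have hinj0 : ∀ a b : ZMod (m * n), ZMod.castHom hdm (ZMod m) a = ZMod.castHom hdm (ZMod m) b →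
      ZMod.castHom hdn (ZMod n) a = ZMod.castHom hdn (ZMod n) b → a = b := by
    intro a b h1 h2
    apply (ZMod.chineseRemainder h).injective
    have key : ∀ c, ZMod.chineseRemainder h c =
        (ZMod.castHom hdm (ZMod m) c, ZMod.castHom hdn (ZMod n) c) := by
      intro c
      have H : (ZMod.chineseRemainder h).toRingHom =
        (ZMod.castHom hdm (ZMod m)).prod (ZMod.castHom hdn (ZMod n)) := RingHom.ext_zmod _ _
      exact congrArg (fun g => g c) H
    rw [key, key, h1, h2]
  have hinj : Function.Injective f := by
    intro u v huv
    have h1 := congrArg Prod.fst huv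
    have h2 := congrArg Prod.snd huv
    ext
    · exact hinj0 _ _ (congrArg QuadraticAlgebra.re h1) (congrArg QuadraticAlgebra.re h2)
    · exact hinj0 _ _ (congrArg QuadraticAlgebra.im h1) (congrArg QuadraticAlgebra.im h2)
  have hcardE : ∀ k : ℕ, ∀ [NeZero k], Fintype.card (Eis (ZMod k)) = k * k := by
    intro k _
    rw [Fintype.card_congr (equivProd _ _), Fintype.card_prod, ZMod.card]
  have hbij : Function.Bijective f := by
    rw [Fintype.bijective_iff_injective_and_card]
    refine ⟨hinj, ?_⟩
    rw [Fintype.card_prod, hcardE, hcardE, hcardE]; ring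
  rw [w_eq_sum, w_eq_sum, w_eq_sum, Nat.totient_mul h, mul_mul_mul_comm, Finset.sum_mul_sum,
    ← Fintype.sum_prod_type']
  push_cast
  rw [mul_inv]
  congr 1
  refine Fintype.sum_equiv (Equiv.ofBijective f hbij) _ _ fun u => ?_
  have hiff : (u * red (m * n) α).im = 0 ↔
      ((f u).1 * red m α).im = 0 ∧ ((f u).2 * red n α).im = 0 := by
    have e1 : (f u).1 * red m α = redTo hdm (u * red (m * n) α) := by
      rw [map_mul, redTo_red]
    have e2 : (f u).2 * red n α = redTo hdn (u * red (m * n) α) := by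
      rw [map_mul, redTo_red]
    rw [e1, e2, im_map, im_map]
    constructor
    · intro h; rw [h, map_zero, map_zero]; exact ⟨rfl, rfl⟩
    · rintro ⟨h1, h2⟩; exact hinj0 _ _ (by rw [h1, map_zero]) (by rw [h2, map_zero])
  rw [Equiv.ofBijective_apply, chi_coprime_mul h, map_mul]
  by_cases h1 : ((f u).1 * red m α).im = 0 <;> by_cases h2 : ((f u).2 * red n α).im = 0 <;>
    simp only [hiff, h1, h2, and_self, if_true, if_false, and_true, and_false, mul_zero, zero_mul]
  rfl

lemma chi_prime_pow {p k : ℕ} (hp : p.Prime) (hk : k ≠ 0) (x : Eis (ZMod (p ^ k))) :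
    chi (p ^ k) x = cubicChar p (redTo (dvd_pow_self p hk) x) ^ k := by
  rw [chi, Nat.primeFactors_prime_pow hk hp, Finset.prod_singleton, hp.factorization_pow,
    Finsupp.single_eq_same]
  rfl

lemma isUnit_prime_pow_iff {p k : ℕ} (hp : p.Prime) (hk : k ≠ 0) (x : Eis (ZMod (p ^ k))) :
    IsUnit x ↔ IsUnit (redTo (dvd_pow_self p hk) x) := by
  refine ⟨fun h => h.map _, fun h => ?_⟩
  rw [isUnit_iff_forall (pow_ne_zero _ hp.ne_zero)]
  intro q hq
  have : q = p := by
    rw [Nat.primeFactors_prime_pow hk hp, Finset.mem_singleton] at hq; exact hq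
  subst this; exact h

/-- The value of the weights at multiples of the modulus, for prime powers. -/
def kap (p k : ℕ) : ℂ := w (p ^ k) 0

lemma norm_kap_le {p k : ℕ} (hp : p.Prime) (hk : k ≠ 0) : ‖kap p k‖ ≤ 2 * p ^ k := by
  have hpk : p ^ k ≠ 0 := pow_ne_zero _ hp.ne_zero
  have : NeZero (p ^ k) := ⟨hpk⟩
  have h1 : ‖∑ u : Eis (ZMod (p ^ k)),
      if (u * red (p ^ k) 0).im = 0 then (starRingEnd ℂ) (chi (p ^ k) u) else 0‖ ≤
      (p ^ k * p ^ k : ℝ) := by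
    refine (norm_sum_le _ _).trans ((Finset.sum_le_card_nsmul _ _ 1 fun u _ => ?_).trans ?_)
    · split_ifs
      · rw [RCLike.norm_conj]
        by_cases hu : IsUnit u
        · rw [chi_norm hu]
        · rw [chi_nonunit hpk hu]; simp
      · simp
    · rw [Finset.card_univ, Fintype.card_congr (equivProd _ _), Fintype.card_prod, ZMod.card]
      simp
  rw [kap, w_eq_sum, norm_mul, norm_inv, Complex.norm_natCast]
  have htot : (p ^ k : ℝ) ≤ 2 * ((p ^ k).totient : ℝ) := by
    rw [Nat.totient_prime_pow hp (Nat.pos_of_ne_zero hk)]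
    obtain ⟨j, rfl⟩ := Nat.exists_eq_succ_of_ne_zero hk
    have : p ^ (j + 1) ≤ 2 * (p ^ j * (p - 1)) := by
      have := hp.two_le
      have h2 : p ≤ 2 * (p - 1) := by omega
      calc p ^ (j + 1) = p ^ j * p := pow_succ _ _
        _ ≤ p ^ j * (2 * (p - 1)) := Nat.mul_le_mul_left _ h2
        _ = _ := by ring
    exact_mod_cast this
  have htp : 0 < ((p ^ k).totient : ℝ) := by
    exact_mod_cast Nat.totient_pos.2 (Nat.pos_of_ne_zero hpk)
  rw [inv_mul_le_iff₀ htp]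
  have hP : (0 : ℝ) ≤ p ^ k := by positivity
  nlinarith [h1]

lemma w_congr {m : ℕ} {α β : Eis ℤ} (h : red m α = red m β) : w m α = w m β := by
  rw [w, w, h]

lemma w_prime_pow_of_dvd {p k : ℕ} {α : Eis ℤ} (h : ((p ^ k : ℕ) : Eis ℤ) ∣ α) :
    w (p ^ k) α = kap p k :=
  w_congr (by rw [(red_eq_zero_iff _ _).2 h, map_zero])

lemma card_mul_eq_zero {p : ℕ} {j k : ℕ} (hjk : j ≤ k) [NeZero (p ^ k)] :
    (Finset.univ.filter fun b : ZMod (p ^ k) => b * ((p ^ j : ℕ) : ZMod (p ^ k)) = 0).card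
      = p ^ j := by
  have h := IsAddCyclic.card_nsmulAddMonoidHom_ker (G := ZMod (p ^ k)) (d := p ^ j)
  rw [Nat.card_zmod, Nat.gcd_eq_right (pow_dvd_pow p hjk)] at h
  rw [← Fintype.card_subtype, ← Nat.card_eq_fintype_card]
  refine Eq.trans ?_ h
  refine Nat.card_congr (Equiv.subtypeEquivRight fun b => ?_)
  simp [AddMonoidHom.mem_ker, mul_comm]

lemma w_prime_pow {p : ℕ} (hp : p.Prime) {j k : ℕ} (hjk : j < k) {y : Eis ℤ}
    (hy : ¬ (p : Eis ℤ) ∣ y) :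
    w (p ^ k) (((p ^ j : ℕ) : Eis ℤ) * y) = p ^ j * cubicChar p (red p y) ^ k := by
  have := Fact.mk hp
  have hk : k ≠ 0 := by omega
  have hpk : p ^ k ≠ 0 := pow_ne_zero _ hp.ne_zero
  have : NeZero (p ^ k) := ⟨hpk⟩
  have hdvd : p ∣ p ^ k := dvd_pow_self p hk
  -- the condition modulo `p`
  have hmod : ∀ b : ZMod (p ^ k), b * ((p ^ j : ℕ) : ZMod (p ^ k)) = 0 →
      ZMod.castHom hdvd (ZMod p) b = 0 := by
    intro b hb
    rw [← ZMod.natCast_zmod_val b, ← Nat.cast_mul, ZMod.natCast_eq_zero_iff] at hb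
    rw [← ZMod.natCast_zmod_val b, map_natCast, ZMod.natCast_eq_zero_iff]
    have : p * p ^ j ∣ b.val * p ^ j := by
      rw [← pow_succ']; exact (pow_dvd_pow p hjk).trans hb
    exact Nat.dvd_of_mul_dvd_mul_right (pow_pos hp.pos j) this
  have him : ∀ u : Eis (ZMod (p ^ k)), ∀ x : Eis ℤ,
      (u * red (p ^ k) (((p ^ j : ℕ) : Eis ℤ) * x)).im =
        (u * red (p ^ k) x).im * ((p ^ j : ℕ) : ZMod (p ^ k)) := by
    intro u x
    rw [map_mul, map_natCast]
    generalize p ^ j = N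
    simp; ring
  by_cases hu : IsUnit (red p y)
  · have hu' : IsUnit (red (p ^ k) y) := by
      rw [isUnit_prime_pow_iff hp hk, redTo_red]; exact hu
    have key : w (p ^ k) ((p ^ j : ℕ) : Eis ℤ) = p ^ j := by
      rw [w_eq_sum]
      have : ∀ u : Eis (ZMod (p ^ k)),
          (if (u * red (p ^ k) ((p ^ j : ℕ) : Eis ℤ)).im = 0 then
            (starRingEnd ℂ) (chi (p ^ k) u) else 0) =
          (if IsUnit u.re then 1 else 0) *
            (if u.im * ((p ^ j : ℕ) : ZMod (p ^ k)) = 0 then 1 else 0) := by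
        intro v
        have h1 := him v 1
        rw [map_one, mul_one, mul_one] at h1
        rw [h1]
        by_cases h2 : v.im * ((p ^ j : ℕ) : ZMod (p ^ k)) = 0
        · have h3 := hmod _ h2
          have h4 : IsUnit v ↔ IsUnit v.re := by
            rw [isUnit_prime_pow_iff hp hk, isUnit_iff_norm_isUnit, norm_eq, re_map, im_map, h3]
            constructor
            · intro h
              have h5 : IsUnit (ZMod.castHom hdvd (ZMod p) v.re) := by
                simpa using h
              rw [← ZMod.natCast_zmod_val v.re, map_natCast, ZMod.isUnit_iff_coprime] at h5
              rw [← ZMod.natCast_zmod_val v.re, ZMod.isUnit_iff_coprime]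
              exact h5.pow_right k
            · intro h
              simpa using (h.map (ZMod.castHom hdvd (ZMod p)))
          rw [if_pos h2, if_pos h2, mul_one]
          by_cases h5 : IsUnit v.re
          · rw [if_pos h5, chi_prime_pow hp hk,
              cubicChar_of_im_eq_zero ((h4.2 h5).map _) (by rw [im_map, h3])]
            simp
          · rw [if_neg h5, chi_nonunit hpk (fun h => h5 (h4.1 h)), map_zero]
        · rw [if_neg h2, if_neg h2, mul_zero]
      rw [Finset.sum_congr rfl fun u _ => this u]
      have hprod : ∀ f g : ZMod (p ^ k) → ℂ,
          ∑ u : Eis (ZMod (p ^ k)), f u.re * g u.im = (∑ a, f a) * ∑ b, g b := by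
        intro f g
        rw [Fintype.sum_equiv (equivProd _ _) (fun u : Eis (ZMod (p ^ k)) => f u.re * g u.im)
          (fun x : ZMod (p ^ k) × ZMod (p ^ k) => f x.1 * g x.2) (fun u => rfl),
          Fintype.sum_prod_type, Finset.sum_mul_sum]
      rw [hprod (fun a => if IsUnit a then 1 else 0)
        (fun b => if b * ((p ^ j : ℕ) : ZMod (p ^ k)) = 0 then 1 else 0),
      Finset.sum_boole, Finset.sum_boole, card_mul_eq_zero hjk.le]
      have hc : (Finset.univ.filter fun x : ZMod (p ^ k) => IsUnit x).card = (p ^ k).totient := by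
        rw [← ZMod.card_units_eq_totient, ← Finset.card_univ]
        symm
        refine Finset.card_bij (fun u _ => (u : ZMod (p ^ k))) (fun u _ => by simp)
          (fun u _ v _ h => Units.ext h) fun b hb => ?_
        exact ⟨(Finset.mem_filter.1 hb).2.unit, Finset.mem_univ _, rfl⟩
      rw [hc]
      have : ((p ^ k).totient : ℂ) ≠ 0 := by
        exact_mod_cast (Nat.totient_pos.2 (Nat.pos_of_ne_zero hpk)).ne'
      field_simp
      push_cast; rfl
    rw [mul_comm, w_mul_of_isUnit hpk hu', key, chi_prime_pow hp hk, redTo_red, mul_comm]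
  · rw [MulChar.map_nonunit _ hu, zero_pow hk, mul_zero, w_eq_sum, Finset.sum_eq_zero, mul_zero]
    intro u _
    split_ifs with h
    · by_cases hv : IsUnit u
      · exfalso
        rw [him] at h
        have h3 := hmod _ h
        have h4 : (redTo hdvd u * red p y).im = 0 := by
          rw [← redTo_red hdvd, ← map_mul, im_map, h3]
        have h5 : redTo hdvd u * red p y = 0 := by
          have hN : ¬ IsUnit (redTo hdvd u * red p y) := by
            rw [IsUnit.mul_iff]; exact fun h => hu h.2
          rw [isUnit_iff_norm_isUnit, norm_eq, h4] at hN
          ext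
          · by_contra h0
            exact hN (by simpa using h0)
          · exact h4
        have h6 : red p y = 0 := ((hv.map (redTo hdvd)).mul_right_eq_zero).1 h5
        exact hy ((red_eq_zero_iff _ _).1 h6)
      · rw [chi_nonunit hpk hv, map_zero]
    · rfl

end Eis

namespace Eis

lemma w_eq_prod {m : ℕ} (hm : m ≠ 0) (α : Eis ℤ) :
    w m α = ∏ p ∈ m.primeFactors, w (p ^ m.factorization p) α := by
  induction m using Nat.recOnPosPrimePosCoprime with
  | zero => exact absurd rfl hm
  | one => simp [w_one_left]
  | prime_pow p n hp hn =>
    rw [Nat.primeFactors_prime_pow hn.ne' hp, Finset.prod_singleton, hp.factorization_pow,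
      Finsupp.single_eq_same]
  | coprime a b ha hb hab iha ihb =>
    have ha0 : a ≠ 0 := by omega
    have hb0 : b ≠ 0 := by omega
    rw [w_coprime_mul ha0 hb0 hab, iha ha0, ihb hb0, hab.primeFactors_mul,
      Finset.prod_union hab.disjoint_primeFactors]
    congr 1
    · refine Finset.prod_congr rfl fun p hp => ?_
      rw [Nat.factorization_mul_apply_of_coprime hab,
        Nat.factorization_eq_zero_of_not_dvd (n := b) fun h => ?_, add_zero]
      exact (Nat.mem_primeFactors.1 hp).1.one_lt.ne'
        (Nat.dvd_one.1 (hab ▸ Nat.dvd_gcd (Nat.mem_primeFactors.1 hp).2.1 h))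
    · refine Finset.prod_congr rfl fun p hp => ?_
      rw [Nat.factorization_mul_apply_of_coprime hab,
        Nat.factorization_eq_zero_of_not_dvd (n := a) fun h => ?_, zero_add]
      exact (Nat.mem_primeFactors.1 hp).1.one_lt.ne'
        (Nat.dvd_one.1 (hab ▸ Nat.dvd_gcd h (Nat.mem_primeFactors.1 hp).2.1))

/-- The local factors of the weights. -/
def loc (z : ℂ) (c p k : ℕ) : ℂ :=
  if c.factorization p < k then p ^ c.factorization p * z ^ k else kap p k

lemma natCast_dvd_natCast_mul_iff {p : ℕ} (hp : p.Prime) {c : ℕ} (hc : ¬ p ∣ c) (y : Eis ℤ) :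
    (p : Eis ℤ) ∣ (c : Eis ℤ) * y ↔ (p : Eis ℤ) ∣ y := by
  have hpz : Prime (p : ℤ) := Nat.prime_iff_prime_int.1 hp
  have hc' : ¬ (p : ℤ) ∣ c := by exact_mod_cast hc
  rw [natCast_dvd_iff, natCast_dvd_iff]
  simp [hpz.dvd_mul, hc']

lemma w_natCast_mul_prime_pow {p : ℕ} (hp : p.Prime) {k : ℕ} {c : ℕ} (hc : c ≠ 0) {y : Eis ℤ}
    (hy : ¬ (p : Eis ℤ) ∣ y) :
    w (p ^ k) ((c : Eis ℤ) * y) = loc (cubicChar p (red p y)) c p k := by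
  obtain ⟨d, hd, hcd⟩ := Nat.exists_eq_pow_mul_and_not_dvd hc p hp.ne_one
  set v := c.factorization p
  rw [loc]
  split_ifs with h
  · obtain ⟨d, hd, hcd⟩ : ∃ d, ¬ p ∣ d ∧ c = p ^ c.factorization p * d :=
      ⟨_, Nat.not_dvd_ordCompl hp hc, (Nat.ordProj_mul_ordCompl_eq_self c p).symm⟩
    have e : (c : Eis ℤ) * y = ((p ^ c.factorization p : ℕ) : Eis ℤ) * ((d : Eis ℤ) * y) := by
      conv_lhs => rw [hcd]
      push_cast; ring
    have hu : IsUnit (d : Eis (ZMod p)) := by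
      have : IsUnit (d : ZMod p) :=
        (ZMod.isUnit_iff_coprime _ _).2 ((Nat.Prime.coprime_iff_not_dvd hp).2 hd).symm
      have := this.map (algebraMap (ZMod p) (Eis (ZMod p)))
      simpa using this
    rw [e, w_prime_pow hp h (by rwa [natCast_dvd_natCast_mul_iff hp hd]), map_mul, map_mul,
      map_natCast, cubicChar_of_im_eq_zero hu (by simp), one_mul]
  · apply w_prime_pow_of_dvd
    push Not at h
    have : p ^ k ∣ c := (pow_dvd_pow p h).trans (Nat.ordProj_dvd c p)
    exact (Nat.cast_dvd_cast this).mul_right _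

lemma w_natCast_mul {m : ℕ} (hm : m ≠ 0) {c : ℕ} (hc : c ≠ 0) {y : Eis ℤ}
    (hy : ∀ p : ℕ, p.Prime → ¬ (p : Eis ℤ) ∣ y) :
    w m ((c : Eis ℤ) * y) =
      ∏ p ∈ m.primeFactors, loc (cubicChar p (red p y)) c p (m.factorization p) := by
  rw [w_eq_prod hm]
  refine Finset.prod_congr rfl fun p hp => ?_
  have hp := (Nat.mem_primeFactors.1 hp).1
  exact w_natCast_mul_prime_pow hp hc (hy p hp)

lemma red_om {n : ℕ} : red n om = om := by ext <;> simp

lemma isUnit_om {R : Type*} [CommRing R] : IsUnit (om : Eis R) := ⟨omUnit, rfl⟩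

lemma chi_om_eq_one {m : ℕ} (hm : m % 9 = 1) : chi m om = 1 := by
  rw [chi_om (by omega)]
  obtain ⟨k, hk⟩ : ∃ k, m = 9 * k + 1 := ⟨m / 9, by omega⟩
  have : (m ^ 2 - 1) / 3 = 3 * (9 * k ^ 2 + 2 * k) := by
    rw [hk]
    apply Nat.div_eq_of_eq_mul_right (by norm_num)
    rw [Nat.sub_eq_iff_eq_add (by nlinarith)]; ring
  rw [this, pow_mul, zeta3_cube, one_pow]

lemma chi_om_ne_one {l : ℕ} (hl : l % 9 = 2) : chi l om ≠ 1 := by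
  rw [chi_om (by omega)]
  obtain ⟨k, hk⟩ : ∃ k, l = 9 * k + 2 := ⟨l / 9, by omega⟩
  have : (l ^ 2 - 1) / 3 = 3 * (9 * k ^ 2 + 4 * k) + 1 := by
    rw [hk]
    apply Nat.div_eq_of_eq_mul_right (by norm_num)
    rw [Nat.sub_eq_iff_eq_add (by nlinarith)]; ring
  rw [this, pow_succ, pow_mul, zeta3_cube, one_pow, one_mul]
  exact zeta3_primitive.ne_one (by norm_num)

/-- The prime above `3`. -/
def lam : Eis ℤ := ⟨1, -1⟩

lemma lam_sq : lam ^ 2 = -3 * om := by rw [sq]; ext <;> simp [lam]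

lemma norm_lam : norm lam = 3 := by rw [norm_eq]; rfl

lemma isUnit_red_of_coprime {m : ℕ} {α : Eis ℤ} {n : ℕ} (hn : norm α = n) (h : n.Coprime m) :
    IsUnit (red m α) := by
  rw [isUnit_iff_norm_isUnit, norm_map, hn]
  simpa using (ZMod.isUnit_iff_coprime n m).2 h

lemma isUnit_red_lam {m : ℕ} (hm : ¬ 3 ∣ m) : IsUnit (red m lam) :=
  isUnit_red_of_coprime (n := 3) (by rw [norm_lam]; rfl)
    ((Nat.Prime.coprime_iff_not_dvd Nat.prime_three).2 hm)

lemma chi_lam_eq_one {m : ℕ} (hm : m % 9 = 1) : chi m (red m lam) = 1 := by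
  have hu := isUnit_red_lam (m := m) (by omega)
  have h3 := chi_cube hu
  have h2 : chi m (red m lam) ^ 2 = 1 := by
    rw [sq, ← chi_mul, ← map_mul, ← sq, lam_sq, map_mul, chi_mul, red_om, chi_om_eq_one hm, mul_one]
    have hu : IsUnit (red m (-3)) := by
      apply isUnit_red_of_coprime (n := 9) (by rw [norm_eq]; simp)
      exact Nat.Coprime.pow_left 2 ((Nat.Prime.coprime_iff_not_dvd Nat.prime_three).2 (by omega))
    apply chi_of_im_eq_zero hu
    simp
  rw [pow_succ, h2, one_mul] at h3
  exact h3

lemma w_om_mul {m : ℕ} (hm : m % 9 = 1) (α : Eis ℤ) : w m (om * α) = w m α := by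
  rw [w_mul_of_isUnit (by omega) (by rw [red_om]; exact isUnit_om), red_om, chi_om_eq_one hm,
    one_mul]

lemma w_lam_mul {m : ℕ} (hm : m % 9 = 1) (α : Eis ℤ) : w m (lam * α) = w m α := by
  rw [w_mul_of_isUnit (by omega) (isUnit_red_lam (by omega)), chi_lam_eq_one hm, one_mul]

lemma kap_one_eq_zero {l : ℕ} (hl : l % 9 = 2) : kap l 1 = 0 := by
  have h := w_mul_of_isUnit (m := l) (by omega) (β := om) (by rw [red_om]; exact isUnit_om) 0
  rw [mul_zero, red_om] at h
  rw [kap, pow_one]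
  have h2 : (chi l om - 1) * w l 0 = 0 := by linear_combination -h
  exact (mul_eq_zero.1 h2).resolve_left (sub_ne_zero.2 (chi_om_ne_one hl))

/-- The family of moduli used: `m ≡ 1 mod 9`, and `l` exactly divides `m`. -/
structure Good (l m : ℕ) : Prop where
  mod_nine : m % 9 = 1
  dvd : l ∣ m
  not_sq_dvd : ¬ l ^ 2 ∣ m

lemma Good.factorization {l m : ℕ} (hl : l.Prime) (h : Good l m) : m.factorization l = 1 := by
  have hm : m ≠ 0 := by have := h.mod_nine; omega
  have h1 := (hl.dvd_iff_one_le_factorization hm).1 h.dvd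
  have h2 : ¬ 2 ≤ m.factorization l := fun h2 =>
    h.not_sq_dvd ((hl.pow_dvd_iff_le_factorization hm).2 h2)
  omega

lemma Good.w_eq_zero_of_dvd {l m : ℕ} (hl : l.Prime) (hl9 : l % 9 = 2) (h : Good l m) {α : Eis ℤ}
    (hα : (l : ℤ) ∣ norm α) : w m α = 0 := by
  have hm : m ≠ 0 := by have := h.mod_nine; omega
  rw [w_eq_prod hm]
  apply Finset.prod_eq_zero (Nat.mem_primeFactors.2 ⟨hl, h.dvd, hm⟩)
  rw [h.factorization hl, w_prime_pow_of_dvd, kap_one_eq_zero hl9]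
  rw [pow_one]
  exact natCast_dvd_of_dvd_norm hl (by omega) hα

lemma Good.w_zero {l m : ℕ} (hl : l.Prime) (hl9 : l % 9 = 2) (h : Good l m) : w m 0 = 0 :=
  h.w_eq_zero_of_dvd hl hl9 (by simp)

lemma dvd_lam_of_norm {x : Eis ℤ} (h : (3 : ℤ) ∣ norm x) : lam ∣ x := by
  have : (3 : ℤ) ∣ x.re + x.im := by
    rw [norm_eq] at h
    have h2 : (3 : ℤ) ∣ (x.re + x.im) ^ 2 := by
      obtain ⟨c, hc⟩ := h
      exact ⟨c + x.re * x.im, by linear_combination hc⟩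
    exact Int.prime_three.dvd_of_dvd_pow h2
  obtain ⟨c, hc⟩ := this
  exact ⟨⟨x.re - c, c⟩, by ext <;> simp [lam] <;> linarith⟩

lemma exists_om_pow_mul {x : Eis ℤ} (h : ¬ (3 : ℤ) ∣ norm x) :
    ∃ i < 3, ∃ y, x = om ^ i * y ∧ ((3 : Eis ℤ) ∣ y + 1 ∨ (3 : Eis ℤ) ∣ y - 1) := by
  have e : (3 : Eis ℤ) = (3 : ℕ) := by norm_num
  have h1 : x = om ^ 1 * (om ^ 2 * x) := by
    rw [← mul_assoc, ← pow_add, show 1 + 2 = 3 from rfl, om_cube, one_mul]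
  have h2 : x = om ^ 2 * (om * x) := by
    rw [← mul_assoc, ← pow_succ, om_cube, one_mul]
  have key : ((3 : Eis ℤ) ∣ x + 1 ∨ (3 : Eis ℤ) ∣ x - 1) ∨
      ((3 : Eis ℤ) ∣ om ^ 2 * x + 1 ∨ (3 : Eis ℤ) ∣ om ^ 2 * x - 1) ∨
      ((3 : Eis ℤ) ∣ om * x + 1 ∨ (3 : Eis ℤ) ∣ om * x - 1) := by
    simp only [e, natCast_dvd_iff, om_sq]
    simp [re_one, im_one]
    rw [norm_eq] at h
    have hne : ¬ (x.re + x.im) % 3 = 0 := by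
      intro h0
      apply h
      have : x.re ^ 2 - x.re * x.im + x.im ^ 2 = (x.re + x.im) ^ 2 - 3 * (x.re * x.im) := by ring
      rw [this]
      exact dvd_sub (dvd_pow (Int.dvd_of_emod_eq_zero h0) two_ne_zero) (dvd_mul_right _ _)
    clear h
    have hr : x.re % 3 = 0 ∨ x.re % 3 = 1 ∨ x.re % 3 = 2 := by omega
    have hi : x.im % 3 = 0 ∨ x.im % 3 = 1 ∨ x.im % 3 = 2 := by omega
    clear e h1 h2
    generalize x.re = a at *
    generalize x.im = b at *
    rcases hr with hr | hr | hr <;> rcases hi with hi | hi | hi <;> omega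
  rcases key with h | h | h
  · exact ⟨0, by norm_num, x, by simp, h⟩
  · exact ⟨1, by norm_num, _, h1, h⟩
  · exact ⟨2, by norm_num, _, h2, h⟩

/-- Primitive numbers are primary up to units and the prime above three. -/
lemma exists_isPrimary {x : Eis ℤ} (h : ∀ p : ℕ, p.Prime → ¬ (p : Eis ℤ) ∣ x) :
    ∃ (i j : ℕ) (y : Eis ℤ), IsPrimary y ∧ x = om ^ i * lam ^ j * y := by
  by_cases h3 : (3 : ℤ) ∣ norm x
  · obtain ⟨z, rfl⟩ := dvd_lam_of_norm h3
    have hz : ¬ (3 : ℤ) ∣ norm z := by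
      intro h4
      obtain ⟨t, rfl⟩ := dvd_lam_of_norm h4
      apply h 3 Nat.prime_three
      rw [← mul_assoc, ← sq, lam_sq]
      exact ⟨-om * t, by push_cast; ring⟩
    obtain ⟨i, -, y, rfl, hy⟩ := exists_om_pow_mul hz
    exact ⟨i, 1, y, ⟨fun p hp hpy => h p hp ((hpy.mul_left _).mul_left _), hy⟩, by ring⟩
  · obtain ⟨i, -, y, rfl, hy⟩ := exists_om_pow_mul h3
    exact ⟨i, 0, y, ⟨fun p hp hpy => h p hp (hpy.mul_left _), hy⟩, by ring⟩

lemma exists_content {x : Eis ℤ} (hx : x ≠ 0) : ∃ (c : ℕ) (y : Eis ℤ), c ≠ 0 ∧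
    x = (c : Eis ℤ) * y ∧ ∀ p : ℕ, p.Prime → ¬ (p : Eis ℤ) ∣ y := by
  have hg : (Int.gcd x.re x.im) ≠ 0 := by
    rw [Ne, Int.gcd_eq_zero_iff]
    exact fun h => hx (QuadraticAlgebra.ext h.1 h.2)
  obtain ⟨y, hy⟩ := (natCast_dvd_iff (Int.gcd x.re x.im) x).2
    ⟨Int.gcd_dvd_left .., Int.gcd_dvd_right ..⟩
  refine ⟨_, y, hg, hy, ?_⟩
  rintro p hp ⟨z, rfl⟩
  have h1 : ((Int.gcd x.re x.im * p : ℕ) : Eis ℤ) ∣ x := ⟨z, by push_cast; rw [mul_assoc]; exact hy⟩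
  rw [natCast_dvd_iff] at h1
  have h2 := Int.dvd_coe_gcd h1.1 h1.2
  have h3 : Int.gcd x.re x.im * p ∣ Int.gcd x.re x.im * 1 := by rw [mul_one]; exact_mod_cast h2
  exact hp.one_lt.ne' (Nat.dvd_one.1 (Nat.dvd_of_mul_dvd_mul_left (Nat.pos_of_ne_zero hg) h3))

lemma w_om_lam_mul {m : ℕ} (hm : m % 9 = 1) (i j : ℕ) (α : Eis ℤ) :
    w m (om ^ i * lam ^ j * α) = w m α := by
  induction i with
  | zero =>
    induction j with
    | zero => simp
    | succ j ih =>
      have e : om ^ 0 * lam ^ (j + 1) * α = lam * (om ^ 0 * lam ^ j * α) := by ring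
      rw [e, w_lam_mul hm, ih]
  | succ i ih =>
    have e : om ^ (i + 1) * lam ^ j * α = om * (om ^ i * lam ^ j * α) := by ring
    rw [e, w_om_mul hm, ih]

lemma conj_w (m : ℕ) (α : Eis ℤ) : (starRingEnd ℂ) (w m α) = w m (star α) := by
  rcases eq_or_ne m 0 with rfl | hm
  · simp [w]
  have : NeZero m := ⟨hm⟩
  rw [w_eq_sum, w_eq_sum, map_mul, map_inv₀, map_natCast, map_sum]
  congr 1
  refine Fintype.sum_equiv (starRingAut (R := Eis (ZMod m))).toEquiv _ _ fun u => ?_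
  have h1 : ((starRingAut (R := Eis (ZMod m))).toEquiv u) = star u := rfl
  rw [h1, chi_star, map_star, ← star_mul']
  have : (star (u * red m α)).im = 0 ↔ (u * red m α).im = 0 := by
    generalize u * red m α = z
    simp
  by_cases h : (u * red m α).im = 0
  · rw [if_pos h, if_pos (this.2 h)]
  · rw [if_neg h, if_neg (fun h' => h (this.1 h')), map_zero]

lemma norm_w_le {m : ℕ} (hm : m ≠ 0) (α : Eis ℤ) : ‖w m α‖ ≤ m * m := by
  have : NeZero m := ⟨hm⟩
  have h1 : ‖∑ u : Eis (ZMod m),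
      if (u * red m α).im = 0 then (starRingEnd ℂ) (chi m u) else 0‖ ≤ (m * m : ℝ) := by
    refine (norm_sum_le _ _).trans ((Finset.sum_le_card_nsmul _ _ 1 fun u _ => ?_).trans ?_)
    · split_ifs
      · rw [RCLike.norm_conj]
        by_cases hu : IsUnit u
        · rw [chi_norm hu]
        · rw [chi_nonunit hm hu]; simp
      · simp
    · rw [Finset.card_univ, Fintype.card_congr (equivProd _ _), Fintype.card_prod, ZMod.card]
      simp
  rw [w_eq_sum, norm_mul, norm_inv, Complex.norm_natCast]
  have htp : (1 : ℝ) ≤ (m.totient : ℝ) := by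
    exact_mod_cast Nat.totient_pos.2 (Nat.pos_of_ne_zero hm)
  rw [inv_mul_le_iff₀ (by linarith)]
  have : (0:ℝ) ≤ m * m := by positivity
  nlinarith

end Eis

/-! ### Theta functions of binary quadratic forms -/

lemma summable_exp_int_sq {δ : ℝ} (hδ : 0 < δ) :
    Summable fun n : ℤ => Real.exp (-δ * (n : ℝ) ^ 2) := by
  have := summable_pow_mul_jacobiTheta₂_term_bound 0 (T := δ / Real.pi) (by positivity) 0
  refine this.congr fun n => ?_
  have hp := Real.pi_ne_zero
  simp only [pow_zero, one_mul]
  congr 1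
  field_simp
  ring

lemma tsum_gaussian_shift {κ : ℝ} (hκ : 0 < κ) (b : ℝ) :
    (∑' x : ℤ, Complex.exp (-Real.pi * κ * (x + b) ^ 2)) = (Real.sqrt κ : ℂ)⁻¹ *
      ∑' x : ℤ, Complex.exp (-Real.pi / κ * x ^ 2 - 2 * Real.pi * Complex.I * b * x) := by
  have hκ' : 0 < ((κ⁻¹ : ℝ) : ℂ).re := by simpa using hκ
  have h := Complex.tsum_exp_neg_quadratic hκ' (-Complex.I * b)
  have hs : (((κ⁻¹ : ℝ) : ℂ)) ^ (1 / 2 : ℂ) = (Real.sqrt κ : ℂ)⁻¹ := by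
    rw [← Complex.ofReal_inv, ← Real.sqrt_inv, Real.sqrt_eq_rpow,
      Complex.ofReal_cpow (by positivity)]
    norm_num
  have hne : (Real.sqrt κ : ℂ) ≠ 0 := by
    exact_mod_cast (Real.sqrt_pos.2 hκ).ne'
  have hκc : (κ : ℂ) ≠ 0 := by exact_mod_cast hκ.ne'
  rw [hs, one_div, inv_inv] at h
  have e1 : (∑' x : ℤ, Complex.exp (-Real.pi * κ * (x + b) ^ 2)) =
      ∑' n : ℤ, Complex.exp (-Real.pi / ((κ⁻¹ : ℝ) : ℂ) * (n + Complex.I * (-Complex.I * b)) ^ 2) := by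
    refine tsum_congr fun x => ?_
    congr 1
    have : Complex.I * (-Complex.I * b) = b := by
      rw [← mul_assoc, mul_neg, Complex.I_mul_I]; simp
    rw [this, Complex.ofReal_inv, div_inv_eq_mul]
  have e2 : (∑' x : ℤ, Complex.exp (-Real.pi / κ * x ^ 2 - 2 * Real.pi * Complex.I * b * x)) =
      ∑' n : ℤ, Complex.exp (-Real.pi * ((κ⁻¹ : ℝ) : ℂ) * n ^ 2 +
        2 * Real.pi * (-Complex.I * b) * n) := by
    refine tsum_congr fun x => ?_
    congr 1
    rw [Complex.ofReal_inv]
    ring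
  rw [e1, e2, h, inv_mul_cancel_left₀ hne]

lemma summable_gaussian_prod {a b : ℝ} (ha : 0 < a) (hb : 0 < b) :
    Summable fun p : ℤ × ℤ => Real.exp (-a * (p.1 : ℝ) ^ 2) * Real.exp (-b * (p.2 : ℝ) ^ 2) :=
  (summable_exp_int_sq ha).mul_of_nonneg (summable_exp_int_sq hb)
    (fun _ => (Real.exp_pos _).le) (fun _ => (Real.exp_pos _).le)

/-- The theta function of a point of the upper half plane. -/
def formTheta (μ b t : ℝ) : ℂ :=
  ∑' p : ℤ × ℤ, Complex.exp (-Real.pi * t * (μ * (p.1 + b * p.2) ^ 2 + p.2 ^ 2 / μ))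

lemma tsum_prod_right {α β : Type*} {f : α × β → ℂ} (hf : Summable f) :
    ∑' p, f p = ∑' y, ∑' x, f (x, y) := by
  rw [← (Equiv.prodComm β α).tsum_eq f]
  exact Summable.tsum_prod ((Equiv.prodComm β α).summable_iff.2 hf)

lemma sqrt_mul_formTheta {μ b t : ℝ} (hμ : 0 < μ) (ht : 0 < t)
    (hs : Summable fun p : ℤ × ℤ =>
      Complex.exp (-Real.pi * t * (μ * (p.1 + b * p.2) ^ 2 + p.2 ^ 2 / μ))) :
    (Real.sqrt μ * Real.sqrt t : ℝ) * formTheta μ b t =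
      ∑' p : ℤ × ℤ, Complex.exp (-Real.pi / μ * (p.1 ^ 2 / t + t * p.2 ^ 2)
        - 2 * Real.pi * Complex.I * b * p.1 * p.2) := by
  have hs2 : Summable fun p : ℤ × ℤ => Complex.exp (-Real.pi / μ * (p.1 ^ 2 / t + t * p.2 ^ 2)
        - 2 * Real.pi * Complex.I * b * p.1 * p.2) := by
    refine Summable.of_norm ?_
    have := summable_gaussian_prod (a := Real.pi / μ / t) (b := Real.pi / μ * t)
      (by positivity) (by positivity)
    refine this.congr fun p => ?_
    rw [Complex.norm_exp, ← Real.exp_add]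
    congr 1
    have : (-Real.pi / μ * (p.1 ^ 2 / t + t * p.2 ^ 2)
        - 2 * Real.pi * Complex.I * b * p.1 * p.2 : ℂ) =
        ((-(Real.pi / μ / t) * (p.1 : ℝ) ^ 2 + -(Real.pi / μ * t) * (p.2 : ℝ) ^ 2 : ℝ) : ℂ) +
        ((- 2 * Real.pi * b * p.1 * p.2 : ℝ) : ℂ) * Complex.I := by
      push_cast; ring
    rw [this, Complex.add_re, Complex.ofReal_re, Complex.re_ofReal_mul, Complex.I_re]; ring
  rw [formTheta, tsum_prod_right hs, tsum_prod_right hs2, ← tsum_mul_left]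
  refine tsum_congr fun y => ?_
  dsimp only
  have hμt : 0 < μ * t := by positivity
  have h := tsum_gaussian_shift hμt (b * y)
  have hμc : (μ : ℂ) ≠ 0 := by exact_mod_cast hμ.ne'
  have htc : (t : ℂ) ≠ 0 := by exact_mod_cast ht.ne'
  have e1 : ∑' x : ℤ, Complex.exp (-Real.pi * t * (μ * (x + b * y) ^ 2 + y ^ 2 / μ)) =
      Complex.exp (-Real.pi * t * (y ^ 2 / μ)) *
        ∑' x : ℤ, Complex.exp (-Real.pi * (μ * t : ℝ) * (x + (b * y : ℝ)) ^ 2) := by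
    rw [← tsum_mul_left]
    refine tsum_congr fun x => ?_
    rw [← Complex.exp_add]
    congr 1
    push_cast
    ring
  have e2 : ∑' x : ℤ, Complex.exp (-Real.pi / μ * (x ^ 2 / t + t * y ^ 2)
        - 2 * Real.pi * Complex.I * b * x * y) =
      Complex.exp (-Real.pi * t * (y ^ 2 / μ)) *
        ∑' x : ℤ, Complex.exp (-Real.pi / (μ * t : ℝ) * x ^ 2
          - 2 * Real.pi * Complex.I * (b * y : ℝ) * x) := by
    rw [← tsum_mul_left]
    refine tsum_congr fun x => ?_
    rw [← Complex.exp_add]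
    congr 1
    push_cast
    field_simp
    ring
  have hne : (Real.sqrt μ * Real.sqrt t : ℝ) ≠ 0 := by positivity
  rw [e1, e2, h, Real.sqrt_mul hμ.le]
  have hne' : ((Real.sqrt μ * Real.sqrt t : ℝ) : ℂ) ≠ 0 := by exact_mod_cast hne
  field_simp

lemma formTheta_inv {μ b t : ℝ} (hμ : 0 < μ) (ht : 0 < t)
    (hs : ∀ t : ℝ, 0 < t → Summable fun p : ℤ × ℤ =>
      Complex.exp (-Real.pi * t * (μ * (p.1 + b * p.2) ^ 2 + p.2 ^ 2 / μ))) :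
    formTheta μ b t⁻¹ = t * formTheta μ b t := by
  have h1 := sqrt_mul_formTheta hμ ht (hs t ht)
  have h2 := sqrt_mul_formTheta (b := b) hμ (inv_pos.2 ht) (hs _ (inv_pos.2 ht))
  have h3 : (Real.sqrt μ * Real.sqrt t⁻¹ : ℝ) * formTheta μ b t⁻¹ =
      (Real.sqrt μ * Real.sqrt t : ℝ) * formTheta μ b t := by
    rw [h1, h2, ← (Equiv.prodComm ℤ ℤ).tsum_eq]
    refine tsum_congr fun p => ?_
    congr 1
    have htc : (t : ℂ) ≠ 0 := by exact_mod_cast ht.ne'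
    simp only [Equiv.prodComm_apply, Prod.fst_swap, Prod.snd_swap, Complex.ofReal_inv]
    field_simp
    ring
  have hm : (Real.sqrt μ : ℂ) ≠ 0 := by exact_mod_cast (Real.sqrt_pos.2 hμ).ne'
  have hst : (Real.sqrt t : ℂ) ≠ 0 := by exact_mod_cast (Real.sqrt_pos.2 ht).ne'
  rw [Real.sqrt_inv] at h3
  push_cast at h3
  rw [mul_assoc, mul_assoc] at h3
  have h4 := mul_left_cancel₀ hm h3
  have h5 : formTheta μ b t⁻¹ = (Real.sqrt t * Real.sqrt t : ℂ) * formTheta μ b t := by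
    rw [mul_assoc, ← h4, mul_inv_cancel_left₀ hst]
  rw [h5, ← Complex.ofReal_mul, Real.mul_self_sqrt ht.le]

namespace Eis

/-! ### Sums over the Eisenstein integers -/

lemma half_sq_le_norm (α : Eis ℤ) :
    ((α.re : ℝ) ^ 2 + (α.im : ℝ) ^ 2) / 2 ≤ (norm α : ℤ) := by
  rw [norm_eq]
  push_cast
  nlinarith [sq_nonneg ((α.re : ℝ) - α.im)]

lemma one_le_norm {α : Eis ℤ} (h : α ≠ 0) : (1 : ℝ) ≤ (norm α : ℤ) := by
  have h1 := norm_nonneg α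
  have h2 : norm α ≠ 0 := fun h0 => h ((norm_eq_zero_iff α).1 h0)
  exact_mod_cast (by omega : 1 ≤ norm α)

lemma summable_re_im {f : ℤ × ℤ → ℝ} (h : Summable f) :
    Summable fun α : Eis ℤ => f (α.re, α.im) :=
  (QuadraticAlgebra.equivProd (R := ℤ) (-1) (-1)).summable_iff.2 h

lemma summable_exp_norm {δ : ℝ} (hδ : 0 < δ) :
    Summable fun α : Eis ℤ => Real.exp (-δ * (norm α : ℤ)) := by
  have h := summable_gaussian_prod (half_pos hδ) (half_pos hδ)
  have h2 := summable_re_im h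
  refine Summable.of_nonneg_of_le (fun _ => (Real.exp_pos _).le) (fun α => ?_) h2
  dsimp only
  rw [← Real.exp_add, Real.exp_le_exp]
  nlinarith [half_sq_le_norm α]

lemma summable_int_inv_one_add_sq : Summable fun n : ℤ => (1 + (n : ℝ) ^ 2)⁻¹ := by
  have h : Summable fun n : ℤ => (((|n| : ℤ) : ℝ) ^ (2 : ℝ))⁻¹ := by
    have := Real.summable_abs_int_rpow (b := 2) one_lt_two
    refine this.congr fun n => ?_
    rw [Real.rpow_neg (abs_nonneg _)]
    push_cast
    rfl
  refine Summable.of_norm_bounded_eventually h ?_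
  have : {n : ℤ | n = 0}.Finite := by simp
  refine Filter.eventually_cofinite.2 (this.subset fun n hn => ?_)
  by_contra h0
  apply hn
  have h0' : (0 : ℝ) < (n : ℝ) ^ 2 := by
    have : (n : ℝ) ≠ 0 := by exact_mod_cast h0
    positivity
  rw [Real.norm_of_nonneg (by positivity)]
  apply inv_anti₀
  · push_cast; rw [Real.rpow_two, sq_abs]; exact h0'
  · push_cast; rw [Real.rpow_two, sq_abs]; linarith

lemma summable_norm_rpow {σ : ℝ} (hσ : 2 ≤ σ) :
    Summable fun α : Eis ℤ => ((norm α : ℤ) : ℝ) ^ (-σ) := by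
  have h := summable_int_inv_one_add_sq.mul_of_nonneg summable_int_inv_one_add_sq
    (fun n => by positivity) (fun n => by positivity)
  have h2 := (summable_re_im h).mul_left 9
  refine Summable.of_nonneg_of_le
    (fun α => Real.rpow_nonneg (by exact_mod_cast norm_nonneg α) _) (fun α => ?_) h2
  dsimp only
  rcases eq_or_ne α 0 with rfl | hα
  · simp [Real.zero_rpow (by linarith : -σ ≠ 0)]
  have h1 := one_le_norm hα
  have h3 := half_sq_le_norm α
  set N : ℝ := ((norm α : ℤ) : ℝ)
  calc N ^ (-σ) ≤ N ^ (-2 : ℝ) := Real.rpow_le_rpow_of_exponent_le h1 (by linarith)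
    _ = (N ^ 2)⁻¹ := by rw [Real.rpow_neg (by linarith), Real.rpow_two]
    _ ≤ _ := by
      rw [← mul_inv, ← div_eq_mul_inv, inv_eq_one_div, div_le_div_iff₀ (by positivity) (by positivity)]
      have : 1 + (α.re : ℝ) ^ 2 ≤ 3 * N := by nlinarith [sq_nonneg (α.im : ℝ)]
      have h5 : 1 + (α.im : ℝ) ^ 2 ≤ 3 * N := by nlinarith [sq_nonneg (α.re : ℝ)]
      have := mul_le_mul this h5 (by positivity) (by positivity)
      nlinarith

/-! ### Sublattices cut out by a linear congruence -/

lemma exists_hermite_normal_form {m : ℕ} (hm : m ≠ 0) (A B : ℤ)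
    (h : ∀ p : ℕ, p.Prime → p ∣ m → (p : ℤ) ∣ A → (p : ℤ) ∣ B → False) :
    ∃ (g k : ℕ) (s : ℤ), k * g = m ∧ ∀ x y : ℤ, (m : ℤ) ∣ A * x + B * y ↔
      ∃ X Y : ℤ, x = k * X + s * Y ∧ y = g * Y := by
  set g := Int.gcd A m with hg
  have hg0 : g ≠ 0 := by
    intro h0
    rw [hg, Int.gcd_eq_zero_iff] at h0
    exact hm (by exact_mod_cast h0.2)
  have hgz : (g : ℤ) ≠ 0 := by exact_mod_cast hg0
  obtain ⟨A', hA'⟩ : (g : ℤ) ∣ A := Int.gcd_dvd_left ..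
  obtain ⟨k, hk⟩ : g ∣ m := by exact_mod_cast (Int.gcd_dvd_right A m)
  have hcop : IsCoprime A' (k : ℤ) := by
    rw [Int.isCoprime_iff_gcd_eq_one]
    have : g * Int.gcd A' k = g * 1 := by
      rw [mul_one]
      conv_rhs => rw [hg, hA', hk]
      push_cast
      rw [Int.gcd_mul_left, Int.natAbs_natCast]
    exact Nat.eq_of_mul_eq_mul_left (Nat.pos_of_ne_zero hg0) this
  have hBg : IsCoprime (g : ℤ) B := by
    rw [Int.isCoprime_iff_gcd_eq_one]
    by_contra hne
    obtain ⟨p, hp, hpd⟩ := Nat.exists_prime_and_dvd hne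
    have h1 : (p : ℤ) ∣ g := (Int.natCast_dvd_natCast.2 hpd).trans (Int.gcd_dvd_left ..)
    have h2 : (p : ℤ) ∣ B := (Int.natCast_dvd_natCast.2 hpd).trans (Int.gcd_dvd_right ..)
    refine h p hp ?_ (h1.trans ⟨A', hA'⟩) h2
    exact (Int.natCast_dvd_natCast.1 h1).trans ⟨k, hk⟩
  obtain ⟨r, v, hrv⟩ := hcop
  have hmz : (m : ℤ) = g * k := by exact_mod_cast hk
  refine ⟨g, k, -r * B, by rw [hk, mul_comm], fun x y => ⟨fun hd => ?_, ?_⟩⟩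
  · rw [hmz, hA'] at hd
    have hgy : (g : ℤ) ∣ y := by
      have h1 : (g : ℤ) ∣ B * y := by
        have h2 := (dvd_mul_right (g : ℤ) k).trans hd
        rwa [mul_assoc, dvd_add_right (dvd_mul_right _ _)] at h2
      exact hBg.dvd_of_dvd_mul_left h1
    obtain ⟨Y, rfl⟩ := hgy
    have h1 : (k : ℤ) ∣ A' * x + B * Y := by
      have : (g : ℤ) * A' * x + B * (g * Y) = g * (A' * x + B * Y) := by ring
      rw [this] at hd
      exact (mul_dvd_mul_iff_left hgz).1 hd
    have h2 : (k : ℤ) ∣ x - -r * B * Y := by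
      have : x - -r * B * Y = r * (A' * x + B * Y) + k * (v * x) := by
        linear_combination (-x) * hrv
      rw [this]
      exact dvd_add (h1.mul_left _) (dvd_mul_right _ _)
    obtain ⟨X, hX⟩ := h2
    exact ⟨X, Y, by linarith, rfl⟩
  · rintro ⟨X, Y, rfl, rfl⟩
    rw [hmz, hA']
    refine ⟨A' * X + v * B * Y, ?_⟩
    linear_combination (-(g : ℤ) * B * Y) * hrv

/-- The theta function of the lattice `{α | im (u α) = 0}`. -/
def latTheta (m : ℕ) (u : Eis (ZMod m)) (t : ℝ) : ℂ :=
  ∑' α : Eis ℤ, if (u * red m α).im = 0 then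
    Complex.exp (-(2 * Real.pi / (Real.sqrt 3 * m)) * t * (norm α : ℤ)) else 0

lemma summable_cexp_norm {δ : ℝ} (hδ : 0 < δ) :
    Summable fun α : Eis ℤ => Complex.exp (-δ * (norm α : ℤ)) := by
  refine Summable.of_norm ((summable_exp_norm hδ).congr fun α => ?_)
  rw [Complex.norm_exp]
  congr 1
  simp

lemma latTheta_inv {m : ℕ} (hm : m ≠ 0) {u : Eis (ZMod m)} (hu : IsUnit u) {t : ℝ} (ht : 0 < t) :
    latTheta m u t⁻¹ = t * latTheta m u t := by
  have : NeZero m := ⟨hm⟩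
  obtain ⟨g, k, s, hkg, hL⟩ := exists_hermite_normal_form hm (u.im.val : ℤ) ((u.re - u.im).val : ℤ)
    (by
      intro p hp hpm h1 h2
      have hun := isUnit_iff_norm_isUnit.1 hu
      have := Fact.mk hp
      have h3 := hun.map (ZMod.castHom hpm (ZMod p))
      have e1 : ZMod.castHom hpm (ZMod p) u.im = 0 := by
        rw [← ZMod.natCast_zmod_val u.im, map_natCast, ZMod.natCast_eq_zero_iff]
        exact_mod_cast h1
      have e2 : ZMod.castHom hpm (ZMod p) (u.re - u.im) = 0 := by
        rw [← ZMod.natCast_zmod_val (u.re - u.im), map_natCast, ZMod.natCast_eq_zero_iff]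
        exact_mod_cast h2
      rw [map_sub, e1, sub_zero] at e2
      rw [norm_eq, map_add, map_sub, map_pow, map_pow, map_mul, e1, e2] at h3
      simp at h3)
  have hk : k ≠ 0 := by rintro rfl; simp at hkg; exact hm hkg.symm
  have hg : g ≠ 0 := by rintro rfl; simp at hkg; exact hm hkg.symm
  have hcond : ∀ α : Eis ℤ, (u * red m α).im = 0 ↔
      ∃ X Y : ℤ, α.re = k * X + s * Y ∧ α.im = g * Y := by
    intro α
    rw [← hL, ← ZMod.intCast_zmod_eq_zero_iff_dvd]
    have : (u * red m α).im = ((u.im.val * α.re + (u.re - u.im).val * α.im : ℤ) : ZMod m) := by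
      push_cast
      rw [ZMod.natCast_zmod_val, ZMod.natCast_zmod_val]
      simp [red]
      ring
    rw [this]
  let f : ℤ × ℤ → Eis ℤ := fun p => ⟨k * p.1 + s * p.2, g * p.2⟩
  have hf : Function.Injective f := by
    rintro ⟨X, Y⟩ ⟨X', Y'⟩ h
    have h1 := congrArg QuadraticAlgebra.re h
    have h2 := congrArg QuadraticAlgebra.im h
    simp only [f] at h1 h2
    have hY : Y = Y' := mul_left_cancel₀ (by exact_mod_cast hg) h2
    subst hY
    have hX : X = X' := mul_left_cancel₀ (by exact_mod_cast hk : (k : ℤ) ≠ 0) (by linarith)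
    rw [hX]
  set μ : ℝ := 2 * k / (Real.sqrt 3 * g) with hμ
  have hk' : (0 : ℝ) < k := by positivity
  have hg' : (0 : ℝ) < g := by positivity
  have hs3 : (0 : ℝ) < Real.sqrt 3 := by positivity
  have hμ0 : 0 < μ := by positivity
  set b : ℝ := (s - g / 2) / k with hb
  have hexp : ∀ (t : ℝ) (p : ℤ × ℤ),
      Complex.exp (-(2 * Real.pi / (Real.sqrt 3 * m)) * t * (norm (f p) : ℤ)) =
      Complex.exp (-Real.pi * t * (μ * (p.1 + b * p.2) ^ 2 + p.2 ^ 2 / μ)) := by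
    intro t p
    congr 1
    have key : (2 * Real.pi / (Real.sqrt 3 * m)) * t * (norm (f p) : ℤ) =
        Real.pi * t * (μ * (p.1 + b * p.2) ^ 2 + p.2 ^ 2 / μ) := by
      have h3 : Real.sqrt 3 ^ 2 = 3 := Real.sq_sqrt (by norm_num)
      have hm' : (m : ℝ) = k * g := by exact_mod_cast hkg.symm
      rw [norm_eq, hm', hμ, hb]
      simp only [f]
      push_cast
      field_simp
      rw [h3]
      ring
    have key' := congrArg (fun x : ℝ => -(x : ℂ)) key
    push_cast at key'
    linear_combination key'
  have hth : ∀ t, latTheta m u t = formTheta μ b t := by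
    intro t
    rw [latTheta, formTheta, ← hf.tsum_eq]
    · refine tsum_congr fun p => ?_
      rw [if_pos ((hcond _).2 ⟨p.1, p.2, rfl, rfl⟩), hexp]
    · intro α hα
      rw [Function.mem_support] at hα
      have hc : (u * red m α).im = 0 := by
        by_contra hc
        exact hα (if_neg hc)
      obtain ⟨X, Y, h1, h2⟩ := (hcond α).1 hc
      exact ⟨(X, Y), by ext <;> simp [f, h1, h2]⟩
  rw [hth, hth]
  refine formTheta_inv hμ0 ht fun t ht => ?_
  have hm' : (0 : ℝ) < m := by positivity
  have h := (summable_cexp_norm (δ := 2 * Real.pi / (Real.sqrt 3 * m) * t) (by positivity)).comp_injective hf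
  refine h.congr fun p => ?_
  rw [← hexp]
  simp

/-- The theta function with coefficients `w m`. -/
def wTheta (m : ℕ) (t : ℝ) : ℂ :=
  ∑' α : Eis ℤ, w m α * Complex.exp (-(2 * Real.pi / (Real.sqrt 3 * m)) * t * (norm α : ℤ))

lemma summable_latTheta {m : ℕ} (hm : m ≠ 0) (u : Eis (ZMod m)) {t : ℝ} (ht : 0 < t) :
    Summable fun α : Eis ℤ => if (u * red m α).im = 0 then
    Complex.exp (-(2 * Real.pi / (Real.sqrt 3 * m)) * t * (norm α : ℤ)) else 0 := by
  have hm' : (0 : ℝ) < m := by positivity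
  have h := (summable_cexp_norm (δ := 2 * Real.pi / (Real.sqrt 3 * m) * t) (by positivity)).norm
  refine Summable.of_norm_bounded h fun α => ?_
  split_ifs
  · apply le_of_eq
    congr 2
    push_cast
    ring
  · simp

lemma wTheta_eq {m : ℕ} [NeZero m] {t : ℝ} (ht : 0 < t) :
    wTheta m t = (m.totient : ℂ)⁻¹ * ∑ u : Eis (ZMod m),
      (starRingEnd ℂ) (chi m u) * latTheta m u t := by
  have hm : m ≠ 0 := NeZero.ne m
  simp only [latTheta, ← tsum_mul_left]
  rw [← Summable.tsum_finsetSum (fun u _ => (summable_latTheta hm u ht).mul_left _), ← tsum_mul_left,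
    wTheta]
  refine tsum_congr fun α => ?_
  rw [w_eq_sum, mul_assoc, Finset.sum_mul]
  congr 1
  refine Finset.sum_congr rfl fun u _ => ?_
  split_ifs <;> simp

lemma wTheta_inv {m : ℕ} (hm : m ≠ 0) {t : ℝ} (ht : 0 < t) :
    wTheta m t⁻¹ = t * wTheta m t := by
  have : NeZero m := ⟨hm⟩
  rw [wTheta_eq ht, wTheta_eq (inv_pos.2 ht), mul_left_comm]
  congr 1
  rw [Finset.mul_sum]
  apply Finset.sum_congr rfl
  intro u _
  by_cases hu : IsUnit u
  · rw [latTheta_inv hm hu ht]; ring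
  · rw [chi_nonunit hm hu]; simp

end Eis

namespace Eis

/-! ### The completed L-function -/

open Filter Asymptotics Set MeasureTheory

instance : Countable (Eis ℤ) := 
  (QuadraticAlgebra.equivProd (R := ℤ) (-1) (-1)).injective.countable

/-- The exponential rate in `wTheta m`. -/
def rate (m : ℕ) : ℝ := 2 * Real.pi / (Real.sqrt 3 * m)

lemma rate_pos {m : ℕ} (hm : m ≠ 0) : 0 < rate m := by
  have : (0 : ℝ) < m := by positivity
  unfold rate; positivity

lemma wTheta_eq_tsum (m : ℕ) (t : ℝ) :
    wTheta m t = ∑' α : Eis ℤ, w m α * (Real.exp (-(rate m * (norm α : ℤ)) * t) : ℝ) := by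
  refine tsum_congr fun α => ?_
  congr 1
  rw [rate]
  push_cast
  congr 1
  ring

lemma norm_wTheta_term_le {m : ℕ} (hm : m ≠ 0) {t₀ t : ℝ} (h : t₀ ≤ t) (α : Eis ℤ) :
    ‖w m α * (Real.exp (-(rate m * (norm α : ℤ)) * t) : ℝ)‖ ≤
      m * m * Real.exp (-(rate m * t₀) * (norm α : ℤ)) := by
  rw [_root_.norm_mul, Complex.norm_real, Real.norm_of_nonneg (Real.exp_pos _).le]
  refine mul_le_mul (norm_w_le hm α) (Real.exp_le_exp.2 ?_) (Real.exp_pos _).le (by positivity)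
  have h1 : (0 : ℝ) ≤ (norm α : ℤ) := by exact_mod_cast norm_nonneg α
  have h2 := mul_le_mul_of_nonneg_left h (mul_nonneg (rate_pos hm).le h1)
  nlinarith

lemma summable_wTheta {m : ℕ} (hm : m ≠ 0) {t : ℝ} (ht : 0 < t) :
    Summable fun α : Eis ℤ => w m α * (Real.exp (-(rate m * (norm α : ℤ)) * t) : ℝ) :=
  Summable.of_norm_bounded ((summable_exp_norm (mul_pos (rate_pos hm) ht)).mul_left _)
    (norm_wTheta_term_le hm le_rfl)

lemma continuousOn_wTheta {m : ℕ} (hm : m ≠ 0) : ContinuousOn (wTheta m) (Ioi 0) := by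
  intro t ht
  have ht2 : 0 < t / 2 := half_pos ht
  have : ContinuousOn (wTheta m) (Ici (t / 2)) := by
    have := continuousOn_tsum (s := Ici (t / 2))
      (f := fun (α : Eis ℤ) t => w m α * (Real.exp (-(rate m * (norm α : ℤ)) * t) : ℝ))
      (fun α => by fun_prop) ((summable_exp_norm (mul_pos (rate_pos hm) ht2)).mul_left (m * m : ℝ))
      (fun α t' ht' => norm_wTheta_term_le hm ht' α)
    exact this.congr fun t' _ => wTheta_eq_tsum m t'
  exact (this.continuousAt (Ici_mem_nhds (half_lt_self ht))).continuousWithinAt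

lemma norm_wTheta_le {m : ℕ} (hm : m ≠ 0) (h0 : w m 0 = 0) {t : ℝ} (ht : 1 ≤ t) :
    ‖wTheta m t‖ ≤ (m * m * ∑' α : Eis ℤ, Real.exp (-rate m * (norm α : ℤ))) *
      Real.exp (rate m) * Real.exp (-rate m * t) := by
  have hs := summable_exp_norm (rate_pos hm)
  rw [wTheta_eq_tsum, ← tsum_mul_left, ← tsum_mul_right, ← tsum_mul_right]
  refine tsum_of_norm_bounded ((((hs.mul_left _).mul_right _).mul_right _).hasSum) fun α => ?_
  rw [_root_.norm_mul, Complex.norm_real, Real.norm_of_nonneg (Real.exp_pos _).le, mul_assoc,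
    mul_assoc, ← Real.exp_add, ← Real.exp_add]
  rcases eq_or_ne α 0 with rfl | hα
  · rw [h0, _root_.norm_zero, zero_mul]; positivity
  refine mul_le_mul (norm_w_le hm α) (Real.exp_le_exp.2 ?_) (Real.exp_pos _).le (by positivity)
  have h1 := one_le_norm hα
  have := mul_nonneg (rate_pos hm).le (mul_nonneg (sub_nonneg.2 h1) (sub_nonneg.2 ht))
  nlinarith

lemma wTheta_isBigO {m : ℕ} (hm : m ≠ 0) (h0 : w m 0 = 0) (r : ℝ) :
    wTheta m =O[atTop] (fun t : ℝ => t ^ r) := by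
  refine IsBigO.trans ?_ (isLittleO_exp_neg_mul_rpow_atTop (rate_pos hm) r).isBigO
  refine IsBigO.of_bound ((m * m * ∑' α : Eis ℤ, Real.exp (-rate m * (norm α : ℤ))) *
      Real.exp (rate m)) ((eventually_ge_atTop 1).mono fun t ht => ?_)
  rw [Real.norm_of_nonneg (Real.exp_pos _).le]
  exact norm_wTheta_le hm h0 ht

/-- The functional equation data of `wTheta m`. -/
def fePair {m : ℕ} (hm : m ≠ 0) (h0 : w m 0 = 0) : WeakFEPair ℂ where
  f := wTheta m
  g := wTheta m
  k := 1
  ε := 1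
  f₀ := 0
  g₀ := 0
  hf_int := (continuousOn_wTheta hm).locallyIntegrableOn measurableSet_Ioi
  hg_int := (continuousOn_wTheta hm).locallyIntegrableOn measurableSet_Ioi
  hk := one_pos
  hε := one_ne_zero
  h_feq := fun t ht => by
    rw [one_div, wTheta_inv hm ht, Real.rpow_one, one_mul, smul_eq_mul]
  hf_top := fun r => by simpa using wTheta_isBigO hm h0 r
  hg_top := fun r => by simpa using wTheta_isBigO hm h0 r

lemma isStrongFEPair_fePair {m : ℕ} (hm : m ≠ 0) (h0 : w m 0 = 0) :
    IsStrongFEPair (fePair hm h0) := ⟨rfl, rfl⟩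

lemma differentiable_mellin_wTheta {m : ℕ} (hm : m ≠ 0) (h0 : w m 0 = 0) :
    Differentiable ℂ (mellin (wTheta m)) := fun s => by
  have h := isStrongFEPair_fePair hm h0
  exact mellin_differentiableAt_of_isBigO_rpow (a := s.re + 1) (b := s.re - 1)
    (fePair hm h0).hf_int (h.hf_top _) (by linarith) (h.hf_zero _) (by linarith)

lemma mellinConvergent_wTheta {m : ℕ} (hm : m ≠ 0) (h0 : w m 0 = 0) (s : ℂ) :
    MellinConvergent (wTheta m) s := by
  have h := isStrongFEPair_fePair hm h0
  exact mellinConvergent_of_isBigO_rpow (a := s.re + 1) (b := s.re - 1)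
    (fePair hm h0).hf_int (h.hf_top _) (by linarith) (h.hf_zero _) (by linarith)

lemma mellin_wTheta {m : ℕ} (hm : m ≠ 0) (h0 : w m 0 = 0) {s : ℂ} (hs : 2 ≤ s.re) :
    mellin (wTheta m) s = Complex.Gamma s * (rate m : ℂ) ^ (-s) *
      ∑' α : Eis ℤ, w m α * ((norm α : ℤ) : ℂ) ^ (-s) := by
  have hr := rate_pos hm
  have h := hasSum_mellin (ι := Eis ℤ) (a := w m) (p := fun α => rate m * (norm α : ℤ))
    (F := wTheta m) (s := s) (fun α => ?_) (by linarith) (fun t ht => ?_) ?_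
  · rw [← h.tsum_eq, ← tsum_mul_left]
    refine tsum_congr fun α => ?_
    rcases eq_or_ne α 0 with rfl | hα
    · simp [h0]
    have h1 : (0 : ℝ) < (norm α : ℤ) := lt_of_lt_of_le one_pos (one_le_norm hα)
    rw [Complex.ofReal_mul, Complex.mul_cpow_ofReal_nonneg hr.le h1.le, Complex.cpow_neg,
      Complex.cpow_neg, Complex.ofReal_intCast, div_eq_mul_inv, mul_inv]
    ring
  · rcases eq_or_ne α 0 with rfl | hα
    · exact Or.inl h0
    · exact Or.inr (mul_pos hr (lt_of_lt_of_le one_pos (one_le_norm hα)))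
  · rw [wTheta_eq_tsum]
    exact (summable_wTheta hm ht).hasSum
  · refine Summable.of_nonneg_of_le (fun α => ?_) (fun α => ?_)
      ((summable_norm_rpow hs).mul_left (m * m * rate m ^ (-s.re)))
    · have h1 : (0 : ℝ) ≤ (norm α : ℤ) := by exact_mod_cast norm_nonneg α
      positivity
    · have h1 : (0 : ℝ) ≤ (norm α : ℤ) := by exact_mod_cast norm_nonneg α
      rw [div_eq_mul_inv, ← Real.rpow_neg (by positivity), Real.mul_rpow hr.le h1, mul_assoc]
      refine mul_le_mul_of_nonneg_right (norm_w_le hm α) ?_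
      positivity

lemma conj_wTheta (m : ℕ) (t : ℝ) : (starRingEnd ℂ) (wTheta m t) = wTheta m t := by
  rw [wTheta_eq_tsum, Complex.conj_tsum]
  have hinv : Function.Involutive (star : Eis ℤ → Eis ℤ) := star_involutive
  rw [← hinv.toPerm.tsum_eq]
  refine tsum_congr fun α => ?_
  rw [map_mul, conj_w, Complex.conj_ofReal]
  simp only [Function.Involutive.coe_toPerm, star_star, QuadraticAlgebra.norm_star]

lemma wTheta_eq_re (m : ℕ) (t : ℝ) : wTheta m t = ((wTheta m t).re : ℂ) :=
  (Complex.conj_eq_iff_re.1 (conj_wTheta m t)).symm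

lemma integrableOn_wTheta {m : ℕ} (hm : m ≠ 0) (h0 : w m 0 = 0) :
    IntegrableOn (fun t : ℝ => t ^ (-1 / 2 : ℝ) * (wTheta m t).re) (Ioi 0) := by
  have h := mellinConvergent_wTheta hm h0 (1 / 2)
  have h2 := h.re
  refine IntegrableOn.congr_fun h2 (fun t ht => ?_) measurableSet_Ioi
  have e : ((1 / 2 - 1 : ℂ)) = ((-1 / 2 : ℝ) : ℂ) := by norm_num
  simp only [smul_eq_mul, RCLike.re_eq_complex_re]
  rw [e, ← Complex.ofReal_cpow (le_of_lt ht), Complex.re_ofReal_mul]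

lemma mellin_wTheta_half {m : ℕ} (hm : m ≠ 0) (h0 : w m 0 = 0) :
    mellin (wTheta m) (1 / 2) =
      ((2 * ∫ t : ℝ in Ioi 1, t ^ (-1 / 2 : ℝ) * (wTheta m t).re : ℝ) : ℂ) := by
  have e : ((1 / 2 - 1 : ℂ)) = ((-1 / 2 : ℝ) : ℂ) := by norm_num
  have h1 : mellin (wTheta m) (1 / 2) =
      ((∫ t : ℝ in Ioi 0, t ^ (-1 / 2 : ℝ) * (wTheta m t).re : ℝ) : ℂ) := by
    rw [mellin, ← integral_complex_ofReal]
    refine setIntegral_congr_fun measurableSet_Ioi fun t ht => ?_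
    simp only [smul_eq_mul]
    rw [e, ← Complex.ofReal_cpow (le_of_lt ht)]
    conv_lhs => rw [wTheta_eq_re m t]
    push_cast
    rfl
  rw [h1]
  congr 1
  have hInt := integrableOn_wTheta hm h0
  set f : ℝ → ℝ := fun t : ℝ => t ^ (-1 / 2 : ℝ) * (wTheta m t).re with hf
  have hU : Ioi (0 : ℝ) = Ioc 0 1 ∪ Ioi 1 := (Ioc_union_Ioi_eq_Ioi zero_le_one).symm
  have h2 : ∫ t in Ioi 0, f t = (∫ t in Ioc 0 1, f t) + ∫ t in Ioi 1, f t := by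
    rw [hU, setIntegral_union (Set.Ioc_disjoint_Ioi le_rfl) measurableSet_Ioi
      (hInt.mono_set Ioc_subset_Ioi_self) (hInt.mono_set (Ioi_subset_Ioi zero_le_one))]
  have h3 : ∫ t in Ioc 0 1, f t = ∫ t in Ioi 1, f t := by
    have h4 := integral_comp_rpow_Ioi ((Ioc (0 : ℝ) 1).indicator f) (p := -1) (by norm_num)
    rw [setIntegral_indicator measurableSet_Ioc,
      Set.inter_eq_right.2 Ioc_subset_Ioi_self] at h4
    rw [← h4, ← integral_Ici_eq_integral_Ioi (x := (1 : ℝ)),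
      ← Set.inter_eq_right.2 (Set.Ici_subset_Ioi.2 (zero_lt_one (α := ℝ))),
      ← setIntegral_indicator measurableSet_Ici]
    refine setIntegral_congr_fun measurableSet_Ioi fun t (ht : 0 < t) => ?_
    simp only [abs_neg, abs_one, one_mul, Real.rpow_neg_one, smul_eq_mul]
    by_cases h1t : 1 ≤ t
    · rw [Set.indicator_of_mem (by exact ⟨by positivity, inv_le_one_of_one_le₀ h1t⟩),
        Set.indicator_of_mem (by exact h1t)]
      simp only [hf]
      rw [wTheta_inv hm ht, Complex.re_ofReal_mul, Real.inv_rpow ht.le, ← Real.rpow_neg ht.le]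
      have : t ^ (-1 - 1 : ℝ) * (t ^ (-(-1 / 2) : ℝ) * t) = t ^ (-1 / 2 : ℝ) := by
        nth_rewrite 3 [← Real.rpow_one t]
        rw [← Real.rpow_add ht, ← Real.rpow_add ht]
        norm_num
      rw [← this]
      ring
    · rw [Set.indicator_of_notMem, Set.indicator_of_notMem, mul_zero]
      · exact fun h => h1t h
      · intro h
        exact h1t ((inv_le_one₀ ht).1 h.2)
  rw [h2, h3]
  ring

end Eis

open scoped ZMod ComplexConjugate in
theorem ZMod.sum_normSq_dft {n : ℕ} [NeZero n] (Φ : ZMod n → ℂ) :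
    ∑ j, ‖𝓕 Φ j‖ ^ 2 = n * ∑ s, ‖Φ s‖ ^ 2 := by
  have hswap (Ψ : ZMod n → ℂ) : ∑ j, 𝓕 Φ j * Ψ j = ∑ s, Φ s * 𝓕 Ψ s := by
    simp only [ZMod.dft_apply, smul_eq_mul, Finset.sum_mul, Finset.mul_sum]
    rw [Finset.sum_comm]
    refine Finset.sum_congr rfl fun s _ => Finset.sum_congr rfl fun j _ => ?_
    rw [mul_comm s j]; ring
  have hconj : (fun j => conj (𝓕 Φ j)) = 𝓕 (fun s => conj (Φ (-s))) := by
    funext j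
    simp only [ZMod.dft_apply, smul_eq_mul, map_sum, map_mul]
    refine Fintype.sum_equiv (Equiv.neg _) _ _ fun s => ?_
    simp [AddChar.map_neg_eq_conj]
  have := hswap (fun j => conj (𝓕 Φ j))
  rw [hconj] at this
  rw [ZMod.dft_dft] at this
  have h2 : ∀ j, 𝓕 Φ j * conj (𝓕 Φ j) = ((‖𝓕 Φ j‖ ^ 2 : ℝ) : ℂ) := by
    intro j
    rw [Complex.mul_conj, Complex.normSq_eq_norm_sq]
  have h3 : ∀ j, Φ j * (n • (conj (Φ (- -j)))) = ((n * ‖Φ j‖ ^ 2 : ℝ) : ℂ) := by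
    intro j
    rw [neg_neg, nsmul_eq_mul, mul_left_comm, Complex.mul_conj, Complex.normSq_eq_norm_sq]
    push_cast; ring
  simp only [h2] at this
  rw [Finset.mul_sum]
  apply Complex.ofReal_injective
  push_cast at this ⊢
  rw [this]
  refine Finset.sum_congr rfl fun j _ => ?_
  have := h3 j
  push_cast at this
  rw [← this]
  simp

theorem ZMod.card_mul_natCast_eq_zero_le {n : ℕ} [NeZero n] {a : ℕ} :
    (Finset.univ.filter fun x : ZMod n => x * (a : ZMod n) = 0).card ≤ a ∨ a = 0 := by
  rcases Nat.eq_zero_or_pos a with h | ha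
  · exact Or.inr h
  left
  have hn : 0 < n := Nat.pos_of_ne_zero (NeZero.ne n)
  have key : ∀ x : ZMod n, x * (a : ZMod n) = 0 → n ∣ x.val * a := by
    intro x hx
    rw [← ZMod.natCast_eq_zero_iff]
    push_cast
    rwa [ZMod.natCast_zmod_val]
  refine (Finset.card_le_card_of_injOn (t := Finset.range a) (fun x => x.val * a / n) ?_ ?_).trans
    (Finset.card_range a).le
  · intro x hx
    simp only [Finset.coe_range, Set.mem_Iio]
    rw [Nat.div_lt_iff_lt_mul hn, mul_comm a n]
    exact Nat.mul_lt_mul_of_pos_right (ZMod.val_lt x) ha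
  · intro x hx y hy hxy
    simp only [Finset.coe_filter, Finset.mem_univ, true_and, Set.mem_ofPred_eq] at hx hy
    simp only at hxy
    have h1 := Nat.div_mul_cancel (key x hx)
    have h2 := Nat.div_mul_cancel (key y hy)
    rw [hxy, h2] at h1
    exact ZMod.val_injective _ (Nat.eq_of_mul_eq_mul_right ha h1.symm)

open scoped ZMod ComplexConjugate in
theorem DirichletCharacter.norm_dft_sq_le {n : ℕ} [NeZero n] (X : DirichletCharacter ℂ n)
    {a : ℕ} (ha : a ≠ 0) {k : ZMod n} (hk : k = a ∨ k = -a) :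
    ‖𝓕 (fun s => X s) k‖ ^ 2 ≤ n * a := by
  have hu (u : (ZMod n)ˣ) : ‖𝓕 (fun s => X s) (u * k)‖ = ‖𝓕 (fun s => X s) k‖ := by
    have := ZMod.dft_comp_unitMul (fun s => X s) u⁻¹ k
    simp only [map_mul, inv_inv] at this
    have h2 := ZMod.dft_const_mul (X (u⁻¹ : (ZMod n)ˣ)) (fun s => X s)
    have h3 : 𝓕 (fun j => X ((u⁻¹ : (ZMod n)ˣ) : ZMod n) * X j) k = 𝓕 (fun s => X s) (u * k) := by
      have := ZMod.dft_comp_unitMul (fun s => X s) u⁻¹ k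
      simpa only [map_mul, inv_inv] using this
    rw [← h3, h2, _root_.norm_mul]
    have : ‖X ((u⁻¹ : (ZMod n)ˣ) : ZMod n)‖ = 1 := X.unit_norm_eq_one _
    simp
  have hφ : (0:ℝ) < Fintype.card (ZMod n)ˣ := by exact_mod_cast Fintype.card_pos
  have hpars := ZMod.sum_normSq_dft (fun s => X s)
  have hX : ∑ s, ‖X s‖ ^ 2 = Fintype.card (ZMod n)ˣ := by
    have h1 : ∀ s, ‖X s‖ ^ 2 = if IsUnit s then (1:ℝ) else 0 := by
      intro s
      split_ifs with h
      · have := X.unit_norm_eq_one h.unit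
        rw [IsUnit.unit_spec] at this
        rw [this]; norm_num
      · rw [X.map_nonunit h]; simp
    simp only [h1]
    rw [Finset.sum_boole]
    norm_cast
    rw [← Fintype.card_subtype]
    exact Fintype.card_congr ⟨fun s => s.2.unit, fun u => ⟨u, u.isUnit⟩, fun s => by simp,
      fun u => by ext; simp⟩
  have hfib : ∀ j : ZMod n, (Finset.univ.filter fun u : (ZMod n)ˣ => u * k = j).card ≤ a := by
    intro j
    by_cases hne : (Finset.univ.filter fun u : (ZMod n)ˣ => u * k = j).Nonempty
    · obtain ⟨u₀, hu₀⟩ := hne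
      simp only [Finset.mem_filter, Finset.mem_univ, true_and] at hu₀
      refine le_trans ?_ ((ZMod.card_mul_natCast_eq_zero_le (n := n) (a := a)).resolve_right ha)
      refine Finset.card_le_card_of_injOn (fun u => (u : ZMod n) - u₀) ?_ ?_
      · intro u hu
        simp only [Finset.coe_filter, Finset.mem_univ, true_and, Set.mem_ofPred_eq] at hu ⊢
        have : ((u : ZMod n) - u₀) * k = 0 := by rw [sub_mul, hu, hu₀, sub_self]
        rcases hk with rfl | rfl
        · exact this
        · simpa using this
      · intro u _ v _ huv
        simp only [sub_left_inj] at huv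
        exact Units.ext huv
    · rw [Finset.not_nonempty_iff_eq_empty.1 hne]; simp
  have h1 : ∑ u : (ZMod n)ˣ, ‖𝓕 (fun s => X s) (u * k)‖ ^ 2 ≤
      ∑ j, (a : ℝ) * ‖𝓕 (fun s => X s) j‖ ^ 2 := by
    rw [← Finset.sum_fiberwise_of_maps_to (s := Finset.univ) (t := Finset.univ)
      (g := fun u : (ZMod n)ˣ => (u : ZMod n) * k) (fun _ _ => Finset.mem_univ _)]
    refine Finset.sum_le_sum fun j _ => ?_
    rw [Finset.sum_congr rfl (g := fun _ => ‖𝓕 (fun s => X s) j‖ ^ 2)]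
    · rw [Finset.sum_const, nsmul_eq_mul]
      gcongr
      exact_mod_cast hfib j
    · intro u hu
      simp only [Finset.mem_filter, Finset.mem_univ, true_and] at hu
      rw [hu]
  rw [← Finset.mul_sum, hpars, hX] at h1
  simp only [hu] at h1
  rw [Finset.sum_const, Finset.card_univ, nsmul_eq_mul] at h1
  nlinarith

theorem tsum_zpow_mul_one_sub_sq {f : ℤ → ℝ} (hf : f.support.Finite) {z : ℂ} (hz : ‖z‖ = 1) :
    ‖∑' k, (f k : ℂ) * z ^ k‖ * ‖1 - z‖ ^ 2 ≤ ∑' k, |f (k + 2) - 2 * f (k + 1) + f k| := by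
  have hz0 : z ≠ 0 := by rintro rfl; simp at hz
  have hsum : ∀ j : ℤ, Summable fun k => (f (k + j) : ℂ) * z ^ (k + j) := by
    intro j
    refine ((Equiv.addRight j).summable_iff (f := fun k => (f k : ℂ) * z ^ k)).2 ?_
    refine summable_of_hasFiniteSupport (hf.subset ?_)
    intro k hk
    simp only [Function.mem_support] at hk ⊢
    intro h; apply hk; simp [h]
  have hts : ∀ j : ℤ, ∑' k, (f (k + j) : ℂ) * z ^ (k + j) = ∑' k, (f k : ℂ) * z ^ k :=
    fun j => (Equiv.addRight j).tsum_eq (fun k => (f k : ℂ) * z ^ k)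
  have hfs : ∀ j : ℤ, Summable fun k => f (k + j) := fun j =>
    ((Equiv.addRight j).summable_iff (f := f)).2 (summable_of_hasFiniteSupport hf)
  have hid : (∑' k, (f k : ℂ) * z ^ k) * (1 - z) ^ 2 =
      ∑' k, ((f (k + 2) - 2 * f (k + 1) + f k : ℝ) : ℂ) * z ^ (k + 2) := by
    have h0 := hts 0
    calc _ = (∑' k, (f (k + 2) : ℂ) * z ^ (k + 2)) - 2 * z * (∑' k, (f (k + 1) : ℂ) * z ^ (k + 1))
          + z ^ 2 * (∑' k, (f (k + 0) : ℂ) * z ^ (k + 0)) := by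
          rw [hts, hts, hts]; ring
      _ = _ := by
          rw [← tsum_mul_left, ← tsum_mul_left, ← (hsum 2).tsum_sub ((hsum 1).mul_left _),
            ← ((hsum 2).sub ((hsum 1).mul_left _)).tsum_add ((hsum 0).mul_left _)]
          refine tsum_congr fun k => ?_
          simp only [add_zero]
          have e1 : z ^ (k + 2) = z ^ k * z ^ 2 := by rw [zpow_add₀ hz0]; norm_cast
          have e2 : z ^ (k + 1) = z ^ k * z := by rw [zpow_add₀ hz0]; norm_num
          rw [e1, e2]; push_cast; ring
  have habs : Summable fun k => |f (k + 2) - 2 * f (k + 1) + f k| := by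
    have := ((hfs 2).sub ((hfs 1).mul_left 2)).add (hfs 0)
    simpa using this.abs
  rw [← _root_.norm_pow, ← _root_.norm_mul, hid]
  refine tsum_of_norm_bounded habs.hasSum fun k => ?_
  rw [_root_.norm_mul, norm_zpow, hz, one_zpow, mul_one, Complex.norm_real, Real.norm_eq_abs]

theorem four_mul_div_le_norm_one_sub_stdAddChar {n : ℕ} [NeZero n] (j : ZMod n) :
    4 * (j.valMinAbs.natAbs : ℝ) / n ≤ ‖1 - ZMod.stdAddChar j‖ := by
  have hn : (0:ℝ) < n := by exact_mod_cast Nat.pos_of_ne_zero (NeZero.ne n)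
  have hle : (j.valMinAbs.natAbs : ℝ) ≤ n / 2 := by
    have := ZMod.natAbs_valMinAbs_le j
    have h2 : ((n / 2 : ℕ) : ℝ) ≤ n / 2 := Nat.cast_div_le
    exact le_trans (by exact_mod_cast this) h2
  have h1 : ZMod.stdAddChar j = Complex.exp (2 * Real.pi * Complex.I * j.valMinAbs / n) := by
    conv_lhs => rw [← ZMod.coe_valMinAbs j]
    exact ZMod.stdAddChar_coe _
  have h2 : ‖1 - ZMod.stdAddChar j‖ = 2 * |Real.sin (Real.pi * j.valMinAbs / n)| := by
    rw [h1, norm_sub_rev]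
    have : (2 * Real.pi * Complex.I * j.valMinAbs / n : ℂ) =
        Complex.I * ((2 * (Real.pi * j.valMinAbs / n) : ℝ) : ℂ) := by push_cast; ring
    rw [this, Complex.norm_exp_I_mul_ofReal_sub_one]
    rw [_root_.norm_mul, Real.norm_eq_abs, Real.norm_eq_abs]
    norm_num
  have h3 : |Real.sin (Real.pi * j.valMinAbs / n)| = |Real.sin (Real.pi * j.valMinAbs.natAbs / n)| := by
    rw [Nat.cast_natAbs, Int.cast_abs]
    rcases abs_choice (j.valMinAbs : ℝ) with h | h <;> rw [h]
    rw [mul_neg, neg_div, Real.sin_neg, abs_neg]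
  rw [h2, h3]
  have h4 := Real.mul_le_sin (x := Real.pi * j.valMinAbs.natAbs / n) (by positivity) (by
    rw [div_le_iff₀ hn]
    nlinarith [Real.pi_pos])
  have h5 : 2 / Real.pi * (Real.pi * j.valMinAbs.natAbs / n) = 2 * j.valMinAbs.natAbs / n := by
    field_simp
  rw [h5] at h4
  have := le_abs_self (Real.sin (Real.pi * j.valMinAbs.natAbs / n))
  calc 4 * (j.valMinAbs.natAbs : ℝ) / n = 2 * (2 * j.valMinAbs.natAbs / n) := by ring
    _ ≤ _ := by linarith

open scoped ZMod ComplexConjugate in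
/-- A smoothed Pólya–Vinogradov inequality. -/
theorem DirichletCharacter.exists_norm_tsum_le : ∃ C : ℝ, 0 < C ∧
    ∀ (n : ℕ) [NeZero n] (X : DirichletCharacter ℂ n), X ≠ 1 → ∀ (b : ZMod n) (f : ℤ → ℝ),
      f.support.Finite →
      ‖∑' k : ℤ, X (k + b) * (f k : ℂ)‖ ≤
        C * (n : ℝ) ^ (3 / 2 : ℝ) * ∑' k, |f (k + 2) - 2 * f (k + 1) + f k| := by
  have hs : Summable fun k : ℤ => |(k : ℝ)| ^ (-(3 / 2) : ℝ) :=
    Real.summable_abs_int_rpow (by norm_num)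
  refine ⟨(∑' k : ℤ, |(k : ℝ)| ^ (-(3 / 2) : ℝ)) + 1, ?_, ?_⟩
  · have : 0 ≤ ∑' k : ℤ, |(k : ℝ)| ^ (-(3 / 2) : ℝ) := tsum_nonneg fun k => by positivity
    linarith
  intro n _ X hX b f hf
  set T := ∑' k, |f (k + 2) - 2 * f (k + 1) + f k| with hT
  have hT0 : 0 ≤ T := tsum_nonneg fun k => abs_nonneg _
  have hn : (0:ℝ) < n := by exact_mod_cast Nat.pos_of_ne_zero (NeZero.ne n)
  set G := 𝓕 (fun s => X s) with hG
  have hXinv : ∀ s : ZMod n, X s = (n : ℂ)⁻¹ * ∑ j, ZMod.stdAddChar (j * s) * G j := by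
    intro s
    have h := congrFun (ZMod.dft.symm_apply_apply (fun s => X s)) s
    rw [ZMod.invDFT_apply] at h
    simp only [smul_eq_mul] at h
    exact h.symm
  have hswap : ∑' k : ℤ, X (k + b) * (f k : ℂ) = (n : ℂ)⁻¹ * ∑ j, G j * ZMod.stdAddChar (j * b) *
      ∑' k : ℤ, (f k : ℂ) * (ZMod.stdAddChar j : ℂ) ^ k := by
    have hsm : ∀ z : ℂ, Summable fun k : ℤ => (f k : ℂ) * z ^ k := fun z =>
      summable_of_hasFiniteSupport (hf.subset fun k hk => by
        simp only [Function.mem_support] at hk ⊢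
        intro h; apply hk; simp [h])
    simp only [← tsum_mul_left]
    rw [← Summable.tsum_finsetSum fun j _ => (hsm _).mul_left _, ← tsum_mul_left]
    refine tsum_congr fun k => ?_
    rw [hXinv, Finset.mul_sum, Finset.mul_sum, Finset.sum_mul]
    refine Finset.sum_congr rfl fun j _ => ?_
    rw [mul_add, AddChar.map_add_eq_mul, ← AddChar.map_zsmul_eq_zpow, zsmul_eq_mul, mul_comm j]
    ring
  have hbound : ∀ j : ZMod n, ‖G j * ZMod.stdAddChar (j * b) *
      ∑' k : ℤ, (f k : ℂ) * (ZMod.stdAddChar j : ℂ) ^ k‖ ≤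
        (n : ℝ) ^ (5 / 2 : ℝ) * T * |(j.valMinAbs : ℝ)| ^ (-(3 / 2) : ℝ) := by
    intro j
    rcases eq_or_ne j 0 with rfl | hj
    · have : G 0 = 0 := by
        rw [hG, ZMod.dft_apply_zero]
        exact MulChar.sum_eq_zero_of_ne_one hX
      rw [this]; simp
    have ha : j.valMinAbs.natAbs ≠ 0 := by
      rwa [Int.natAbs_ne_zero, Ne, ZMod.valMinAbs_eq_zero]
    set a := j.valMinAbs.natAbs with hadef
    have hapos : (0:ℝ) < a := by exact_mod_cast Nat.pos_of_ne_zero ha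
    have hja : j = a ∨ j = -a := by
      have h1 := ZMod.coe_valMinAbs j
      rcases Int.natAbs_eq j.valMinAbs with h | h
      · left; rw [← h1, h, ← hadef]; push_cast; rfl
      · right; rw [← h1, h, ← hadef]; push_cast; rfl
    have hG1 := DirichletCharacter.norm_dft_sq_le X ha hja
    rw [← hG] at hG1
    have hG2 : ‖G j‖ ≤ (n : ℝ) ^ (1 / 2 : ℝ) * (a : ℝ) ^ (1 / 2 : ℝ) := by
      rw [← Real.mul_rpow hn.le hapos.le, ← Real.sqrt_eq_rpow]
      exact Real.le_sqrt_of_sq_le hG1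
    have hz : ‖(ZMod.stdAddChar j : ℂ)‖ = 1 := AddChar.norm_apply _ _
    have hF := tsum_zpow_mul_one_sub_sq hf hz
    rw [← hT] at hF
    have hlow := four_mul_div_le_norm_one_sub_stdAddChar j
    rw [← hadef] at hlow
    set FF := ‖∑' k : ℤ, (f k : ℂ) * (ZMod.stdAddChar j : ℂ) ^ k‖ with hFF
    have hF2 : FF ≤ T * (n : ℝ) ^ 2 * ((a : ℝ) ^ 2)⁻¹ := by
      have h1 : FF * ((a : ℝ) / n) ^ 2 ≤ T := by
        refine le_trans ?_ hF
        gcongr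
        refine le_trans ?_ hlow
        gcongr
        linarith
      rw [div_pow, mul_div_assoc', div_le_iff₀ (by positivity)] at h1
      rw [← div_eq_mul_inv, le_div_iff₀ (by positivity)]
      exact h1
    have habs : |(j.valMinAbs : ℝ)| = a := by rw [hadef, Nat.cast_natAbs, Int.cast_abs]
    rw [_root_.norm_mul, _root_.norm_mul, AddChar.norm_apply, mul_one, habs, ← hFF]
    calc ‖G j‖ * FF ≤ ((n : ℝ) ^ (1 / 2 : ℝ) * (a : ℝ) ^ (1 / 2 : ℝ)) *
          (T * (n : ℝ) ^ 2 * ((a : ℝ) ^ 2)⁻¹) := by gcongr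
      _ = ((n : ℝ) ^ (1 / 2 : ℝ) * (n : ℝ) ^ (2:ℝ)) * T *
          ((a : ℝ) ^ (1 / 2 : ℝ) * (a : ℝ) ^ (-2 : ℝ)) := by
          rw [Real.rpow_neg hapos.le, Real.rpow_two, Real.rpow_two]; ring
      _ = _ := by
          rw [← Real.rpow_add hn, ← Real.rpow_add hapos]; norm_num
  rw [hswap, _root_.norm_mul, norm_inv, Complex.norm_natCast]
  have hsum : ∑ j : ZMod n, |(j.valMinAbs : ℝ)| ^ (-(3 / 2) : ℝ) ≤
      (∑' k : ℤ, |(k : ℝ)| ^ (-(3 / 2) : ℝ)) + 1 := by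
    have hinj : Function.Injective (fun j : ZMod n => j.valMinAbs) := ZMod.injective_valMinAbs
    have h1 : ∑ j : ZMod n, |(j.valMinAbs : ℝ)| ^ (-(3 / 2) : ℝ) =
      ∑ k ∈ Finset.univ.image (fun j : ZMod n => j.valMinAbs), |(k : ℝ)| ^ (-(3 / 2) : ℝ) := by
      rw [Finset.sum_image (fun _ _ _ _ h => hinj h)]
    rw [h1]
    refine (hs.sum_le_tsum _ fun k _ => by positivity).trans (by linarith)
  calc (n : ℝ)⁻¹ * ‖_‖ ≤ (n : ℝ)⁻¹ * ∑ j : ZMod n,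
        (n : ℝ) ^ (5 / 2 : ℝ) * T * |(j.valMinAbs : ℝ)| ^ (-(3 / 2) : ℝ) := by
        gcongr
        exact norm_sum_le_of_le _ fun j _ => hbound j
    _ ≤ (n : ℝ)⁻¹ * ((n : ℝ) ^ (5 / 2 : ℝ) * T * ((∑' k : ℤ, |(k : ℝ)| ^ (-(3 / 2) : ℝ)) + 1)) := by
        rw [← Finset.mul_sum]; gcongr
    _ = _ := by
        have : (n : ℝ)⁻¹ * (n : ℝ) ^ (5 / 2 : ℝ) = (n : ℝ) ^ (3 / 2 : ℝ) := by
          rw [← Real.rpow_neg_one, ← Real.rpow_add hn]; norm_num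
        rw [← this]; ring

/-- Projection of the real line to `[1, 2]`. -/
def clamp (x : ℝ) : ℝ := max 1 (min x 2)

theorem one_le_clamp (x : ℝ) : 1 ≤ clamp x := le_max_left _ _

theorem clamp_le_two (x : ℝ) : clamp x ≤ 2 := max_le (by norm_num) (min_le_right _ _)

theorem clamp_of_mem {x : ℝ} (h1 : 1 ≤ x) (h2 : x ≤ 2) : clamp x = x := by
  rw [clamp, min_eq_left h2, max_eq_right h1]

theorem clamp_of_le {x : ℝ} (h : x ≤ 1) : clamp x = 1 := by
  rw [clamp, min_eq_left (by linarith), max_eq_left h]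

theorem clamp_of_ge {x : ℝ} (h : 2 ≤ x) : clamp x = 2 := by
  rw [clamp, min_eq_right h]; norm_num

theorem abs_clamp_sub_le (x y : ℝ) : |clamp x - clamp y| ≤ |x - y| := by
  have h1 : |clamp x - clamp y| ≤ |min x 2 - min y 2| := by
    simp only [clamp, max_comm (1 : ℝ)]
    exact abs_max_sub_max_le_abs _ _ _
  have h2 := abs_min_sub_min_le_max x 2 y 2
  rw [sub_self, abs_zero, max_eq_left (abs_nonneg _)] at h2
  exact h1.trans h2

theorem continuous_clamp : Continuous clamp := by unfold clamp; fun_prop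

theorem hasDerivAt_comp_clamp {φ φ' : ℝ → ℝ} (h : ∀ x, 1 ≤ x → x ≤ 2 → HasDerivAt φ (φ' x) x)
    (h1 : φ' 1 = 0) (h2 : φ' 2 = 0) (x : ℝ) :
    HasDerivAt (fun x => φ (clamp x)) (φ' (clamp x)) x := by
  have hd := h (clamp x) (one_le_clamp x) (clamp_le_two x)
  by_cases hx : 1 < x ∧ x < 2
  · rw [clamp_of_mem hx.1.le hx.2.le] at hd ⊢
    refine hd.congr_of_eventuallyEq ?_
    filter_upwards [Ioo_mem_nhds hx.1 hx.2] with y hy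
    rw [clamp_of_mem hy.1.le hy.2.le]
  · have h0 : φ' (clamp x) = 0 := by
      rcases not_and_or.1 hx with hx | hx
      · rw [clamp_of_le (not_lt.1 hx), h1]
      · rw [clamp_of_ge (not_lt.1 hx), h2]
    rw [h0] at hd ⊢
    rw [hasDerivAt_iff_isLittleO] at hd ⊢
    simp only [smul_zero, sub_zero] at hd ⊢
    refine (hd.comp_tendsto continuous_clamp.continuousAt).trans_le fun y => ?_
    simpa using abs_clamp_sub_le y x

/-- The smooth weight `((z - 1)(2 - z))² e^{-l/z}` on `[1, 2]`, extended by zero. -/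
def bump (l x : ℝ) : ℝ :=
  ((clamp x - 1) * (2 - clamp x)) ^ 2 * Real.exp (-l / clamp x)

theorem bump_nonneg (l x : ℝ) : 0 ≤ bump l x := by unfold bump; positivity

theorem bump_of_le {l x : ℝ} (h : x ≤ 1) : bump l x = 0 := by simp [bump, clamp_of_le h]

theorem bump_of_ge {l x : ℝ} (h : 2 ≤ x) : bump l x = 0 := by simp [bump, clamp_of_ge h]

/-- The derivative of `bump l`. -/
def bumpDeriv (l x : ℝ) : ℝ :=
  Real.exp (-l / x) * (2 * ((x - 1) * (2 - x)) * (3 - 2 * x) + ((x - 1) * (2 - x)) ^ 2 * (l / x ^ 2))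

theorem hasDerivAt_bump (l x : ℝ) : HasDerivAt (bump l) (bumpDeriv l (clamp x)) x := by
  refine hasDerivAt_comp_clamp (φ := fun z => ((z - 1) * (2 - z)) ^ 2 * Real.exp (-l / z))
    (φ' := bumpDeriv l) (fun z hz1 hz2 => ?_) (by simp [bumpDeriv]) (by simp [bumpDeriv]) x
  have hz : z ≠ 0 := by positivity
  have e1 : HasDerivAt (fun z : ℝ => (z - 1) * (2 - z)) (1 * (2 - z) + (z - 1) * (-1)) z :=
    ((hasDerivAt_id z).sub_const 1).mul ((hasDerivAt_id z).const_sub 2)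
  have e2 : HasDerivAt (fun z : ℝ => -l / z) ((0 * z - -l * 1) / z ^ 2) z :=
    (hasDerivAt_const z (-l)).div (hasDerivAt_id z) hz
  refine ((e1.pow 2).mul e2.exp).congr_deriv ?_
  simp only [bumpDeriv, Pi.pow_apply]
  field_simp
  ring

theorem abs_bumpDeriv_sub_le {l : ℝ} (hl : 0 ≤ l) (x y : ℝ) :
    |bumpDeriv l (clamp x) - bumpDeriv l (clamp y)| ≤
      4 * (1 + l) ^ 2 * Real.exp (-l / 2) * |x - y| := by
  have hder : ∀ z ∈ Set.Icc (1:ℝ) 2, HasDerivWithinAt (bumpDeriv l)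
      (Real.exp (-l / z) * ((2 * (3 - 2 * z) ^ 2 - 4 * ((z - 1) * (2 - z))) +
        (2 * (2 * ((z - 1) * (2 - z)) * (3 - 2 * z)) * (l / z ^ 2) +
        ((z - 1) * (2 - z)) ^ 2 * (l ^ 2 / z ^ 4 - 2 * l / z ^ 3)))) (Set.Icc 1 2) z := by
    intro z hz
    have hz0 : z ≠ 0 := by have := hz.1; positivity
    have e1 : HasDerivAt (fun z : ℝ => (z - 1) * (2 - z)) (1 * (2 - z) + (z - 1) * (-1)) z :=
      ((hasDerivAt_id z).sub_const 1).mul ((hasDerivAt_id z).const_sub 2)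
    have e2 : HasDerivAt (fun z : ℝ => -l / z) ((0 * z - -l * 1) / z ^ 2) z :=
      (hasDerivAt_const z (-l)).div (hasDerivAt_id z) hz0
    have e3 : HasDerivAt (fun z : ℝ => 3 - 2 * z) (-(2 * 1)) z :=
      ((hasDerivAt_id z).const_mul 2).const_sub 3
    have e4 : HasDerivAt (fun z : ℝ => l / z ^ 2) ((0 * z ^ 2 - l * (2 * z)) / (z ^ 2) ^ 2) z := by
      have := (hasDerivAt_const z l).div (hasDerivAt_pow 2 z) (pow_ne_zero 2 hz0)
      exact this.congr_deriv (by simp)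
    refine HasDerivAt.hasDerivWithinAt ?_
    refine (e2.exp.mul (((e1.const_mul 2).mul e3).add ((e1.pow 2).mul e4))).congr_deriv ?_
    field_simp
    simp only [Pi.add_apply, Pi.mul_apply, Pi.pow_apply]
    field_simp
    ring
  have hb : ∀ z ∈ Set.Icc (1:ℝ) 2,
      ‖Real.exp (-l / z) * ((2 * (3 - 2 * z) ^ 2 - 4 * ((z - 1) * (2 - z))) +
        (2 * (2 * ((z - 1) * (2 - z)) * (3 - 2 * z)) * (l / z ^ 2) +
        ((z - 1) * (2 - z)) ^ 2 * (l ^ 2 / z ^ 4 - 2 * l / z ^ 3)))‖ ≤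
        4 * (1 + l) ^ 2 * Real.exp (-l / 2) := by
    rintro z ⟨h1, h2⟩
    have hz : 0 < z := by linarith
    rw [_root_.norm_mul, Real.norm_eq_abs, Real.abs_exp, mul_comm]
    have hexp : Real.exp (-l / z) ≤ Real.exp (-l / 2) := by
      apply Real.exp_le_exp.2
      rw [neg_div, neg_div]
      apply neg_le_neg
      gcongr
    set r := (z - 1) * (2 - z) with hr
    have hr0 : 0 ≤ r := mul_nonneg (by linarith) (by linarith)
    have hr1 : r ≤ 1 / 4 := by nlinarith [sq_nonneg (2 * z - 3)]
    have hs : |3 - 2 * z| ≤ 1 := abs_le.2 ⟨by linarith, by linarith⟩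
    have hs2 : (3 - 2 * z) ^ 2 ≤ 1 := by rw [← sq_abs]; exact pow_le_one₀ (abs_nonneg _) hs
    have hz2 : l / z ^ 2 ≤ l := div_le_self hl (one_le_pow₀ h1)
    have hz2' : 0 ≤ l / z ^ 2 := by positivity
    have hz3 : 2 * l / z ^ 3 ≤ 2 * l := div_le_self (by positivity) (one_le_pow₀ h1)
    have hz3' : 0 ≤ 2 * l / z ^ 3 := by positivity
    have hz4 : l ^ 2 / z ^ 4 ≤ l ^ 2 := div_le_self (by positivity) (one_le_pow₀ h1)
    have hz4' : 0 ≤ l ^ 2 / z ^ 4 := by positivity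
    have t1 : |2 * (3 - 2 * z) ^ 2 - 4 * r| ≤ 3 :=
      abs_le.2 ⟨by nlinarith [sq_nonneg (3 - 2 * z)], by linarith⟩
    have t2 : |2 * (2 * r * (3 - 2 * z)) * (l / z ^ 2)| ≤ l := by
      rw [abs_mul, abs_mul, abs_mul, abs_mul, abs_of_nonneg hr0, abs_of_nonneg hz2']
      norm_num
      have : 2 * (2 * r * |3 - 2 * z|) ≤ 1 := by nlinarith [abs_nonneg (3 - 2 * z)]
      calc _ ≤ 1 * l := by gcongr
        _ = l := one_mul l
    have t3 : |r ^ 2 * (l ^ 2 / z ^ 4 - 2 * l / z ^ 3)| ≤ l ^ 2 + 2 * l := by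
      rw [abs_mul, abs_of_nonneg (sq_nonneg r)]
      have : r ^ 2 ≤ 1 := by nlinarith
      have h3 : |l ^ 2 / z ^ 4 - 2 * l / z ^ 3| ≤ l ^ 2 + 2 * l := abs_le.2 ⟨by nlinarith, by linarith⟩
      calc _ ≤ 1 * (l ^ 2 + 2 * l) := by gcongr
        _ = _ := one_mul _
    have h5 : ‖2 * (3 - 2 * z) ^ 2 - 4 * r + (2 * (2 * r * (3 - 2 * z)) * (l / z ^ 2) +
        r ^ 2 * (l ^ 2 / z ^ 4 - 2 * l / z ^ 3))‖ ≤ 4 * (1 + l) ^ 2 := by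
      refine (norm_add_le _ _).trans ((add_le_add le_rfl (norm_add_le _ _)).trans ?_)
      simp only [Real.norm_eq_abs]
      nlinarith
    gcongr
  have h := (convex_Icc (1:ℝ) 2).norm_image_sub_le_of_norm_hasDerivWithin_le hder hb
    (x := clamp y) (y := clamp x) ⟨one_le_clamp y, clamp_le_two y⟩ ⟨one_le_clamp x, clamp_le_two x⟩
  simp only [Real.norm_eq_abs] at h
  exact h.trans (mul_le_mul_of_nonneg_left (abs_clamp_sub_le x y) (by positivity))

theorem abs_bump_second_diff_le {l e : ℝ} (hl : 0 ≤ l) (he : 0 ≤ e) (z : ℝ) :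
    |bump l (z + 2 * e) - 2 * bump l (z + e) + bump l z| ≤
      4 * (1 + l) ^ 2 * Real.exp (-l / 2) * e ^ 2 := by
  have hd : ∀ x ∈ Set.univ, HasDerivWithinAt (fun x => bump l (x + e) - bump l x)
      (bumpDeriv l (clamp (x + e)) - bumpDeriv l (clamp x)) Set.univ x := fun x _ =>
    (((hasDerivAt_bump l (x + e)).comp_add_const x e).sub (hasDerivAt_bump l x)).hasDerivWithinAt
  have hb : ∀ x ∈ Set.univ, ‖bumpDeriv l (clamp (x + e)) - bumpDeriv l (clamp x)‖ ≤
      4 * (1 + l) ^ 2 * Real.exp (-l / 2) * e := fun x _ => by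
    have := abs_bumpDeriv_sub_le hl (x + e) x
    rwa [add_sub_cancel_left, abs_of_nonneg he] at this
  have h := convex_univ.norm_image_sub_le_of_norm_hasDerivWithin_le hd hb
    (Set.mem_univ z) (Set.mem_univ (z + e))
  simp only [Real.norm_eq_abs, add_sub_cancel_left, abs_of_nonneg he] at h
  rw [show bump l (z + 2 * e) - 2 * bump l (z + e) + bump l z =
    bump l (z + e + e) - bump l (z + e) - (bump l (z + e) - bump l z) by
      rw [show z + e + e = z + 2 * e by ring]; ring]
  refine h.trans_eq ?_
  ring

theorem bump_support_subset (l A : ℝ) {e : ℝ} (he : 0 < e) :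
    (Function.support fun k : ℤ => bump l (A + e * k)) ⊆
      (Finset.Icc ⌈(1 - A) / e⌉ ⌊(2 - A) / e⌋ : Finset ℤ) := by
  intro k hk
  simp only [Function.mem_support] at hk
  have h1 : 1 ≤ A + e * k := by
    by_contra! h
    exact hk (bump_of_le h.le)
  have h2 : A + e * k ≤ 2 := by
    by_contra! h
    exact hk (bump_of_ge h.le)
  simp only [Finset.coe_Icc, Set.mem_Icc]
  refine ⟨Int.ceil_le.2 ?_, Int.le_floor.2 ?_⟩
  · rw [div_le_iff₀ he]; linarith
  · rw [le_div_iff₀ he]; linarith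

theorem tsum_abs_bump_second_diff_le {l e C : ℝ} (hl : 0 ≤ l) (he : 0 < e) (hC : 0 ≤ C)
    (hel : e ≤ C * l) (A : ℝ) :
    ∑' k : ℤ, |bump l (A + e * ((k + 2 : ℤ) : ℝ)) - 2 * bump l (A + e * ((k + 1 : ℤ) : ℝ)) +
      bump l (A + e * k)| ≤ 6912 * (1 + 3 * C) * e * Real.exp (-l / 4) := by
  have hterm : ∀ k : ℤ, |bump l (A + e * ((k + 2 : ℤ) : ℝ)) - 2 * bump l (A + e * ((k + 1 : ℤ) : ℝ)) +
      bump l (A + e * k)| ≤ 4 * (1 + l) ^ 2 * Real.exp (-l / 2) * e ^ 2 := by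
    intro k
    have := abs_bump_second_diff_le hl he.le (A + e * k)
    push_cast
    rw [show A + e * ((k : ℝ) + 2) = A + e * k + 2 * e by ring,
      show A + e * ((k : ℝ) + 1) = A + e * k + e by ring]
    exact this
  have hzero : ∀ k ∉ Finset.Icc ⌈(1 - A) / e - 2⌉ ⌊(2 - A) / e⌋,
      |bump l (A + e * ((k + 2 : ℤ) : ℝ)) - 2 * bump l (A + e * ((k + 1 : ℤ) : ℝ)) +
      bump l (A + e * k)| = 0 := by
    intro k hk
    rw [Finset.mem_Icc, Int.ceil_le, Int.le_floor, not_and_or, not_le, not_le] at hk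
    push_cast
    rcases hk with h | h
    · rw [lt_sub_iff_add_lt, lt_div_iff₀ he] at h
      rw [bump_of_le (by nlinarith), bump_of_le (by nlinarith), bump_of_le (by nlinarith)]
      simp
    · rw [div_lt_iff₀ he] at h
      rw [bump_of_ge (by nlinarith), bump_of_ge (by nlinarith), bump_of_ge (by nlinarith)]
      simp
  rw [tsum_eq_sum hzero]
  have hcard : ((Finset.Icc ⌈(1 - A) / e - 2⌉ ⌊(2 - A) / e⌋).card : ℝ) ≤ 1 / e + 3 := by
    rw [Int.card_Icc]
    have h1 := Int.floor_le ((2 - A) / e)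
    have h2 := Int.le_ceil ((1 - A) / e - 2)
    have h3 : (2 - A) / e - ((1 - A) / e - 2) = 1 / e + 2 := by field_simp; ring
    rcases le_total 0 (⌊(2 - A) / e⌋ + 1 - ⌈(1 - A) / e - 2⌉) with h | h
    · have : (((⌊(2 - A) / e⌋ + 1 - ⌈(1 - A) / e - 2⌉).toNat : ℤ) : ℝ) =
          ((⌊(2 - A) / e⌋ + 1 - ⌈(1 - A) / e - 2⌉ : ℤ) : ℝ) := by rw [Int.toNat_of_nonneg h]
      rw [Int.cast_natCast] at this
      rw [this]; push_cast; linarith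
    · rw [Int.toNat_of_nonpos h]
      have : 0 < 1 / e := by positivity
      push_cast; linarith
  have hexp : (1 + l) ^ 3 ≤ 1728 * Real.exp (l / 4) := by
    have h1 : 1 + l ≤ 12 * Real.exp (l / 12) := by
      have := Real.add_one_le_exp (l / 12)
      linarith
    calc (1 + l) ^ 3 ≤ (12 * Real.exp (l / 12)) ^ 3 := by gcongr
      _ = 1728 * Real.exp (l / 4) := by
        rw [mul_pow, ← Real.exp_nat_mul]; norm_num; ring_nf
  calc _ ≤ ∑ k ∈ Finset.Icc ⌈(1 - A) / e - 2⌉ ⌊(2 - A) / e⌋,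
        4 * (1 + l) ^ 2 * Real.exp (-l / 2) * e ^ 2 := Finset.sum_le_sum fun k _ => hterm k
    _ ≤ (1 / e + 3) * (4 * (1 + l) ^ 2 * Real.exp (-l / 2) * e ^ 2) := by
        rw [Finset.sum_const, nsmul_eq_mul]; gcongr
    _ = 4 * e * Real.exp (-l / 2) * ((1 + l) ^ 2 * (1 + 3 * e)) := by field_simp
    _ ≤ 4 * e * Real.exp (-l / 2) * ((1 + l) ^ 2 * ((1 + 3 * C) * (1 + l))) := by
        gcongr; nlinarith
    _ = 4 * e * Real.exp (-l / 2) * (1 + 3 * C) * (1 + l) ^ 3 := by ring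
    _ ≤ 4 * e * Real.exp (-l / 2) * (1 + 3 * C) * (1728 * Real.exp (l / 4)) := by gcongr
    _ = 6912 * (1 + 3 * C) * e * (Real.exp (-l / 2) * Real.exp (l / 4)) := by ring
    _ = _ := by rw [← Real.exp_add]; ring_nf

/-- The arithmetic function with prescribed values on prime powers. -/
def primePowerFun (φ : ℕ → ℕ → ℂ) : ArithmeticFunction ℂ :=
  ⟨fun n => if n = 0 then 0 else ∏ p ∈ n.primeFactors, φ p (n.factorization p), by simp⟩

theorem primePowerFun_apply (φ : ℕ → ℕ → ℂ) {n : ℕ} (hn : n ≠ 0) :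
    primePowerFun φ n = ∏ p ∈ n.primeFactors, φ p (n.factorization p) := by
  simp [primePowerFun, hn]

theorem primePowerFun_isMultiplicative (φ : ℕ → ℕ → ℂ) : (primePowerFun φ).IsMultiplicative := by
  refine ArithmeticFunction.IsMultiplicative.iff_ne_zero.2 ⟨by simp [primePowerFun], ?_⟩
  intro m n hm hn hmn
  rw [primePowerFun_apply _ hm, primePowerFun_apply _ hn, primePowerFun_apply _ (mul_ne_zero hm hn),
    hmn.primeFactors_mul, Finset.prod_union hmn.disjoint_primeFactors]
  congr 1 <;> refine Finset.prod_congr rfl fun p hp => ?_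
  · rw [Nat.factorization_eq_of_coprime_left hmn (by simpa using hp)]
  · rw [Nat.factorization_eq_of_coprime_right hmn (by simpa using hp)]

theorem primePowerFun_prime_pow (φ : ℕ → ℕ → ℂ) {p : ℕ} (hp : p.Prime) (k : ℕ) :
    primePowerFun φ (p ^ k) = if k = 0 then 1 else φ p k := by
  rw [primePowerFun_apply _ (pow_ne_zero _ hp.ne_zero)]
  split_ifs with h
  · simp [h]
  · rw [Nat.primeFactors_prime_pow h hp, Finset.prod_singleton, hp.factorization_pow]
    simp

namespace Eis

lemma kap_zero (p : ℕ) : kap p 0 = 1 := by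
  rw [kap, pow_zero, w_one_left]

lemma loc_zero (z : ℂ) (c p : ℕ) : loc z c p 0 = 1 := by
  simp [loc, kap_zero]

lemma loc_succ_sub_eq_zero {z : ℂ} {c p k : ℕ} (hk : c.factorization p < k) :
    loc z c p (k + 1) - z * loc z c p k = 0 := by
  rw [loc, loc, if_pos hk, if_pos (by omega), pow_succ]; ring

lemma norm_kap_le' {p : ℕ} (hp : p.Prime) (k : ℕ) : ‖kap p k‖ ≤ 2 * p ^ k := by
  rcases eq_or_ne k 0 with rfl | hk
  · rw [kap_zero]; norm_num
  · exact norm_kap_le hp hk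

lemma norm_loc_succ_sub_le {z : ℂ} (hz : ‖z‖ ≤ 1) {c p : ℕ} (hp : p.Prime) (k : ℕ) :
    ‖loc z c p (k + 1) - z * loc z c p k‖ ≤ 3 * (p : ℝ) ^ min (k + 1) (c.factorization p) := by
  have hp1 : (1:ℝ) ≤ p := by exact_mod_cast hp.one_le
  have hp2 : (2:ℝ) ≤ p := by exact_mod_cast hp.two_le
  rcases lt_trichotomy k (c.factorization p) with h | h | h
  · rw [min_eq_left (by omega), loc, loc, if_neg (by omega), if_neg (by omega)]
    have h1 := norm_kap_le' hp (k + 1)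
    have h2 := norm_kap_le' hp k
    have h3 : ‖z * kap p k‖ ≤ 1 * (2 * p ^ k) := by
      rw [_root_.norm_mul]; gcongr
    refine (norm_sub_le _ _).trans ((add_le_add h1 h3).trans ?_)
    rw [pow_succ]
    nlinarith [pow_pos (zero_lt_two.trans_le hp2) k]
  · rw [min_eq_right (by omega), loc, loc, if_pos (by omega), if_neg (by omega), h]
    have h2 := norm_kap_le' hp (c.factorization p)
    have h3 : ‖z * kap p (c.factorization p)‖ ≤ 1 * (2 * p ^ c.factorization p) := by
      rw [_root_.norm_mul]; gcongr
    have h4 : ‖(p : ℂ) ^ c.factorization p * z ^ (c.factorization p + 1)‖ ≤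
        p ^ c.factorization p * 1 := by
      rw [_root_.norm_mul, _root_.norm_pow, _root_.norm_pow, Complex.norm_natCast]
      gcongr
      exact pow_le_one₀ (_root_.norm_nonneg _) hz
    refine (norm_sub_le _ _).trans ((add_le_add h4 h3).trans ?_)
    linarith
  · rw [loc_succ_sub_eq_zero h, _root_.norm_zero]; positivity

/-- The Dirichlet quotient of `m ↦ w m (c * y)` by the character `m ↦ X m`. -/
def quotFun {n : ℕ} (X : DirichletCharacter ℂ n) (c : ℕ) : ArithmeticFunction ℂ :=
  primePowerFun fun p k => loc (X p) c p k - X p * loc (X p) c p (k - 1)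

lemma quotFun_isMultiplicative {n : ℕ} (X : DirichletCharacter ℂ n) (c : ℕ) :
    (quotFun X c).IsMultiplicative := primePowerFun_isMultiplicative _

lemma quotFun_prime_pow_succ {n : ℕ} (X : DirichletCharacter ℂ n) (c : ℕ) {p : ℕ} (hp : p.Prime)
    (k : ℕ) : quotFun X c (p ^ (k + 1)) = loc (X p) c p (k + 1) - X p * loc (X p) c p k := by
  rw [quotFun, primePowerFun_prime_pow _ hp, if_neg (by omega), Nat.add_sub_cancel]

lemma primePowerFun_loc_eq {n : ℕ} (X : DirichletCharacter ℂ n) (c : ℕ) :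
    (primePowerFun fun p k => loc (X p) c p k) =
      toArithmeticFunction (X ·) * quotFun X c := by
  rw [ArithmeticFunction.IsMultiplicative.eq_iff_eq_on_prime_powers _
    (primePowerFun_isMultiplicative _) _
    ((DirichletCharacter.isMultiplicative_toArithmeticFunction X).mul
      (quotFun_isMultiplicative X c))]
  intro p k hp
  have hX : ∀ j, toArithmeticFunction (X ·) (p ^ j) = X p ^ j := by
    intro j
    rw [← DirichletCharacter.apply_eq_toArithmeticFunction_apply _ (pow_ne_zero _ hp.ne_zero)]
    push_cast; rw [map_pow]
  have h1 : primePowerFun (fun p k => loc (X p) c p k) (p ^ k) = loc (X p) c p k := by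
    rw [primePowerFun_prime_pow _ hp]
    split_ifs with h
    · rw [h, loc_zero]
    · rfl
  rw [h1, ArithmeticFunction.mul_apply,
    Nat.sum_divisorsAntidiagonal' (fun a b => toArithmeticFunction (X ·) a * quotFun X c b),
    Nat.divisors_prime_pow hp, Finset.sum_map]
  have h2 : ∀ i ∈ Finset.range (k + 1), toArithmeticFunction (X ·)
      (p ^ k / (⟨(p ^ ·), Nat.pow_right_injective hp.two_le⟩ : ℕ ↪ ℕ) i) *
      quotFun X c ((⟨(p ^ ·), Nat.pow_right_injective hp.two_le⟩ : ℕ ↪ ℕ) i) =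
      X p ^ (k - i) * quotFun X c (p ^ i) := by
    intro i hi
    simp only [Function.Embedding.coeFn_mk]
    rw [Nat.pow_div (by simpa [Nat.lt_succ_iff] using hi) hp.pos, hX]
  rw [Finset.sum_congr rfl h2]
  clear h1 h2
  induction k with
  | zero => simp [loc_zero, (quotFun_isMultiplicative X c).map_one]
  | succ k ih =>
    rw [Finset.sum_range_succ, Nat.sub_self, pow_zero, one_mul, quotFun_prime_pow_succ X c hp]
    have : ∀ i ∈ Finset.range (k + 1), X p ^ (k + 1 - i) * quotFun X c (p ^ i) =
        X p * (X p ^ (k - i) * quotFun X c (p ^ i)) := by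
      intro i hi
      rw [Nat.sub_add_comm (by simpa [Nat.lt_succ_iff] using hi), pow_succ]; ring
    rw [Finset.sum_congr rfl this, ← Finset.mul_sum, ← ih]
    ring

lemma dvd_sq_of_quotFun_ne_zero {n : ℕ} (X : DirichletCharacter ℂ n) {c D : ℕ} (hc : c ≠ 0)
    (h : quotFun X c D ≠ 0) : D ∣ c ^ 2 := by
  have hD : D ≠ 0 := by rintro rfl; simp at h
  rw [← Nat.factorization_le_iff_dvd hD (pow_ne_zero _ hc)]
  intro p
  by_cases hp : p ∈ D.primeFactors
  · rw [quotFun, primePowerFun_apply _ hD, Finset.prod_ne_zero_iff] at h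
    have h1 := h p hp
    have h0 : D.factorization p ≠ 0 := by
      rw [← Finsupp.mem_support_iff, Nat.support_factorization]; exact hp
    rw [Nat.factorization_pow, Finsupp.smul_apply, smul_eq_mul]
    obtain ⟨k, hk⟩ := Nat.exists_eq_succ_of_ne_zero h0
    rw [hk, Nat.succ_eq_add_one, Nat.add_sub_cancel] at h1
    rw [hk]
    have h2 : k ≤ c.factorization p := by
      by_contra! hlt
      exact h1 (loc_succ_sub_eq_zero hlt)
    rcases Nat.eq_zero_or_pos (c.factorization p) with h3 | h3
    · exfalso
      apply h1
      have hk0 : k = 0 := by omega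
      rw [hk0, loc_zero, loc, if_pos (by omega), h3]
      simp
    · omega
  · rw [← Nat.support_factorization, Finsupp.notMem_support_iff] at hp
    rw [hp]; exact Nat.zero_le _

lemma sum_range_pow_succ_le {x : ℝ} (hx : 2 ≤ x) (n : ℕ) :
    ∑ k ∈ Finset.range n, x ^ (k + 1) ≤ 2 * x ^ n := by
  induction n with
  | zero => simp
  | succ n ih =>
    rw [Finset.sum_range_succ]
    have : 2 * x ^ n ≤ x ^ (n + 1) := by rw [pow_succ, mul_comm]; gcongr
    linarith

lemma sum_norm_quotFun_prime_pow_le {n : ℕ} (X : DirichletCharacter ℂ n) {c : ℕ} {p : ℕ}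
    (hp : p.Prime) (hpc : c.factorization p ≠ 0) :
    ∑ D ∈ (p ^ (2 * c.factorization p)).divisors, ‖quotFun X c D‖ * D ≤
      7 * ((p : ℝ) ^ c.factorization p) ^ 3 := by
  have hp2 : (2:ℝ) ≤ p := by exact_mod_cast hp.two_le
  have hp1 : (1:ℝ) ≤ p := by linarith
  set v := c.factorization p with hv
  rw [Nat.divisors_prime_pow hp, Finset.sum_map, Finset.sum_range_succ']
  simp only [Function.Embedding.coeFn_mk, pow_zero, (quotFun_isMultiplicative X c).map_one]
  have h1 : ∀ k ∈ Finset.range (2 * v), ‖quotFun X c (p ^ (k + 1))‖ * ((p ^ (k + 1) : ℕ) : ℝ) ≤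
      if k ∈ Finset.range (v + 1) then 3 * (p : ℝ) ^ v * (p : ℝ) ^ (k + 1) else 0 := by
    intro k _
    rw [quotFun_prime_pow_succ X c hp]
    split_ifs with h
    · push_cast
      gcongr
      refine (norm_loc_succ_sub_le (X.norm_le_one _) hp k).trans ?_
      gcongr
      exact min_le_right _ _
    · rw [loc_succ_sub_eq_zero (by simp at h; omega)]; simp
  have h2 := Finset.sum_le_sum h1
  have h3 : ∑ k ∈ Finset.range (2 * v), (if k ∈ Finset.range (v + 1) then
      3 * (p : ℝ) ^ v * (p : ℝ) ^ (k + 1) else 0) ≤ 3 * (p : ℝ) ^ v * (2 * (p : ℝ) ^ (v + 1)) := by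
    rw [← Finset.sum_filter]
    refine (Finset.sum_le_sum_of_subset_of_nonneg (t := Finset.range (v + 1)) ?_ ?_).trans ?_
    · intro k hk; exact (Finset.mem_filter.1 hk).2
    · intros; positivity
    · rw [← Finset.mul_sum]
      gcongr
      exact sum_range_pow_succ_le hp2 _
  have h4 : (p : ℝ) ^ v * (p : ℝ) ^ (v + 1) ≤ ((p : ℝ) ^ v) ^ 3 := by
    rw [← pow_add, ← pow_mul]
    exact pow_le_pow_right₀ hp1 (by omega)
  have h5 : (1:ℝ) ≤ ((p : ℝ) ^ v) ^ 3 := one_le_pow₀ (one_le_pow₀ hp1)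
  norm_num at h2 h3 ⊢
  linarith

lemma seven_pow_card_primeFactors_le {c : ℕ} (hc : c ≠ 0) :
    (7:ℝ) ^ c.primeFactors.card ≤ 7 ^ 49 * (c : ℝ) ^ (1 / 2 : ℝ) := by
  have h1 : ∀ p ∈ c.primeFactors, (7:ℝ) ≤ (if p ∈ Finset.range 49 then 7 else 1) *
      (p : ℝ) ^ (1 / 2 : ℝ) := by
    intro p hp
    have hp := (Nat.mem_primeFactors.1 hp).1
    split_ifs with h
    · have : (1:ℝ) ≤ (p : ℝ) ^ (1 / 2 : ℝ) :=
        Real.one_le_rpow (by exact_mod_cast hp.one_le) (by norm_num)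
      linarith
    · rw [one_mul, ← Real.sqrt_eq_rpow]
      apply Real.le_sqrt_of_sq_le
      have : 49 ≤ p := by simpa using h
      norm_num
      exact_mod_cast this
  have h2 := Finset.prod_le_prod (fun _ _ => by norm_num) h1
  rw [Finset.prod_const, Finset.prod_mul_distrib] at h2
  refine h2.trans ?_
  have h3 : ∏ p ∈ c.primeFactors, (if p ∈ Finset.range 49 then (7:ℝ) else 1) ≤ 7 ^ 49 := by
    rw [← Finset.prod_filter, Finset.prod_const]
    refine pow_le_pow_right₀ (by norm_num) ?_
    refine (Finset.card_le_card (t := Finset.range 49) fun p hp => (Finset.mem_filter.1 hp).2).trans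
      (by simp)
  have h4 : ∏ p ∈ c.primeFactors, (p : ℝ) ^ (1 / 2 : ℝ) ≤ (c : ℝ) ^ (1 / 2 : ℝ) := by
    rw [Real.finsetProd_rpow _ _ fun _ _ => by positivity]
    apply Real.rpow_le_rpow (by positivity) _ (by norm_num)
    have := Nat.le_of_dvd (Nat.pos_of_ne_zero hc) (Nat.prod_primeFactors_dvd c)
    rw [← Nat.cast_prod]
    exact_mod_cast this
  gcongr

lemma sum_norm_quotFun_le {n : ℕ} (X : DirichletCharacter ℂ n) {c : ℕ} (hc : c ≠ 0) :
    ∑ D ∈ (c ^ 2).divisors, ‖quotFun X c D‖ * D ≤ 7 ^ 49 * (c : ℝ) ^ (7 / 2 : ℝ) := by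
  let g : ArithmeticFunction ℝ := ⟨fun D => ‖quotFun X c D‖ * D, by simp⟩
  have hg : g.IsMultiplicative := by
    refine ⟨?_, ?_⟩
    · simp [g, (quotFun_isMultiplicative X c).map_one]
    · intro a b hab
      simp only [g, ArithmeticFunction.coe_mk]
      rw [(quotFun_isMultiplicative X c).map_mul_of_coprime hab, _root_.norm_mul]
      push_cast; ring
  have hsum : ∀ N : ℕ, (g * (ArithmeticFunction.zeta : ArithmeticFunction ℝ)) N =
      ∑ D ∈ N.divisors, ‖quotFun X c D‖ * D := fun N => by
    rw [ArithmeticFunction.coe_mul_zeta_apply]; rfl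
  have hgz : (g * (ArithmeticFunction.zeta : ArithmeticFunction ℝ)).IsMultiplicative :=
    hg.mul ArithmeticFunction.isMultiplicative_zeta.natCast
  have hc2 : c ^ 2 ≠ 0 := pow_ne_zero _ hc
  rw [← hsum, ArithmeticFunction.IsMultiplicative.multiplicative_factorization _ hgz hc2,
    Finsupp.prod, Nat.support_factorization, Nat.primeFactors_pow _ two_ne_zero]
  have h1 : ∏ p ∈ c.primeFactors, (g * (ArithmeticFunction.zeta : ArithmeticFunction ℝ))
      (p ^ (c ^ 2).factorization p) ≤
      ∏ p ∈ c.primeFactors, (7 * ((p : ℝ) ^ c.factorization p) ^ 3) := by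
    refine Finset.prod_le_prod (fun p _ => ?_) fun p hp => ?_
    · rw [hsum]; positivity
    · rw [hsum, Nat.factorization_pow, Finsupp.smul_apply, smul_eq_mul]
      refine sum_norm_quotFun_prime_pow_le X (Nat.mem_primeFactors.1 hp).1 ?_
      rw [← Finsupp.mem_support_iff, Nat.support_factorization]; exact hp
  refine h1.trans ?_
  have h2 : ∏ p ∈ c.primeFactors, (p : ℝ) ^ c.factorization p = c := by
    have := Nat.prod_factorization_pow_eq_self hc
    rw [Finsupp.prod, Nat.support_factorization] at this
    exact_mod_cast this
  rw [Finset.prod_mul_distrib, Finset.prod_const, Finset.prod_pow, h2]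
  have hc0 : (0:ℝ) < c := by exact_mod_cast Nat.pos_of_ne_zero hc
  calc _ ≤ 7 ^ 49 * (c : ℝ) ^ (1 / 2 : ℝ) * (c : ℝ) ^ 3 := by
        gcongr; exact seven_pow_card_primeFactors_le hc
    _ = 7 ^ 49 * ((c : ℝ) ^ (1 / 2 : ℝ) * (c : ℝ) ^ (3 : ℝ)) := by
        rw [mul_assoc]; norm_cast
    _ = _ := by rw [← Real.rpow_add hc0]; norm_num

lemma w_natCast_mul_eq {y : Eis ℤ} {n : ℕ} (X : DirichletCharacter ℂ n)
    (hX : ∀ q : ℕ, q.Prime → q ≠ 3 → cubicChar q (red q y) = X q)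
    (hy : ∀ p : ℕ, p.Prime → ¬ (p : Eis ℤ) ∣ y) {m : ℕ} (hm : m ≠ 0) (h3 : ¬ 3 ∣ m) {c : ℕ}
    (hc : c ≠ 0) : w m ((c : Eis ℤ) * y) =
      ∑ D ∈ m.divisors, quotFun X c D * X ((m / D : ℕ) : ZMod n) := by
  rw [w_natCast_mul hm hc hy]
  have h1 : ∏ p ∈ m.primeFactors, loc (cubicChar p (red p y)) c p (m.factorization p) =
      primePowerFun (fun p k => loc (X p) c p k) m := by
    rw [primePowerFun_apply _ hm]
    refine Finset.prod_congr rfl fun p hp => ?_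
    have hp' := Nat.mem_primeFactors.1 hp
    rw [hX p hp'.1 (by rintro rfl; exact h3 hp'.2.1)]
  rw [h1, primePowerFun_loc_eq, ArithmeticFunction.mul_apply,
    Nat.sum_divisorsAntidiagonal' (fun a b => toArithmeticFunction (X ·) a * quotFun X c b)]
  refine Finset.sum_congr rfl fun D hD => ?_
  rw [mul_comm, ← DirichletCharacter.apply_eq_toArithmeticFunction_apply]
  exact (Nat.div_pos (Nat.divisor_le hD) (Nat.pos_of_mem_divisors hD)).ne'

end Eis

namespace Eis

/-- The members of the family lying in `[M, 2 * M]`. -/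
def fam (l M : ℕ) : Finset ℕ := (Finset.Icc M (2 * M)).filter fun m => m % 9 = 1 ∧ m % l ^ 2 = l

lemma good_of_mod {l m : ℕ} (hl : l.Prime) (h9 : m % 9 = 1) (hm : m % l ^ 2 = l) : Good l m where
  mod_nine := h9
  dvd := by
    rw [← Nat.mod_add_div m (l ^ 2), hm]
    exact dvd_add dvd_rfl (Dvd.dvd.mul_right (dvd_pow_self l two_ne_zero) _)
  not_sq_dvd h := by
    rw [Nat.mod_eq_zero_of_dvd h] at hm
    exact hl.ne_zero hm.symm

lemma exists_modEq_of_fam {l : ℕ} (hl : l.Prime) (hl9 : l % 9 = 2) :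
    ∃ r : ℤ, ∀ x : ℕ, (x % 9 = 1 ∧ x % l ^ 2 = l) ↔ ((9 * l ^ 2 : ℕ) : ℤ) ∣ x - r := by
  have hco : Nat.Coprime 9 (l ^ 2) := by
    apply Nat.Coprime.pow_right
    rw [show (9 : ℕ) = 3 ^ 2 by norm_num]
    apply Nat.Coprime.pow_left
    rw [Nat.coprime_primes Nat.prime_three hl]
    rintro rfl; omega
  obtain ⟨k, hk1, hk2⟩ := Nat.chineseRemainder hco 1 l
  have hl2 : l < l ^ 2 := by
    have := hl.two_le
    nlinarith
  refine ⟨k, fun x => ?_⟩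
  have h1 : x % 9 = 1 ↔ x ≡ k [MOD 9] := by
    unfold Nat.ModEq at hk1 ⊢; omega
  have h2 : x % l ^ 2 = l ↔ x ≡ k [MOD l ^ 2] := by
    unfold Nat.ModEq at hk2 ⊢
    rw [hk2, Nat.mod_eq_of_lt hl2]
  rw [h1, h2, Nat.modEq_and_modEq_iff_modEq_mul hco, Nat.modEq_iff_dvd,
    ← dvd_neg, neg_sub]

lemma norm_sum_fam_dvd_le {l : ℕ} (hl : l.Prime) (hl9 : l % 9 = 2) : ∃ C : ℝ, 0 < C ∧
    ∀ (n : ℕ) [NeZero n] (X : DirichletCharacter ℂ n), X ≠ 1 → n.Coprime (9 * l ^ 2) →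
      ∀ (D M : ℕ) (a : ℝ), M ≠ 0 → D ≠ 0 → D.Coprime (9 * l ^ 2) → (D : ℝ) ≤ a →
      ‖∑ m ∈ fam l M, (bump (a / M) (m / M) : ℂ) *
          (if D ∣ m then X ((m / D : ℕ) : ZMod n) else 0)‖ ≤
        C * (n : ℝ) ^ (3 / 2 : ℝ) * D * (M : ℝ)⁻¹ * Real.exp (-(a / M) / 4) := by
  obtain ⟨C, hC, HC⟩ := DirichletCharacter.exists_norm_tsum_le
  obtain ⟨r, hr⟩ := exists_modEq_of_fam hl hl9
  set q := 9 * l ^ 2 with hq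
  have hq0 : q ≠ 0 := mul_ne_zero (by norm_num) (pow_ne_zero _ hl.ne_zero)
  have hqR : (0:ℝ) < q := by exact_mod_cast Nat.pos_of_ne_zero hq0
  refine ⟨C * (6912 * (1 + 3 * q) * q), by positivity, ?_⟩
  intro n _ X hX hnq D M a hM hD hDq hDa
  have hMR : (0:ℝ) < M := by exact_mod_cast Nat.pos_of_ne_zero hM
  have hDR : (0:ℝ) < D := by exact_mod_cast Nat.pos_of_ne_zero hD
  have haR : 0 ≤ a := hDR.le.trans hDa
  obtain ⟨s₀, hs₀⟩ : ∃ s₀ : ℤ, (q : ℤ) ∣ D * s₀ - r := by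
    have hco : IsCoprime (D : ℤ) (q : ℤ) := Nat.isCoprime_iff_coprime.2 hDq
    obtain ⟨u, v, huv⟩ := hco
    refine ⟨u * r, -(v * r), ?_⟩
    linear_combination (r : ℤ) * huv
  set A : ℝ := D * s₀ / M with hA
  set e : ℝ := D * q / M with he
  have he0 : 0 < e := by positivity
  set f : ℤ → ℝ := fun k => bump (a / M) (A + e * k) with hf
  have hff : f.support.Finite := (Finset.finite_toSet _).subset (bump_support_subset _ A he0)
  have hfk : ∀ k : ℤ, f k = bump (a / M) (((D * (s₀ + q * k) : ℤ) : ℝ) / M) := by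
    intro k
    rw [hf]
    simp only
    congr 1
    rw [hA, he]; push_cast; ring
  have hunit : IsUnit ((q : ℕ) : ZMod n) := (ZMod.isUnit_iff_coprime q n).2 hnq.symm
  set b : ZMod n := (s₀ : ZMod n) * ((q : ℕ) : ZMod n)⁻¹ with hb
  have hXk : ∀ k : ℤ, X (((s₀ + q * k : ℤ)) : ZMod n) = X (q : ZMod n) * X (k + b) := by
    intro k
    rw [← map_mul]
    congr 1
    push_cast
    have h1 : (q : ZMod n) * ((q : ℕ) : ZMod n)⁻¹ = 1 := ZMod.mul_inv_of_unit _ hunit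
    rw [hb]
    linear_combination (-(s₀ : ZMod n)) * h1
  have hsum : ∑ m ∈ fam l M, (bump (a / M) (m / M) : ℂ) *
      (if D ∣ m then X ((m / D : ℕ) : ZMod n) else 0) =
      X (q : ZMod n) * ∑' k : ℤ, X (k + b) * (f k : ℂ) := by
    rw [← tsum_mul_left]
    simp only [← mul_assoc, ← hXk]
    set B := (fam l M).filter (D ∣ ·) with hB
    have hstep : ∀ m ∈ B, ∃ k : ℤ, (m : ℤ) = D * (s₀ + q * k) := by
      intro m hm
      rw [hB, Finset.mem_filter, fam, Finset.mem_filter] at hm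
      have h1 := (hr m).1 hm.1.2
      obtain ⟨s, rfl⟩ := hm.2
      have h2 : (q : ℤ) ∣ D * (s - s₀) := by
        have := dvd_sub h1 hs₀
        rwa [show (D : ℤ) * (s - s₀) = ((D * s : ℕ) : ℤ) - r - (D * s₀ - r) by push_cast; ring]
      have h3 := (Nat.isCoprime_iff_coprime.2 hDq).symm.dvd_of_dvd_mul_left h2
      obtain ⟨k, hk⟩ := h3
      refine ⟨k, ?_⟩
      push_cast
      rw [← hk]; ring
    choose! i hi using hstep
    have hinj : Set.InjOn i B := by
      intro m hm m' hm' h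
      have h1 := hi m hm
      have h2 := hi m' hm'
      rw [h, ← h2] at h1
      exact_mod_cast h1
    have hzero : ∀ k ∉ B.image i, X (((s₀ + q * k : ℤ)) : ZMod n) * (f k : ℂ) = 0 := by
      intro k hk
      have : f k = 0 := by
        by_contra hne
        rw [hfk] at hne
        have h1 : 1 ≤ ((D * (s₀ + q * k) : ℤ) : ℝ) / M := by
          by_contra! h
          exact hne (bump_of_le h.le)
        have h2 : ((D * (s₀ + q * k) : ℤ) : ℝ) / M ≤ 2 := by
          by_contra! h
          exact hne (bump_of_ge h.le)
        rw [le_div_iff₀ hMR, one_mul] at h1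
        rw [div_le_iff₀ hMR] at h2
        have h1' : (M : ℤ) ≤ D * (s₀ + q * k) := by exact_mod_cast h1
        have h2' : D * (s₀ + q * k) ≤ 2 * (M : ℤ) := by exact_mod_cast h2
        obtain ⟨m, hm⟩ := Int.eq_ofNat_of_zero_le (a := D * (s₀ + q * k)) (by omega)
        have hmB : m ∈ B := by
          rw [hB, Finset.mem_filter, fam, Finset.mem_filter, Finset.mem_Icc]
          refine ⟨⟨⟨by omega, by omega⟩, (hr m).2 ?_⟩, ?_⟩
          · rw [← hm]
            have := dvd_add hs₀ (Dvd.intro (D * k : ℤ) rfl : (q : ℤ) ∣ q * (D * k))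
            rwa [show (D : ℤ) * (s₀ + q * k) - r = D * s₀ - r + q * (D * k) by ring]
          · have : (D : ℤ) ∣ m := ⟨_, hm.symm⟩
            exact_mod_cast this
        apply hk
        rw [Finset.mem_image]
        refine ⟨m, hmB, ?_⟩
        have h3 := hi m hmB
        rw [← hm] at h3
        have h4 : (D : ℤ) ≠ 0 := by exact_mod_cast hD
        have h5 : (q : ℤ) ≠ 0 := by exact_mod_cast hq0
        have := mul_left_cancel₀ h4 h3
        exact (mul_left_cancel₀ h5 (add_left_cancel this)).symm
      rw [this]; simp
    rw [tsum_eq_sum hzero, Finset.sum_image hinj]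
    simp only [mul_ite, mul_zero]
    rw [← Finset.sum_filter, ← hB]
    refine Finset.sum_congr rfl fun m hm => ?_
    have h1 := hi m hm
    rw [hfk, ← h1, mul_comm]
    congr 2
    have h2 : ((m / D : ℕ) : ℤ) = s₀ + q * i m := by
      push_cast
      rw [h1]
      exact Int.mul_ediv_cancel_left _ (by exact_mod_cast hD)
    rw [← h2, Int.cast_natCast]
  rw [hsum, _root_.norm_mul]
  have h1 := HC n X hX b f hff
  have h2 : ∑' k, |f (k + 2) - 2 * f (k + 1) + f k| ≤
      6912 * (1 + 3 * q) * e * Real.exp (-(a / M) / 4) := by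
    refine tsum_abs_bump_second_diff_le (by positivity) he0 hqR.le ?_ A
    rw [he, mul_div_assoc', mul_comm (q : ℝ)]
    gcongr
  calc _ ≤ 1 * (C * (n : ℝ) ^ (3 / 2 : ℝ) * (6912 * (1 + 3 * q) * e * Real.exp (-(a / M) / 4))) := by
        gcongr
        · exact X.norm_le_one _
        · exact h1.trans (by gcongr)
    _ = _ := by rw [he]; field_simp

lemma norm_sum_fam_le {l : ℕ} (hl : l.Prime) (hl9 : l % 9 = 2) : ∃ C : ℝ, 0 < C ∧
    ∀ (y : Eis ℤ) (X : DirichletCharacter ℂ (norm y).natAbs), IsPrimary y →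
      (∀ q : ℕ, q.Prime → q ≠ 3 → cubicChar q (red q y) = X q) → X ≠ 1 →
      ∀ (c M : ℕ) (a : ℝ), M ≠ 0 → c ≠ 0 → (c : ℝ) ^ 2 ≤ a →
      ‖∑ m ∈ fam l M, (bump (a / M) (m / M) : ℂ) * w m ((c : Eis ℤ) * y)‖ ≤
        C * (c : ℝ) ^ (7 / 2 : ℝ) * ((norm y).natAbs : ℝ) ^ (3 / 2 : ℝ) * (M : ℝ)⁻¹ *
          Real.exp (-(a / M) / 4) := by
  obtain ⟨C, hC, HC⟩ := norm_sum_fam_dvd_le hl hl9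
  refine ⟨C * 7 ^ 49, by positivity, ?_⟩
  intro y
  generalize hn : (norm y).natAbs = n
  intro X hy hXy hX c M a hM hc hca
  have hfam : ∀ m ∈ fam l M, m ≠ 0 ∧ Good l m := by
    intro m hm
    rw [fam, Finset.mem_filter] at hm
    exact ⟨by omega, good_of_mod hl hm.2.1 hm.2.2⟩
  by_cases hlN : (l : ℤ) ∣ norm ((c : Eis ℤ) * y)
  · rw [Finset.sum_eq_zero, _root_.norm_zero]
    · positivity
    · intro m hm
      rw [(hfam m hm).2.w_eq_zero_of_dvd hl hl9 hlN, mul_zero]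
  have hnorm : norm ((c : Eis ℤ) * y) = c * c * norm y := by
    rw [map_mul, norm_eq]; simp [sq]
  rw [hnorm] at hlN
  have hlc : ¬ l ∣ c := fun h => hlN (Dvd.dvd.mul_right (Dvd.dvd.mul_right (by exact_mod_cast h) _) _)
  have hln : ¬ l ∣ n := fun h => hlN (Dvd.dvd.mul_left (Int.natCast_dvd.2 (hn ▸ h)) _)
  have hn0 : NeZero n := ⟨by
    rw [← hn, Int.natAbs_ne_zero]; exact fun h => hy.ne_zero ((norm_eq_zero_iff _).1 h)⟩
  have hn3 : n % 3 = 1 := by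
    have h1 := norm_mod_three hy.mod_three
    have h2 := norm_nonneg y
    omega
  have hnq : n.Coprime (9 * l ^ 2) := by
    apply Nat.Coprime.mul_right
    · rw [show (9 : ℕ) = 3 ^ 2 by norm_num]
      apply Nat.Coprime.pow_right
      rw [Nat.coprime_comm, Nat.Prime.coprime_iff_not_dvd Nat.prime_three]
      omega
    · apply Nat.Coprime.pow_right
      rwa [Nat.coprime_comm, Nat.Prime.coprime_iff_not_dvd hl]
  have hsum : ∑ m ∈ fam l M, (bump (a / M) (m / M) : ℂ) * w m ((c : Eis ℤ) * y) =
      ∑ D ∈ (c ^ 2).divisors, quotFun X c D * ∑ m ∈ fam l M, (bump (a / M) (m / M) : ℂ) *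
          (if D ∣ m then X ((m / D : ℕ) : ZMod n) else 0) := by
    simp only [Finset.mul_sum]
    rw [Finset.sum_comm]
    refine Finset.sum_congr rfl fun m hm => ?_
    obtain ⟨hm0, hg⟩ := hfam m hm
    have h3 : ¬ 3 ∣ m := by have := hg.mod_nine; omega
    rw [w_natCast_mul_eq X hXy hy.primitive hm0 h3 hc, Finset.mul_sum]
    have h4 : ∀ s : Finset ℕ, ∑ D ∈ s, quotFun X c D * ((bump (a / M) (m / M) : ℂ) *
        (if D ∣ m then X ((m / D : ℕ) : ZMod n) else 0)) = ∑ D ∈ s with D ∣ m,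
        (bump (a / M) (m / M) : ℂ) * (quotFun X c D * X ((m / D : ℕ) : ZMod n)) := by
      intro s
      rw [Finset.sum_filter]
      refine Finset.sum_congr rfl fun D _ => ?_
      split_ifs <;> ring
    rw [h4]
    symm
    refine Finset.sum_subset_zero_on_sdiff ?_ ?_ fun _ _ => rfl
    · intro D hD
      rw [Finset.mem_filter] at hD
      exact Nat.mem_divisors.2 ⟨hD.2, hm0⟩
    · intro D hD
      rw [Finset.mem_sdiff, Finset.mem_filter, Nat.mem_divisors, Nat.mem_divisors] at hD
      have : quotFun X c D = 0 := by
        by_contra hne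
        exact hD.2 ⟨⟨dvd_sq_of_quotFun_ne_zero X hc hne, pow_ne_zero _ hc⟩, hD.1.1⟩
      rw [this]; ring
  rw [hsum]
  have hterm : ∀ D ∈ (c ^ 2).divisors, ‖quotFun X c D * ∑ m ∈ fam l M,
      (bump (a / M) (m / M) : ℂ) * (if D ∣ m then X ((m / D : ℕ) : ZMod n) else 0)‖ ≤
      ‖quotFun X c D‖ * D * (C * (n : ℝ) ^ (3 / 2 : ℝ) * (M : ℝ)⁻¹ * Real.exp (-(a / M) / 4)) := by
    intro D hD
    have hDc := Nat.dvd_of_mem_divisors hD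
    have hD0 : D ≠ 0 := (Nat.pos_of_mem_divisors hD).ne'
    have hDl : ¬ l ∣ D := fun h => hlc (hl.dvd_of_dvd_pow (h.trans hDc))
    rw [_root_.norm_mul, mul_assoc ‖quotFun X c D‖]
    gcongr
    by_cases h3 : 3 ∣ D
    · rw [Finset.sum_eq_zero, _root_.norm_zero]
      · positivity
      · intro m hm
        have hm9 := (hfam m hm).2.mod_nine
        rw [if_neg, mul_zero]
        intro h
        have := h3.trans h
        omega
    · have hDq : D.Coprime (9 * l ^ 2) := by
        apply Nat.Coprime.mul_right
        · rw [show (9 : ℕ) = 3 ^ 2 by norm_num]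
          apply Nat.Coprime.pow_right
          rwa [Nat.coprime_comm, Nat.Prime.coprime_iff_not_dvd Nat.prime_three]
        · apply Nat.Coprime.pow_right
          rwa [Nat.coprime_comm, Nat.Prime.coprime_iff_not_dvd hl]
      have hDa : (D : ℝ) ≤ a := by
        refine le_trans ?_ hca
        exact_mod_cast Nat.le_of_dvd (by positivity) hDc
      refine (HC n X hX hnq D M a hM hD0 hDq hDa).trans_eq ?_
      ring
  refine (norm_sum_le_of_le _ hterm).trans ?_
  rw [← Finset.sum_mul]
  calc _ ≤ 7 ^ 49 * (c : ℝ) ^ (7 / 2 : ℝ) *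
        (C * (n : ℝ) ^ (3 / 2 : ℝ) * (M : ℝ)⁻¹ * Real.exp (-(a / M) / 4)) := by
        gcongr; exact sum_norm_quotFun_le X hc
    _ = _ := by ring

end Eis

namespace Eis

open scoped ComplexOrder in
lemma kap_nonneg (p : ℕ) (hp : p.Prime) (k : ℕ) : 0 ≤ kap p k := by
  have : NeZero (p ^ k) := ⟨pow_ne_zero _ hp.ne_zero⟩
  rw [kap, w_eq_sum]
  refine mul_nonneg (by rw [← Complex.ofReal_natCast, ← Complex.ofReal_inv,
    Complex.zero_le_real]; positivity) ?_
  simp only [map_zero, mul_zero, im_zero, if_true]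
  rw [← map_sum]
  let f : MulChar (Eis (ZMod (p ^ k))) ℂ :=
    { toFun := chi (p ^ k)
      map_one' := chi_one _
      map_mul' := chi_mul _
      map_nonunit' := fun _ hu => chi_nonunit (pow_ne_zero _ hp.ne_zero) hu }
  change 0 ≤ (starRingEnd ℂ) (∑ u, f u)
  by_cases h : f = 1
  · rw [h, MulChar.sum_one_eq_card_units, map_natCast, ← Complex.ofReal_natCast,
      Complex.zero_le_real]
    positivity
  · rw [MulChar.sum_eq_zero_of_ne_one h, map_zero]

open scoped ComplexOrder in
lemma w_nonneg_of_char_eq_one {y : Eis ℤ} (hy : IsPrimary y)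
    (h : ∀ q : ℕ, q.Prime → q ≠ 3 →
      cubicChar q (red q y) = (1 : DirichletCharacter ℂ (norm y).natAbs) q)
    {m c : ℕ} (hm : m % 9 = 1) (hc : c ≠ 0) : 0 ≤ w m ((c : Eis ℤ) * y) := by
  have hm0 : m ≠ 0 := by rintro rfl; simp at hm
  rw [w_natCast_mul hm0 hc hy.primitive]
  refine Finset.prod_nonneg fun p hp => ?_
  have hpp := Nat.prime_of_mem_primeFactors hp
  have hp3 : p ≠ 3 := by
    rintro rfl
    have := Nat.dvd_of_mem_primeFactors hp
    omega
  have hz : 0 ≤ cubicChar p (red p y) := by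
    rw [h p hpp hp3]
    by_cases hu : IsUnit ((p : ℕ) : ZMod (norm y).natAbs)
    · rw [MulChar.one_apply hu]; exact zero_le_one
    · rw [MulChar.map_nonunit _ hu]
  rw [loc]
  split_ifs
  · exact mul_nonneg (pow_nonneg (by rw [← Complex.ofReal_natCast, Complex.zero_le_real]; positivity) _)
      (pow_nonneg hz _)
  · exact kap_nonneg p hpp _

lemma norm_om : QuadraticAlgebra.norm (om : Eis ℤ) = 1 := by
  rw [norm_eq]; simp

lemma neg_le_re_sum_fam {l : ℕ} (hl : l.Prime) (hl9 : l % 9 = 2) :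
    ∃ C : ℝ, 0 < C ∧ ∀ α : Eis ℤ, α ≠ 0 → ∃ (c : ℕ) (y : Eis ℤ), c ≠ 0 ∧ α = c * y ∧
      ∀ (M : ℕ) (a : ℝ), M ≠ 0 → (c : ℝ) ^ 2 ≤ a →
        -(C * (c : ℝ) ^ (7 / 2 : ℝ) * ((norm y : ℤ) : ℝ) ^ (3 / 2 : ℝ) * (M : ℝ)⁻¹ *
            Real.exp (-(a / M) / 4)) ≤
          (∑ m ∈ fam l M, (bump (a / M) (m / M) : ℂ) * w m α).re := by
  obtain ⟨C, hC, H⟩ := norm_sum_fam_le hl hl9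
  refine ⟨C, hC, fun α hα => ?_⟩
  obtain ⟨c, x, hc, rfl, hx⟩ := exists_content hα
  obtain ⟨i, j, y, hy, rfl⟩ := exists_isPrimary hx
  refine ⟨c, _, hc, rfl, fun M a hM hca => ?_⟩
  have hw : ∀ m ∈ fam l M, w m ((c : Eis ℤ) * (om ^ i * lam ^ j * y)) = w m ((c : Eis ℤ) * y) := by
    intro m hm
    rw [mul_left_comm, w_om_lam_mul]
    exact (Finset.mem_filter.1 hm).2.1
  rw [Finset.sum_congr rfl fun m hm => by rw [hw m hm]]
  have hn0 : 0 ≤ ((QuadraticAlgebra.norm (om ^ i * lam ^ j * y) : ℤ) : ℝ) := by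
    exact_mod_cast Eis.norm_nonneg _
  obtain ⟨X, hX⟩ := hy.exists_char
  by_cases h1 : X = 1
  · subst h1
    refine le_trans (b := 0) ?_ ?_
    · rw [neg_nonpos]
      have : (0:ℝ) < M := by exact_mod_cast Nat.pos_of_ne_zero hM
      positivity
    · rw [Complex.re_sum]
      refine Finset.sum_nonneg fun m hm => ?_
      rw [Complex.re_ofReal_mul]
      have := w_nonneg_of_char_eq_one hy hX (Finset.mem_filter.1 hm).2.1 hc
      exact mul_nonneg (bump_nonneg _ _) (Complex.le_def.1 this).1
  · refine le_trans ?_ (neg_le_of_abs_le (Complex.abs_re_le_norm _))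
    rw [neg_le_neg_iff]
    refine (H y X hy hX h1 c M a hM hc hca).trans ?_
    have hle : ((norm y).natAbs : ℝ) ≤ ((QuadraticAlgebra.norm (om ^ i * lam ^ j * y) : ℤ) : ℝ) := by
      have h1 : ((norm y).natAbs : ℤ) ≤ QuadraticAlgebra.norm (om ^ i * lam ^ j * y) := by
        rw [map_mul, map_mul, map_pow, map_pow, norm_om, norm_lam, one_pow, one_mul,
          Int.natAbs_of_nonneg (Eis.norm_nonneg _)]
        exact le_mul_of_one_le_left (Eis.norm_nonneg _) (one_le_pow₀ (by norm_num))
      calc ((norm y).natAbs : ℝ) = (((norm y).natAbs : ℤ) : ℝ) := (Int.cast_natCast _).symm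
        _ ≤ _ := Int.cast_le.2 h1
    gcongr

end Eis

namespace Eis

lemma tsum_exp_norm_inv {t : ℝ} (ht : 0 < t) :
    ∑' α : Eis ℤ, Real.exp (-(rate 1 * t⁻¹) * (norm α : ℤ)) =
      t * ∑' α : Eis ℤ, Real.exp (-(rate 1 * t) * (norm α : ℤ)) := by
  have h := wTheta_inv (m := 1) one_ne_zero ht
  simp only [wTheta_eq_tsum, w_one_left, one_mul] at h
  rw [← Complex.ofReal_tsum, ← Complex.ofReal_tsum, ← Complex.ofReal_mul, Complex.ofReal_inj] at h
  have e : ∀ (u : ℝ) (α : Eis ℤ), -(rate 1 * u) * ((norm α : ℤ) : ℝ) =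
      -(rate 1 * (norm α : ℤ)) * u := fun u α => by ring
  simp only [e]
  exact h

lemma exists_tsum_exp_norm_le : ∃ C : ℝ, 0 < C ∧ ∀ δ : ℝ, 0 < δ →
    ∑' α : Eis ℤ, (if α = 0 then 0 else Real.exp (-δ * (norm α : ℤ))) ≤ C / δ := by
  have hr : 0 < rate 1 := rate_pos one_ne_zero
  set r := rate 1 with hrdef
  set T : ℝ → ℝ := fun δ => ∑' α : Eis ℤ, Real.exp (-δ * (norm α : ℤ)) with hT
  have hTpos : ∀ δ, 0 < δ → 0 < T δ := fun δ hδ =>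
    (summable_exp_norm hδ).tsum_pos (fun _ => (Real.exp_pos _).le) 0 (Real.exp_pos _)
  have hnn : ∀ α : Eis ℤ, (0:ℝ) ≤ ((norm α : ℤ) : ℝ) := fun α => by
    exact_mod_cast Eis.norm_nonneg α
  have hs : ∀ δ, 0 < δ → Summable fun α : Eis ℤ =>
      if α = 0 then 0 else Real.exp (-δ * (norm α : ℤ)) := fun δ hδ =>
    (summable_exp_norm hδ).of_nonneg_of_le (fun α => by split_ifs <;> positivity)
      (fun α => by split_ifs <;> first | positivity | exact le_rfl)
  refine ⟨T r * (r + Real.exp r), mul_pos (hTpos r hr) (by positivity), fun δ hδ => ?_⟩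
  rcases le_total δ r with hle | hle
  · calc _ ≤ T δ := (hs δ hδ).tsum_le_tsum
          (fun α => by split_ifs <;> first | positivity | exact le_rfl) (summable_exp_norm hδ)
      _ = r / δ * T (r * (r / δ)) := by
          have := tsum_exp_norm_inv (t := r / δ) (by positivity)
          rw [← hrdef, show r * (r / δ)⁻¹ = δ by field_simp] at this
          exact this
      _ ≤ r / δ * T r := by
          gcongr
          refine (summable_exp_norm (by positivity)).tsum_le_tsum (fun α => ?_)
            (summable_exp_norm hr)
          apply Real.exp_le_exp.2
          rw [neg_mul, neg_mul, neg_le_neg_iff]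
          refine mul_le_mul_of_nonneg_right ?_ (hnn α)
          exact le_mul_of_one_le_right hr.le ((one_le_div hδ).2 hle)
      _ ≤ T r * (r + Real.exp r) / δ := by
          rw [div_mul_eq_mul_div]
          refine div_le_div_of_nonneg_right ?_ hδ.le
          nlinarith [hTpos r hr, Real.exp_pos r, mul_pos (hTpos r hr) (Real.exp_pos r)]
  · calc _ ≤ ∑' α : Eis ℤ, Real.exp (-r * (norm α : ℤ)) * (Real.exp r / δ) := by
          refine (hs δ hδ).tsum_le_tsum (fun α => ?_) ((summable_exp_norm hr).mul_right _)
          split_ifs with h0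
          · positivity
          · have h1 : (1:ℝ) ≤ ((norm α : ℤ) : ℝ) := by exact_mod_cast one_le_norm h0
            have h2 : Real.exp (-δ) ≤ 1 / δ := by
              rw [Real.exp_neg, ← one_div]
              exact one_div_le_one_div_of_le hδ (by linarith [Real.add_one_le_exp δ])
            calc Real.exp (-δ * (norm α : ℤ))
                ≤ Real.exp (-r * (norm α : ℤ) + (r + -δ)) := by
                  apply Real.exp_le_exp.2
                  nlinarith
              _ = Real.exp (-r * (norm α : ℤ)) * (Real.exp r * Real.exp (-δ)) := by
                  rw [Real.exp_add, Real.exp_add]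
              _ ≤ Real.exp (-r * (norm α : ℤ)) * (Real.exp r * (1 / δ)) := by gcongr
              _ = _ := by ring
      _ = T r * (Real.exp r / δ) := tsum_mul_right
      _ ≤ T r * (r + Real.exp r) / δ := by
          rw [mul_div_assoc]
          gcongr
          linarith

lemma exists_rpow_mul_exp_le : ∃ K : ℝ, 0 < K ∧ ∀ x : ℝ, 0 ≤ x →
    x ^ (3 / 2 : ℝ) * Real.exp (-x) ≤ K * Real.exp (-x / 2) := by
  refine ⟨8, by norm_num, fun x hx => ?_⟩
  have h1 : x ^ (3 / 2 : ℝ) ≤ 8 * Real.exp (x / 2) := by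
    have h3 : x / 4 ≤ Real.exp (x / 4) := by linarith [Real.add_one_le_exp (x / 4)]
    have h2 : x ≤ 4 * Real.exp (x / 3) := by
      have : x / 3 ≤ Real.exp (x / 3) := by linarith [Real.add_one_le_exp (x / 3)]
      linarith [Real.exp_pos (x / 3)]
    calc x ^ (3 / 2 : ℝ) ≤ (4 * Real.exp (x / 3)) ^ (3 / 2 : ℝ) := by gcongr
      _ = 4 ^ (3 / 2 : ℝ) * Real.exp (x / 2) := by
          rw [Real.mul_rpow (by norm_num) (Real.exp_pos _).le, ← Real.exp_mul]
          congr 2; ring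
      _ = 8 * Real.exp (x / 2) := by
          rw [show (4:ℝ) = 2 ^ (2:ℝ) by norm_num, ← Real.rpow_mul (by norm_num)]
          norm_num
  calc x ^ (3 / 2 : ℝ) * Real.exp (-x) ≤ 8 * Real.exp (x / 2) * Real.exp (-x) := by gcongr
    _ = 8 * Real.exp (-x / 2) := by rw [mul_assoc, ← Real.exp_add]; congr 2; ring

lemma exists_tsum_rpow_mul_exp_norm_le : ∃ C : ℝ, 0 < C ∧ ∀ δ : ℝ, 0 < δ →
    (Summable fun α : Eis ℤ => ((norm α : ℤ) : ℝ) ^ (3 / 2 : ℝ) * Real.exp (-δ * (norm α : ℤ))) ∧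
    ∑' α : Eis ℤ, ((norm α : ℤ) : ℝ) ^ (3 / 2 : ℝ) * Real.exp (-δ * (norm α : ℤ)) ≤
      C * δ ^ (-(5 / 2) : ℝ) := by
  obtain ⟨C, hC, H⟩ := exists_tsum_exp_norm_le
  obtain ⟨K, hK, HK⟩ := exists_rpow_mul_exp_le
  refine ⟨2 * K * C, by positivity, fun δ hδ => ?_⟩
  have hnn : ∀ α : Eis ℤ, (0:ℝ) ≤ ((norm α : ℤ) : ℝ) := fun α => by
    exact_mod_cast Eis.norm_nonneg α
  have hs : Summable fun α : Eis ℤ =>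
      if α = 0 then 0 else Real.exp (-(δ / 2) * (norm α : ℤ)) :=
    (summable_exp_norm (half_pos hδ)).of_nonneg_of_le (fun α => by split_ifs <;> positivity)
      (fun α => by split_ifs <;> first | positivity | exact le_rfl)
  have hb : ∀ α : Eis ℤ,
      ((norm α : ℤ) : ℝ) ^ (3 / 2 : ℝ) * Real.exp (-δ * (norm α : ℤ)) ≤
        K * δ ^ (-(3 / 2) : ℝ) * (if α = 0 then 0 else Real.exp (-(δ / 2) * (norm α : ℤ))) := by
    intro α
    split_ifs with h0
    · subst h0
      rw [QuadraticAlgebra.norm_zero, Int.cast_zero, Real.zero_rpow (by norm_num), zero_mul, mul_zero]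
    · have := HK (δ * (norm α : ℤ)) (mul_nonneg hδ.le (hnn α))
      rw [Real.mul_rpow hδ.le (hnn α)] at this
      rw [Real.rpow_neg hδ.le]
      have hp : 0 < δ ^ (3 / 2 : ℝ) := by positivity
      rw [show K * (δ ^ (3 / 2 : ℝ))⁻¹ * Real.exp (-(δ / 2) * (norm α : ℤ)) =
        (K * Real.exp (-(δ / 2) * (norm α : ℤ))) / δ ^ (3 / 2 : ℝ) by field_simp, le_div_iff₀ hp]
      calc _ = δ ^ (3 / 2 : ℝ) * ((norm α : ℤ) : ℝ) ^ (3 / 2 : ℝ) *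
            Real.exp (-(δ * (norm α : ℤ))) := by rw [neg_mul]; ring
        _ ≤ _ := this
        _ = _ := by congr 2; ring
  have hsum : Summable fun α : Eis ℤ =>
      ((norm α : ℤ) : ℝ) ^ (3 / 2 : ℝ) * Real.exp (-δ * (norm α : ℤ)) :=
    (hs.mul_left _).of_nonneg_of_le
      (fun α => mul_nonneg (Real.rpow_nonneg (hnn α) _) (Real.exp_pos _).le) hb
  refine ⟨hsum, ?_⟩
  calc _ ≤ ∑' α : Eis ℤ, K * δ ^ (-(3 / 2) : ℝ) *
        (if α = 0 then 0 else Real.exp (-(δ / 2) * (norm α : ℤ))) :=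
        hsum.tsum_le_tsum hb (hs.mul_left _)
    _ = K * δ ^ (-(3 / 2) : ℝ) *
        ∑' α : Eis ℤ, (if α = 0 then 0 else Real.exp (-(δ / 2) * (norm α : ℤ))) := tsum_mul_left
    _ ≤ K * δ ^ (-(3 / 2) : ℝ) * (C / (δ / 2)) := by gcongr; exact H _ (half_pos hδ)
    _ = 2 * K * C * δ ^ (-(5 / 2) : ℝ) := by
        rw [show (-(5 / 2) : ℝ) = -(3 / 2) - 1 by norm_num, Real.rpow_sub_one hδ.ne']
        field_simp

lemma exists_tsum_prod_norm_le : ∃ C : ℝ, 0 < C ∧ ∀ δ : ℝ, 0 < δ →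
    (Summable fun x : ℕ × Eis ℤ => (x.1 : ℝ) ^ (7 / 2 : ℝ) *
      ((norm x.2 : ℤ) : ℝ) ^ (3 / 2 : ℝ) * Real.exp (-δ * ((x.1 : ℝ) ^ 2 * (norm x.2 : ℤ)))) ∧
    ∑' x : ℕ × Eis ℤ, (x.1 : ℝ) ^ (7 / 2 : ℝ) *
      ((norm x.2 : ℤ) : ℝ) ^ (3 / 2 : ℝ) * Real.exp (-δ * ((x.1 : ℝ) ^ 2 * (norm x.2 : ℤ))) ≤
      C * δ ^ (-(5 / 2) : ℝ) := by
  obtain ⟨C, hC, H⟩ := exists_tsum_rpow_mul_exp_norm_le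
  have hz : Summable fun c : ℕ => (c : ℝ) ^ (-(3 / 2) : ℝ) :=
    Real.summable_nat_rpow.2 (by norm_num)
  have hZ : 0 < ∑' c : ℕ, (c : ℝ) ^ (-(3 / 2) : ℝ) :=
    hz.tsum_pos (fun c => by positivity) 1 (by norm_num)
  refine ⟨C * ∑' c : ℕ, (c : ℝ) ^ (-(3 / 2) : ℝ), by positivity, fun δ hδ => ?_⟩
  have hnn : ∀ α : Eis ℤ, (0:ℝ) ≤ ((norm α : ℤ) : ℝ) := fun α => by
    exact_mod_cast Eis.norm_nonneg α
  set f : ℕ × Eis ℤ → ℝ := fun x => (x.1 : ℝ) ^ (7 / 2 : ℝ) *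
      ((norm x.2 : ℤ) : ℝ) ^ (3 / 2 : ℝ) * Real.exp (-δ * ((x.1 : ℝ) ^ 2 * (norm x.2 : ℤ))) with hf
  have hf0 : 0 ≤ f := fun x => by
    have := hnn x.2
    simp only [hf]; positivity
  have heq : ∀ c : ℕ, (fun y => f (c, y)) = fun y => (c : ℝ) ^ (7 / 2 : ℝ) *
      (((norm y : ℤ) : ℝ) ^ (3 / 2 : ℝ) * Real.exp (-(δ * (c : ℝ) ^ 2) * (norm y : ℤ))) := by
    intro c; funext y
    simp only [hf]
    rw [mul_assoc]; congr 3; ring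
  have hin : ∀ c : ℕ, Summable (fun y => f (c, y)) ∧
      ∑' y, f (c, y) ≤ C * δ ^ (-(5 / 2) : ℝ) * (c : ℝ) ^ (-(3 / 2) : ℝ) := by
    intro c
    rw [heq c]
    rcases Nat.eq_zero_or_pos c with rfl | hc
    · rw [Nat.cast_zero, Real.zero_rpow (by norm_num)]
      simp only [zero_mul, tsum_zero]
      exact ⟨summable_zero, by positivity⟩
    · have hc' : (0:ℝ) < c := by exact_mod_cast hc
      obtain ⟨h1, h2⟩ := H (δ * (c : ℝ) ^ 2) (by positivity)
      refine ⟨h1.mul_left _, ?_⟩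
      rw [tsum_mul_left]
      calc _ ≤ (c : ℝ) ^ (7 / 2 : ℝ) * (C * (δ * (c : ℝ) ^ 2) ^ (-(5 / 2) : ℝ)) := by gcongr
        _ = C * δ ^ (-(5 / 2) : ℝ) * ((c : ℝ) ^ (7 / 2 : ℝ) * (c : ℝ) ^ (-5 : ℝ)) := by
            rw [Real.mul_rpow hδ.le (by positivity), ← Real.rpow_natCast, ← Real.rpow_mul hc'.le]
            norm_num
            ring
        _ = _ := by rw [← Real.rpow_add hc']; norm_num
  have hs : Summable f := by
    rw [summable_prod_of_nonneg hf0]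
    refine ⟨fun c => (hin c).1, ?_⟩
    exact (hz.mul_left _).of_nonneg_of_le (fun c => tsum_nonneg fun y => hf0 _) fun c => (hin c).2
  refine ⟨hs, ?_⟩
  rw [hs.tsum_prod' fun c => (hin c).1]
  calc _ ≤ ∑' c : ℕ, C * δ ^ (-(5 / 2) : ℝ) * (c : ℝ) ^ (-(3 / 2) : ℝ) :=
        Summable.tsum_le_tsum (fun c => (hin c).2)
          ((hz.mul_left _).of_nonneg_of_le (fun c => tsum_nonneg fun y => hf0 _) fun c => (hin c).2)
          (hz.mul_left _)
    _ = _ := by rw [tsum_mul_left]; ring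

end Eis

namespace Eis

lemma fam_mod {l M m : ℕ} (hm : m ∈ fam l M) : m % 9 = 1 ∧ m % l ^ 2 = l :=
  (Finset.mem_filter.1 hm).2

lemma fam_ne_zero {l M m : ℕ} (hm : m ∈ fam l M) : m ≠ 0 := by
  have := (fam_mod hm).1
  omega

lemma clamp_of_fam {l M m : ℕ} (hM : M ≠ 0) (hm : m ∈ fam l M) : clamp ((m : ℝ) / M) = m / M := by
  have hMR : (0:ℝ) < M := by exact_mod_cast Nat.pos_of_ne_zero hM
  obtain ⟨h1, h2⟩ := Finset.mem_Icc.1 (Finset.mem_filter.1 hm).1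
  apply clamp_of_mem
  · rw [one_le_div hMR]; exact_mod_cast h1
  · rw [div_le_iff₀ hMR]; exact_mod_cast h2

/-- The weight of `m` in the average over the family. -/
def bumpWeight (M m : ℕ) : ℝ := ((clamp ((m : ℝ) / M) - 1) * (2 - clamp ((m : ℝ) / M))) ^ 2

lemma bumpWeight_nonneg (M m : ℕ) : 0 ≤ bumpWeight M m := sq_nonneg _

/-- The contribution of `α` to the average of the theta functions over the family. -/
def avgTerm (l M : ℕ) (t : ℝ) (α : Eis ℤ) : ℝ :=
  (∑ m ∈ fam l M, (bump (rate 1 * t * (norm α : ℤ) / M) (m / M) : ℂ) * w m α).re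

lemma bump_eq_of_fam {l M m : ℕ} (hM : M ≠ 0) (hm : m ∈ fam l M) (t N : ℝ) :
    bump (rate 1 * t * N / M) (m / M) = bumpWeight M m * Real.exp (-(rate m * N) * t) := by
  have hMR : (M:ℝ) ≠ 0 := by exact_mod_cast hM
  have hmR : (m:ℝ) ≠ 0 := by exact_mod_cast fam_ne_zero hm
  rw [bump, bumpWeight, clamp_of_fam hM hm, rate, rate]
  congr 2
  have : √3 ≠ 0 := by positivity
  field_simp
  push_cast
  ring

/-- The weighted average of the theta functions over the family. -/
def thetaAvg (l M : ℕ) (t : ℝ) : ℝ := ∑ m ∈ fam l M, bumpWeight M m * (wTheta m t).re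

lemma hasSum_avgTerm {l M : ℕ} (hM : M ≠ 0) {t : ℝ} (ht : 0 < t) :
    HasSum (avgTerm l M t) (thetaAvg l M t) := by
  have h : ∀ m ∈ fam l M, HasSum (fun α : Eis ℤ =>
      ((bump (rate 1 * t * (norm α : ℤ) / M) (m / M) : ℂ) * w m α).re)
      (bumpWeight M m * (wTheta m t).re) := by
    intro m hm
    have h1 := (summable_wTheta (fam_ne_zero hm) ht).hasSum
    rw [← wTheta_eq_tsum] at h1
    have h2 := (Complex.hasSum_re h1).mul_left (bumpWeight M m)
    refine h2.congr_fun ?_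
    intro α
    rw [bump_eq_of_fam hM hm, Complex.re_ofReal_mul, mul_comm (w m α), Complex.re_ofReal_mul,
      mul_assoc]
  have := hasSum_sum h
  simp only [← Complex.re_sum] at this
  exact this

lemma avgTerm_zero {l : ℕ} (hl : l.Prime) (hl9 : l % 9 = 2) (M : ℕ) (t : ℝ) :
    avgTerm l M t 0 = 0 := by
  rw [avgTerm, Finset.sum_eq_zero, Complex.zero_re]
  intro m hm
  rw [(good_of_mod hl (fam_mod hm).1 (fam_mod hm).2).w_zero hl hl9, mul_zero]

lemma one_le_rate_one : 1 ≤ rate 1 := by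
  have h3 : √3 ≤ 2 := by rw [Real.sqrt_le_left (by norm_num)]; norm_num
  rw [rate, one_le_div (by positivity)]
  have := Real.pi_gt_three
  push_cast
  nlinarith

lemma exists_le_thetaAvg {l : ℕ} (hl : l.Prime) (hl9 : l % 9 = 2) :
    ∃ C : ℝ, 0 < C ∧ ∀ (M : ℕ) (t : ℝ) (T : Finset (Eis ℤ)) (d : Eis ℤ → ℝ), M ≠ 0 → 1 ≤ t →
      (∀ α ∈ T, d α ≤ avgTerm l M t α) →
      ∑ α ∈ T, d α - C * (M : ℝ) ^ (3 / 2 : ℝ) * t ^ (-(5 / 2) : ℝ) ≤ thetaAvg l M t := by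
  obtain ⟨C, hC, H⟩ := neg_le_re_sum_fam hl hl9
  obtain ⟨C', hC', H'⟩ := exists_tsum_prod_norm_le
  have hφ : ∀ α : Eis ℤ, ∃ x : ℕ × Eis ℤ, α = x.1 * x.2 ∧ (α ≠ 0 → x.1 ≠ 0 ∧
      ∀ (M : ℕ) (a : ℝ), M ≠ 0 → (x.1 : ℝ) ^ 2 ≤ a →
        -(C * (x.1 : ℝ) ^ (7 / 2 : ℝ) * ((norm x.2 : ℤ) : ℝ) ^ (3 / 2 : ℝ) * (M : ℝ)⁻¹ *
            Real.exp (-(a / M) / 4)) ≤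
          (∑ m ∈ fam l M, (bump (a / M) (m / M) : ℂ) * w m α).re) := by
    intro α
    by_cases h0 : α = 0
    · exact ⟨(0, 0), by simp [h0], fun h => absurd h0 h⟩
    · obtain ⟨c, y, h1, h2, h3⟩ := H α h0
      exact ⟨(c, y), h2, fun _ => ⟨h1, h3⟩⟩
  choose φ hφ1 hφ2 using hφ
  have hinj : Function.Injective φ := fun α β h => by rw [hφ1 α, hφ1 β, h]
  have hr := one_le_rate_one
  refine ⟨C * C' * (rate 1 / 4) ^ (-(5 / 2) : ℝ), by positivity, fun M t T d hM ht hd => ?_⟩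
  have hMR : (0:ℝ) < M := by exact_mod_cast Nat.pos_of_ne_zero hM
  have ht0 : 0 < t := by linarith
  set δ := rate 1 * t / (4 * M) with hδdef
  have hδ : 0 < δ := by positivity
  obtain ⟨hs, hb⟩ := H' δ hδ
  set g : ℕ × Eis ℤ → ℝ := fun x => (x.1 : ℝ) ^ (7 / 2 : ℝ) *
      ((norm x.2 : ℤ) : ℝ) ^ (3 / 2 : ℝ) * Real.exp (-δ * ((x.1 : ℝ) ^ 2 * (norm x.2 : ℤ))) with hg
  have hnn : ∀ α : Eis ℤ, (0:ℝ) ≤ ((norm α : ℤ) : ℝ) := fun α => by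
    exact_mod_cast Eis.norm_nonneg α
  have hg0 : ∀ x, 0 ≤ g x := fun x => by
    have := hnn x.2
    simp only [hg]; positivity
  have hnorm : ∀ α, ((norm α : ℤ) : ℝ) = ((φ α).1 : ℝ) ^ 2 * (norm (φ α).2 : ℤ) := by
    intro α
    conv_lhs => rw [hφ1 α]
    rw [map_mul, show norm (((φ α).1 : ℕ) : Eis ℤ) = (((φ α).1 : ℕ) : ℤ) ^ 2 by
      rw [norm_eq]; simp; try ring]
    push_cast; ring
  have hE : ∀ α, -(C * (M : ℝ)⁻¹ * g (φ α)) ≤ avgTerm l M t α := by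
    intro α
    by_cases h0 : α = 0
    · subst h0
      rw [avgTerm_zero hl hl9, neg_nonpos]
      have := hg0 (φ 0)
      positivity
    · obtain ⟨hc, hh⟩ := hφ2 α h0
      have hy : (φ α).2 ≠ 0 := fun h => h0 (by rw [hφ1 α, h, mul_zero])
      have h1 : (1:ℝ) ≤ ((norm (φ α).2 : ℤ) : ℝ) := by exact_mod_cast one_le_norm hy
      refine le_trans (le_of_eq ?_) (hh M (rate 1 * t * (norm α : ℤ)) hM ?_)
      · simp only [hg]
        rw [show -(rate 1 * t * ((norm α : ℤ) : ℝ) / M) / 4 =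
          -δ * (((φ α).1 : ℝ) ^ 2 * (norm (φ α).2 : ℤ)) by
            rw [← hnorm, hδdef]; field_simp]
        ring
      · rw [hnorm]
        have h2 : 1 ≤ rate 1 * t * ((norm (φ α).2 : ℤ) : ℝ) :=
          one_le_mul_of_one_le_of_one_le (one_le_mul_of_one_le_of_one_le hr ht) h1
        nlinarith [sq_nonneg ((φ α).1 : ℝ)]
  have hsφ : Summable fun α => C * (M : ℝ)⁻¹ * g (φ α) := (hs.comp_injective hinj).mul_left _
  have hsum := hasSum_avgTerm (l := l) hM ht0
  have hD : HasSum (fun α => if α ∈ T then d α else 0) (∑ α ∈ T, d α) := by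
    have h : ∑ α ∈ T, d α = ∑ α ∈ T, if α ∈ T then d α else 0 :=
      Finset.sum_congr rfl fun α hα => (if_pos hα).symm
    rw [h]
    exact hasSum_sum_of_ne_finset_zero fun b hb => if_neg hb
  have hle : ∀ α, (if α ∈ T then d α else 0) - C * (M : ℝ)⁻¹ * g (φ α) ≤ avgTerm l M t α := by
    intro α
    have := hE α
    split_ifs with hα
    · have h1 := hd α hα
      have h2 := hg0 (φ α)
      have : 0 ≤ C * (M : ℝ)⁻¹ * g (φ α) := by positivity
      linarith
    · linarith
  refine le_trans (sub_le_sub_left ?_ _) (hasSum_le hle (hD.sub hsφ.hasSum) hsum)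
  rw [tsum_mul_left]
  calc C * (M : ℝ)⁻¹ * ∑' α, g (φ α) ≤ C * (M : ℝ)⁻¹ * (C' * δ ^ (-(5 / 2) : ℝ)) := by
        gcongr
        refine le_trans ?_ hb
        exact tsum_comp_le_tsum_of_inj hs hg0 hinj
    _ = _ := by
        rw [hδdef, show rate 1 * t / (4 * M) = rate 1 / 4 * t * (M:ℝ)⁻¹ by field_simp,
          Real.mul_rpow (by positivity) (by positivity),
          Real.mul_rpow (by positivity) (by positivity), Real.inv_rpow hMR.le,
          ← Real.rpow_neg hMR.le, neg_neg,
          show (5 / 2 : ℝ) = 1 + 3 / 2 by norm_num, Real.rpow_add hMR, Real.rpow_one]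
        field_simp

end Eis

namespace Eis

lemma isPrimary_one : IsPrimary 1 where
  primitive p hp h := by
    have h1 := (natCast_dvd_iff _ _).1 h
    have := h1.1
    rw [re_one] at this
    exact hp.one_lt.ne' (by exact_mod_cast Int.eq_one_of_dvd_one (by positivity) this)
  mod_three := Or.inr (by simp)

open scoped ComplexOrder in
lemma w_natCast_nonneg {m c : ℕ} (hm : m % 9 = 1) (hc : c ≠ 0) : 0 ≤ w m (c : Eis ℤ) := by
  have := w_nonneg_of_char_eq_one isPrimary_one (m := m) (c := c) ?_ hm hc
  · rwa [mul_one] at this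
  · intro q hq _
    have h1 : ∀ n : ℕ, n = 1 → (1 : DirichletCharacter ℂ n) q = 1 := by
      rintro n rfl
      exact MulChar.one_apply (isUnit_of_subsingleton _)
    rw [map_one, map_one, h1 _ (by rw [map_one]; rfl)]

lemma w_prime_eq_one {m p : ℕ} (hm : m ≠ 0) (hp : p.Prime) (h : ¬ p ∣ m) :
    w m (p : Eis ℤ) = 1 := by
  have := w_natCast_mul hm hp.ne_zero isPrimary_one.primitive
  rw [mul_one] at this
  rw [this]
  refine Finset.prod_eq_one fun q hq => ?_
  have hqp : p ≠ q := by
    rintro rfl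
    exact h (Nat.dvd_of_mem_primeFactors hq)
  have hf : p.factorization q = 0 := by
    rw [hp.factorization, Finsupp.single_apply, if_neg hqp]
  have hk : 0 < m.factorization q :=
    (Nat.prime_of_mem_primeFactors hq).factorization_pos_of_dvd hm (Nat.dvd_of_mem_primeFactors hq)
  rw [loc, hf, if_pos hk, map_one, map_one, pow_zero, one_pow, one_mul]

lemma avgTerm_natCast_nonneg (l M : ℕ) (t : ℝ) {c : ℕ} (hc : c ≠ 0) :
    0 ≤ avgTerm l M t (c : Eis ℤ) := by
  rw [avgTerm, Complex.re_sum]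
  refine Finset.sum_nonneg fun m hm => ?_
  rw [Complex.re_ofReal_mul]
  exact mul_nonneg (bump_nonneg _ _) (Complex.le_def.1 (w_natCast_nonneg (fam_mod hm).1 hc)).1

lemma exists_subset_fam {l : ℕ} (hl : l.Prime) (hl9 : l % 9 = 2) {p : ℕ} (hp : p.Prime)
    (hp3 : p ≠ 3) (hpl : p ≠ l) (J : ℕ) :
    ∃ s ⊆ fam l (8 * (9 * l ^ 2) * J), s.card = J ∧ ∀ m ∈ s, ¬ p ∣ m ∧
      5 * (8 * (9 * l ^ 2) * J) ≤ 4 * m ∧ 2 * m ≤ 3 * (8 * (9 * l ^ 2) * J) := by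
  obtain ⟨r, hr⟩ := exists_modEq_of_fam hl hl9
  have hpq : ¬ p ∣ 9 * l ^ 2 := by
    rw [hp.dvd_mul, show 9 = 3 ^ 2 by norm_num]
    rintro (h | h)
    · exact hp3 ((Nat.prime_dvd_prime_iff_eq hp Nat.prime_three).1 (hp.dvd_of_dvd_pow h))
    · exact hpl ((Nat.prime_dvd_prime_iff_eq hp hl).1 (hp.dvd_of_dvd_pow h))
  have hq0 : 0 < 9 * l ^ 2 := mul_pos (by norm_num) (pow_pos hl.pos _)
  unfold fam
  generalize hqq : 9 * l ^ 2 = q at *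
  obtain ⟨r₀, hr₀⟩ : ∃ r₀ : ℕ, (r₀ : ℤ) = r % q :=
    ⟨(r % q).toNat, Int.toNat_of_nonneg (Int.emod_nonneg _ (by positivity))⟩
  have hr₀q : r₀ < q := by
    have := Int.emod_lt_of_pos r (show (0:ℤ) < q by exact_mod_cast hq0)
    omega
  have hmod : ∀ i : ℕ, (r₀ + q * i) % 9 = 1 ∧ (r₀ + q * i) % l ^ 2 = l := by
    intro i
    rw [hr]
    push_cast
    rw [hr₀, Int.emod_def]
    exact ⟨i - r / q, by ring⟩
  set f : ℕ → ℕ := fun j =>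
    if p ∣ r₀ + q * (2 * j) then r₀ + q * (2 * j + 1) else r₀ + q * (2 * j) with hf
  have hfl : ∀ j, 2 * q * j ≤ f j ∧ f j < 2 * q * (j + 1) := by
    intro j
    have e1 : q * (2 * j) = 2 * q * j := by ring
    have e2 : q * (2 * j + 1) = 2 * q * j + q := by ring
    have e3 : 2 * q * (j + 1) = 2 * q * j + 2 * q := by ring
    simp only [hf]
    rw [e1, e2, e3]
    split_ifs <;> constructor <;> omega
  have hfinj : Function.Injective f := by
    have hdiv : ∀ j, f j / (2 * q) = j := fun j =>
      Nat.div_eq_of_lt_le (by rw [mul_comm]; exact (hfl j).1)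
        (by rw [mul_comm]; exact (hfl j).2)
    intro i j hij
    rw [← hdiv i, ← hdiv j, hij]
  have hfp : ∀ j, ¬ p ∣ f j := by
    intro j
    simp only [hf]
    split_ifs with h
    · intro h'
      apply hpq
      rw [show r₀ + q * (2 * j + 1) = r₀ + q * (2 * j) + q by ring] at h'
      exact (Nat.dvd_add_right h).1 h'
    · exact h
  have hbd : ∀ j ∈ Finset.Ico (5 * J) (6 * J),
      5 * (8 * q * J) ≤ 4 * f j ∧ 2 * f j ≤ 3 * (8 * q * J) := by
    intro j hj
    rw [Finset.mem_Ico] at hj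
    have h1 : 2 * q * (5 * J) ≤ 2 * q * j := Nat.mul_le_mul_left _ hj.1
    have h2 : 2 * q * (j + 1) ≤ 2 * q * (6 * J) := Nat.mul_le_mul_left _ hj.2
    have := hfl j
    constructor <;> nlinarith
  refine ⟨(Finset.Ico (5 * J) (6 * J)).image f, ?_, ?_, ?_⟩
  · intro m hm
    obtain ⟨j, hj, rfl⟩ := Finset.mem_image.1 hm
    have := hbd j hj
    rw [Finset.mem_filter, Finset.mem_Icc]
    refine ⟨⟨by omega, by omega⟩, ?_⟩
    simp only [hf]
    split_ifs <;> exact hmod _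
  · rw [Finset.card_image_of_injective _ hfinj, Nat.card_Ico]; omega
  · intro m hm
    obtain ⟨j, hj, rfl⟩ := Finset.mem_image.1 hm
    exact ⟨hfp j, hbd j hj⟩

lemma exists_le_avgTerm_prime {l : ℕ} (hl : l.Prime) (hl9 : l % 9 = 2) :
    ∃ κ : ℝ, 0 < κ ∧ ∀ p : ℕ, p.Prime → p ≠ 3 → p ≠ l → ∀ (J : ℕ) (t : ℝ), J ≠ 0 → 0 < t →
      t ≤ ((8 * (9 * l ^ 2) * J : ℕ) : ℝ) / (p : ℝ) ^ 2 →
      κ * ((8 * (9 * l ^ 2) * J : ℕ) : ℝ) ≤ avgTerm l (8 * (9 * l ^ 2) * J) t (p : Eis ℤ) := by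
  have hl0 := hl.pos
  have hlR : (0:ℝ) < l := by exact_mod_cast hl0
  have hr : 0 < rate 1 := rate_pos one_ne_zero
  refine ⟨Real.exp (-rate 1) / 64 / (8 * (9 * (l:ℝ) ^ 2)), by positivity, ?_⟩
  intro p hp hp3 hpl J t hJ ht htp
  obtain ⟨s, hs, hcard, hsm⟩ := exists_subset_fam hl hl9 hp hp3 hpl J
  have hM : 8 * (9 * l ^ 2) * J ≠ 0 := by positivity
  have e1 : Real.exp (-rate 1) / 64 / (8 * (9 * (l:ℝ) ^ 2)) * ((8 * (9 * l ^ 2) * J : ℕ) : ℝ) =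
      ∑ m ∈ s, Real.exp (-rate 1) / 64 := by
    rw [Finset.sum_const, hcard, nsmul_eq_mul]
    push_cast
    field_simp
  rw [e1]
  generalize 8 * (9 * l ^ 2) * J = M at *
  have hMR : (0:ℝ) < M := by exact_mod_cast Nat.pos_of_ne_zero hM
  have hpR : (0:ℝ) < p := by exact_mod_cast hp.pos
  have hnp : ((norm (p : Eis ℤ) : ℤ) : ℝ) = (p : ℝ) ^ 2 := by
    rw [norm_eq]; simp
  rw [avgTerm, Complex.re_sum]
  refine le_trans (Finset.sum_le_sum fun m hm => ?_)
    (Finset.sum_le_sum_of_subset_of_nonneg hs fun m hm _ => ?_)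
  · obtain ⟨hpm, h1, h2⟩ := hsm m hm
    have hmf := hs hm
    rw [w_prime_eq_one (fam_ne_zero hmf) hp hpm, mul_one, Complex.ofReal_re,
      bump, clamp_of_fam hM hmf, hnp]
    set x := (m : ℝ) / M with hx
    have hx1 : 5 / 4 ≤ x := by
      rw [hx, div_le_div_iff₀ (by norm_num) hMR]
      have : (5 * M : ℝ) ≤ 4 * m := by exact_mod_cast h1
      linarith
    have hx2 : x ≤ 3 / 2 := by
      rw [hx, div_le_div_iff₀ hMR (by norm_num)]
      have : (2 * m : ℝ) ≤ 3 * M := by exact_mod_cast h2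
      linarith
    have ha : rate 1 * t * (p : ℝ) ^ 2 / M ≤ rate 1 := by
      rw [div_le_iff₀ hMR, mul_assoc]
      exact mul_le_mul_of_nonneg_left ((le_div_iff₀ (by positivity)).1 htp) hr.le
    have ha0 : 0 ≤ rate 1 * t * (p : ℝ) ^ 2 / M := by positivity
    have hpoly : 1 / 8 ≤ (x - 1) * (2 - x) := by nlinarith
    calc Real.exp (-rate 1) / 64 = (1 / 8) ^ 2 * Real.exp (-rate 1) := by ring
      _ ≤ _ := by
        gcongr
        rw [neg_div, neg_le_neg_iff]
        exact (div_le_self ha0 (by linarith)).trans ha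
  · rw [Complex.re_ofReal_mul]
    exact mul_nonneg (bump_nonneg _ _)
      (Complex.le_def.1 (w_natCast_nonneg (fam_mod hm).1 hp.ne_zero)).1

end Eis

lemma exists_finset_primes_sum_ge (A : ℝ) (l : ℕ) : ∃ S : Finset ℕ,
    (∀ p ∈ S, p.Prime ∧ p ≠ 3 ∧ p ≠ l) ∧ A ≤ ∑ p ∈ S, (1 / p : ℝ) := by
  have h := not_summable_one_div_on_primes
  rw [not_summable_iff_tendsto_nat_atTop_of_nonneg
    (fun n => Set.indicator_nonneg (fun _ _ => by positivity) _)] at h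
  obtain ⟨n, hn⟩ := (h.eventually_ge_atTop (A + 2)).exists
  refine ⟨((Finset.range n).filter Nat.Prime) \ {3, l}, fun p hp => ?_, ?_⟩
  · simp only [Finset.mem_sdiff, Finset.mem_filter, Finset.mem_insert, Finset.mem_singleton,
      not_or] at hp
    exact ⟨hp.1.2, hp.2.1, hp.2.2⟩
  · have h1 : ∑ i ∈ Finset.range n, Set.indicator {p : ℕ | p.Prime} (fun n : ℕ => (1 / n : ℝ)) i =
        ∑ p ∈ (Finset.range n).filter Nat.Prime, (1 / p : ℝ) := by
      rw [Finset.sum_filter]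
      exact Finset.sum_congr rfl fun i _ => by simp [Set.indicator_apply]
    rw [h1] at hn
    have h2 : ∑ p ∈ (Finset.range n).filter Nat.Prime, (1 / p : ℝ) ≤
        ∑ p ∈ ((Finset.range n).filter Nat.Prime) \ {3, l}, (1 / p : ℝ) +
          ∑ p ∈ ({3, l} : Finset ℕ), (1 / p : ℝ) := by
      rw [← Finset.sum_union Finset.sdiff_disjoint]
      exact Finset.sum_le_sum_of_subset_of_nonneg (by
        intro x hx; by_cases h : x ∈ ({3, l} : Finset ℕ)
        · exact Finset.mem_union_right _ h
        · exact Finset.mem_union_left _ (Finset.mem_sdiff.2 ⟨hx, h⟩)) fun _ _ _ => by positivity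
    have h3 : ∑ p ∈ ({3, l} : Finset ℕ), (1 / p : ℝ) ≤ 2 := by
      calc _ ≤ ∑ p ∈ ({3, l} : Finset ℕ), (1 : ℝ) := Finset.sum_le_sum fun p _ => by
            rcases Nat.eq_zero_or_pos p with rfl | hp
            · simp
            · rw [div_le_one (by exact_mod_cast hp)]; exact_mod_cast hp
        _ ≤ 2 := by
            rw [Finset.sum_const, nsmul_eq_mul, mul_one]
            exact_mod_cast Finset.card_le_two
    linarith

namespace Eis

open MeasureTheory

lemma integral_rpow_indicator {b : ℝ} (hb : 4 ≤ b) :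
    √b ≤ ∫ t in Set.Ioi (1:ℝ), (Set.Iic b).indicator (fun t => t ^ (-1 / 2 : ℝ)) t := by
  rw [setIntegral_indicator measurableSet_Iic, Set.Ioi_inter_Iic,
    ← intervalIntegral.integral_of_le (by linarith), integral_rpow (Or.inl (by norm_num)),
    Real.one_rpow, show (-1 / 2 + 1 : ℝ) = 1 / 2 by norm_num, ← Real.sqrt_eq_rpow]
  have : 2 ≤ √b := Real.le_sqrt_of_sq_le (by linarith)
  linarith

lemma integrableOn_rpow_indicator (b : ℝ) :
    IntegrableOn (fun t => (Set.Iic b).indicator (fun t => t ^ (-1 / 2 : ℝ)) t) (Set.Ioi (1:ℝ)) := by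
  rw [IntegrableOn, integrable_indicator_iff measurableSet_Iic, IntegrableOn,
    Measure.restrict_restrict measurableSet_Iic, Set.inter_comm, Set.Ioi_inter_Iic]
  refine (ContinuousOn.integrableOn_Icc ?_).mono_set Set.Ioc_subset_Icc_self
  exact ContinuousOn.rpow_const continuousOn_id fun x hx => Or.inl
    (by linarith [hx.1] : (0:ℝ) < x).ne'

/-- Some field in the family has a positive central `L`-value. -/
theorem exists_good_integral_pos {l : ℕ} (hl : l.Prime) (hl9 : l % 9 = 2) :
    ∃ m, Good l m ∧ 0 < ∫ t in Set.Ioi (1:ℝ), t ^ (-1 / 2 : ℝ) * (wTheta m t).re := by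
  obtain ⟨C, hC, H⟩ := exists_le_thetaAvg hl hl9
  obtain ⟨κ, hκ, HM⟩ := exists_le_avgTerm_prime hl hl9
  obtain ⟨S, hS, hA⟩ := exists_finset_primes_sum_ge (C / κ) l
  obtain ⟨J, hJ0, hJ⟩ : ∃ J : ℕ, J ≠ 0 ∧ ∀ p ∈ S, 4 * p ^ 2 ≤ J := by
    refine ⟨∑ p ∈ S, 4 * p ^ 2 + 1, by omega, fun p hp => ?_⟩
    have := Finset.single_le_sum (f := fun p : ℕ => 4 * p ^ 2) (fun _ _ => Nat.zero_le _) hp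
    omega
  replace HM := fun p hp hp3 hpl t => HM p hp hp3 hpl J t hJ0
  have hJM : J ≤ 8 * (9 * l ^ 2) * J := Nat.le_mul_of_pos_left _ (by have := hl.pos; positivity)
  generalize 8 * (9 * l ^ 2) * J = M at *
  have hM : M ≠ 0 := by omega
  have hMR : (0:ℝ) < M := by exact_mod_cast Nat.pos_of_ne_zero hM
  by_contra! hcon
  have hInt : ∀ m ∈ fam l M, IntegrableOn
      (fun t => bumpWeight M m * (t ^ (-1 / 2 : ℝ) * (wTheta m t).re)) (Set.Ioi (1:ℝ)) := by
    intro m hm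
    have hg := good_of_mod hl (fam_mod hm).1 (fam_mod hm).2
    exact ((integrableOn_wTheta (fam_ne_zero hm) (hg.w_zero hl hl9)).mono_set
      (Set.Ioi_subset_Ioi zero_le_one)).const_mul _
  have heq : ∀ t : ℝ, t ^ (-1 / 2 : ℝ) * thetaAvg l M t =
      ∑ m ∈ fam l M, bumpWeight M m * (t ^ (-1 / 2 : ℝ) * (wTheta m t).re) := by
    intro t
    rw [thetaAvg, Finset.mul_sum]
    exact Finset.sum_congr rfl fun _ _ => by ring
  have hle : ∫ t in Set.Ioi (1:ℝ), t ^ (-1 / 2 : ℝ) * thetaAvg l M t ≤ 0 := by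
    simp only [heq]
    rw [integral_finsetSum _ hInt]
    refine Finset.sum_nonpos fun m hm => ?_
    rw [integral_const_mul]
    exact mul_nonpos_of_nonneg_of_nonpos (bumpWeight_nonneg _ _)
      (hcon m (good_of_mod hl (fam_mod hm).1 (fam_mod hm).2))
  have hintT : IntegrableOn (fun t => t ^ (-1 / 2 : ℝ) * thetaAvg l M t) (Set.Ioi (1:ℝ)) := by
    simp only [heq]
    exact integrable_finsetSum _ hInt
  have hinj : Function.Injective ((↑) : ℕ → Eis ℤ) := Nat.cast_injective
  set E : ℝ := C * (M : ℝ) ^ (3 / 2 : ℝ) with hE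
  have hint1 : ∀ p ∈ S, IntegrableOn (fun t => κ * M *
      (Set.Iic ((M : ℝ) / (p : ℝ) ^ 2)).indicator (fun t => t ^ (-1 / 2 : ℝ)) t) (Set.Ioi (1:ℝ)) :=
    fun p _ => (integrableOn_rpow_indicator _).const_mul _
  have hint2 : IntegrableOn (fun t : ℝ => E * t ^ (-3 : ℝ)) (Set.Ioi (1:ℝ)) :=
    (integrableOn_Ioi_rpow_of_lt (by norm_num) one_pos).const_mul _
  have hpt : ∀ t ∈ Set.Ioi (1:ℝ), ∑ p ∈ S, κ * M *
      (Set.Iic ((M : ℝ) / (p : ℝ) ^ 2)).indicator (fun t => t ^ (-1 / 2 : ℝ)) t - E * t ^ (-3 : ℝ) ≤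
      t ^ (-1 / 2 : ℝ) * thetaAvg l M t := by
    intro t ht
    have ht0 : (0:ℝ) < t := lt_trans one_pos ht
    have h1 := H M t (S.map ⟨((↑) : ℕ → Eis ℤ), hinj⟩)
      (fun α =>
        if t ≤ (M : ℝ) / ((α.re : ℤ) : ℝ) ^ 2 then κ * M else 0) hM (le_of_lt ht) ?_
    · rw [Finset.sum_map] at h1
      calc _ = t ^ (-1 / 2 : ℝ) * (∑ p ∈ S, κ * M *
            (Set.Iic ((M : ℝ) / (p : ℝ) ^ 2)).indicator (fun _ => 1) t -
              E * t ^ (-(5 / 2) : ℝ)) := by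
            rw [mul_sub, Finset.mul_sum]
            congr 1
            · refine Finset.sum_congr rfl fun p _ => ?_
              simp only [Set.indicator_apply]
              split_ifs <;> ring
            · rw [mul_left_comm, ← Real.rpow_add ht0]
              norm_num
        _ ≤ _ := by
            refine mul_le_mul_of_nonneg_left (le_trans (le_of_eq ?_) h1) (by positivity)
            congr 1
            refine Finset.sum_congr rfl fun p hp => ?_
            have hp0 := (hS p hp).1.pos
            have hre : ((p : ℕ) : Eis ℤ).re = p := by simp
            simp only [Function.Embedding.coeFn_mk, hre, Set.indicator_apply, Set.mem_Iic]
            simp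
    · intro α hα
      obtain ⟨p, hp, rfl⟩ := Finset.mem_map.1 hα
      have hp0 := (hS p hp).1.pos
      have hre : ((p : ℕ) : Eis ℤ).re = p := by simp
      simp only [Function.Embedding.coeFn_mk, hre]
      split_ifs with h
      · exact HM p (hS p hp).1 (hS p hp).2.1 (hS p hp).2.2 t ht0 (by simpa using h)
      · exact avgTerm_natCast_nonneg l M t hp0.ne'
  have hmono := setIntegral_mono_on ((integrable_finsetSum _ hint1).sub hint2) hintT
    measurableSet_Ioi hpt
  simp only [Pi.sub_apply] at hmono
  rw [integral_sub (integrable_finsetSum _ hint1) hint2, integral_finsetSum _ hint1,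
    integral_const_mul, integral_Ioi_rpow_of_lt (by norm_num) one_pos] at hmono
  have hlow : κ * (M : ℝ) ^ (3 / 2 : ℝ) * (C / κ) ≤ ∑ p ∈ S, ∫ t in Set.Ioi (1:ℝ), κ * M *
      (Set.Iic ((M : ℝ) / (p : ℝ) ^ 2)).indicator (fun t => t ^ (-1 / 2 : ℝ)) t := by
    calc _ ≤ κ * (M : ℝ) ^ (3 / 2 : ℝ) * ∑ p ∈ S, (1 / p : ℝ) := by gcongr
      _ = ∑ p ∈ S, κ * M * √((M : ℝ) / (p : ℝ) ^ 2) := by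
          rw [Finset.mul_sum]
          refine Finset.sum_congr rfl fun p _ => ?_
          rw [Real.sqrt_div hMR.le, Real.sqrt_sq (by positivity),
            show (3 / 2 : ℝ) = 1 + 1 / 2 by norm_num, Real.rpow_add hMR, Real.rpow_one,
            Real.sqrt_eq_rpow]
          ring
      _ ≤ _ := by
          refine Finset.sum_le_sum fun p hp => ?_
          rw [integral_const_mul]
          refine mul_le_mul_of_nonneg_left (integral_rpow_indicator ?_) (by positivity)
          have hp0 := (hS p hp).1.pos
          rw [le_div_iff₀ (by positivity)]
          exact_mod_cast (hJ p hp).trans hJM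
  have hfin : E * (-1 ^ (-3 + 1 : ℝ) / (-3 + 1)) = E / 2 := by
    rw [Real.one_rpow]; ring
  have hE0 : 0 < E := by positivity
  have hlow' : κ * (M : ℝ) ^ (3 / 2 : ℝ) * (C / κ) = E := by rw [hE]; field_simp
  linarith

end Eis

/-- Removing the multiples of a prime from a Dirichlet series. -/
lemma tsum_ite_range_eq {A : Type*} {f : A → ℂ} (hf : Summable f) {φ : A → A}
    (hφ : Function.Injective φ) {v : ℂ} (hv : ∀ a, f (φ a) = v * f a) :
    ∑' a, (if a ∈ Set.range φ then 0 else f a) = (1 - v) * ∑' a, f a := by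
  have h1 : ∑' a, Set.indicator (Set.range φ) f a = v * ∑' a, f a := by
    rw [← tsum_subtype, tsum_range f hφ, ← tsum_mul_left]
    exact tsum_congr hv
  have h2 : (fun a => if a ∈ Set.range φ then 0 else f a) =
      fun a => f a - Set.indicator (Set.range φ) f a := by
    funext a
    rw [Set.indicator_apply]
    split_ifs <;> simp
  rw [h2, hf.tsum_sub (hf.indicator _), h1]
  ring

namespace Eis

/-- The Dirichlet series `∑ V(α) N(α)^{-s}`. -/
def dser (V : Eis ℤ → ℂ) (s : ℂ) : ℂ := ∑' α : Eis ℤ, V α * ((norm α : ℤ) : ℂ) ^ (-s)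

lemma norm_natAbs_cast (α : Eis ℤ) : ((norm α : ℤ) : ℂ) = ((norm α).natAbs : ℂ) := by
  rw [← Int.cast_natCast, Int.natAbs_of_nonneg (Eis.norm_nonneg α)]

lemma norm_term_eq {s : ℂ} (hs : 2 ≤ s.re) (α : Eis ℤ) :
    ‖((norm α : ℤ) : ℂ) ^ (-s)‖ = ((norm α : ℤ) : ℝ) ^ (-s.re) := by
  rw [show ((norm α : ℤ) : ℂ) = (((norm α : ℤ) : ℝ) : ℂ) by push_cast; rfl,
    Complex.norm_cpow_eq_rpow_re_of_nonneg (by exact_mod_cast Eis.norm_nonneg α)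
      (by rw [Complex.neg_re]; linarith), Complex.neg_re]

lemma summable_dser {V : Eis ℤ → ℂ} {B : ℝ} (hV : ∀ α, ‖V α‖ ≤ B) {s : ℂ} (hs : 2 ≤ s.re) :
    Summable fun α : Eis ℤ => V α * ((norm α : ℤ) : ℂ) ^ (-s) := by
  refine Summable.of_norm_bounded ((summable_norm_rpow hs).mul_left B) fun α => ?_
  rw [_root_.norm_mul, norm_term_eq hs]
  gcongr
  · exact Real.rpow_nonneg (by exact_mod_cast Eis.norm_nonneg α) _
  · exact hV α

lemma norm_mul_cpow (β α : Eis ℤ) (s : ℂ) : ((norm (β * α) : ℤ) : ℂ) ^ (-s) =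
    ((norm β : ℤ) : ℂ) ^ (-s) * ((norm α : ℤ) : ℂ) ^ (-s) := by
  rw [map_mul, Int.cast_mul, norm_natAbs_cast, norm_natAbs_cast, Complex.natCast_mul_natCast_cpow]

lemma dser_ite_dvd {V : Eis ℤ → ℂ} {B : ℝ} (hV : ∀ α, ‖V α‖ ≤ B) {s : ℂ} (hs : 2 ≤ s.re)
    {β : Eis ℤ} (hβ : β ≠ 0) {v : ℂ} (hv : ∀ α, V (β * α) = v * V α) :
    dser (fun α => if β ∣ α then 0 else V α) s =
      (1 - v * ((norm β : ℤ) : ℂ) ^ (-s)) * dser V s := by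
  rw [dser, dser, ← tsum_ite_range_eq (summable_dser hV hs) (φ := fun α => β * α)
    (mul_right_injective₀ hβ) (fun α => ?_)]
  · refine tsum_congr fun α => ?_
    have : α ∈ Set.range (fun α => β * α) ↔ β ∣ α :=
      ⟨fun ⟨x, hx⟩ => ⟨x, hx.symm⟩, fun ⟨x, hx⟩ => ⟨x, hx.symm⟩⟩
    simp only [this]
    split_ifs <;> simp
  · simp only [hv, norm_mul_cpow]
    ring

/-- A prime of the Eisenstein integers above `p`. -/
def primeAbove (p : ℕ) : Eis ℤ :=
  if h : p.Prime ∧ p % 3 = 1 then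
    haveI := Fact.mk h.1
    (exists_char_of_split h.2).choose
  else if p = 3 then lam else p

lemma primeAbove_spec {p : ℕ} [hp : Fact p.Prime] (h1 : p % 3 = 1) :
    ∃ χ : MulChar (ZMod p) ℂ, norm (primeAbove p) = p ∧
      orderOf χ = 3 ∧ ∀ q : ℕ, q.Prime → q ≠ 3 → cubicChar q (red q (primeAbove p)) = χ q := by
  rw [primeAbove, dif_pos ⟨hp.1, h1⟩]
  obtain ⟨χ, h, -, h2, h3⟩ := (exists_char_of_split h1).choose_spec
  exact ⟨χ, h, h2, h3⟩

/-- The local factor at `p` of the Dirichlet series of a completely multiplicative function. -/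
def eulerFactor (X : Eis ℤ → ℂ) (p : ℕ) (s : ℂ) : ℂ :=
  if p % 3 = 1 then
    (1 - X (primeAbove p) * (p : ℂ) ^ (-s)) * (1 - X (star (primeAbove p)) * (p : ℂ) ^ (-s))
  else if p = 3 then 1 - X lam * (3 : ℂ) ^ (-s)
  else 1 - X p * ((p ^ 2 : ℕ) : ℂ) ^ (-s)

lemma dvd_of_dvd_star_mul {p : ℕ} (hp : p.Prime) (h1 : p % 3 = 1) {π α : Eis ℤ} (hπ : norm π = p)
    (h : π ∣ star π * α) : π ∣ α := by
  have hpz : Prime (p : ℤ) := Nat.prime_iff_prime_int.1 hp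
  have ht : ¬ (p : ℤ) ∣ 2 * π.re - π.im := by
    intro ht
    have hn := norm_eq π
    rw [hπ] at hn
    have h3 : (p : ℤ) ∣ 3 * π.im ^ 2 := by
      obtain ⟨c, hc⟩ := ht
      exact ⟨4 - c * (2 * π.re - π.im), by linear_combination (-4) * hn - (2 * π.re - π.im) * hc⟩
    have hb : (p : ℤ) ∣ π.im := by
      rcases hpz.dvd_or_dvd h3 with h | h
      · have h' : p ∣ 3 := by exact_mod_cast h
        have := (Nat.prime_dvd_prime_iff_eq hp Nat.prime_three).1 h'
        omega
      · exact hpz.dvd_of_dvd_pow h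
    obtain ⟨c, hc⟩ := ht
    obtain ⟨b, hb⟩ := hb
    have h4 : (p : ℤ) * (p * (c ^ 2 + 3 * b ^ 2)) = p * 4 := by
      rw [hb] at hn hc
      linear_combination (-4) * hn - (2 * π.re - p * b + p * c) * hc
    have h5 : p ∣ 4 := by
      have := mul_left_cancel₀ hpz.ne_zero h4
      exact_mod_cast Dvd.intro _ this
    have h6 : p ∣ 2 := hp.dvd_of_dvd_pow (show p ∣ 2 ^ 2 from h5)
    have := (Nat.prime_dvd_prime_iff_eq hp Nat.prime_two).1 h6
    omega
  obtain ⟨u, v, huv⟩ := (Prime.coprime_iff_not_dvd hpz).2 ht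
  have hs : star π = ((2 * π.re - π.im : ℤ) : Eis ℤ) - π := by
    ext <;> simp <;> ring
  have hps : ((p : ℤ) : Eis ℤ) = π * star π := by rw [mul_star_self, hπ]; simp
  have : α = ((u * p + v * (2 * π.re - π.im) : ℤ) : Eis ℤ) * α := by rw [huv]; simp
  rw [this]
  push_cast at hps hs ⊢
  rw [hps, show (2 * (π.re : Eis ℤ) - π.im) = star π + π by rw [hs]; ring]
  obtain ⟨z, hz⟩ := h
  exact ⟨u * star π * α + v * (z + α), by linear_combination v * hz⟩

lemma dser_ite_norm {V : Eis ℤ → ℂ} {B : ℝ} (hV : ∀ α, ‖V α‖ ≤ B) {s : ℂ} (hs : 2 ≤ s.re)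
    {p : ℕ} (hp : p.Prime) {X : Eis ℤ → ℂ}
    (hX : ∀ β : Eis ℤ, (norm β = p ∨ norm β = p ^ 2) → ∀ α, V (β * α) = X β * V α) :
    dser (fun α => if (p : ℤ) ∣ norm α then 0 else V α) s = eulerFactor X p s * dser V s := by
  have hpz : (p : ℤ) ≠ 0 := by exact_mod_cast hp.ne_zero
  have hnz : ∀ {β : Eis ℤ}, norm β = p → β ≠ 0 := by
    rintro β h rfl
    rw [QuadraticAlgebra.norm_zero] at h
    exact hpz h.symm
  rw [eulerFactor]
  split_ifs with h1 h3
  · have := Fact.mk hp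
    obtain ⟨-, hN, -⟩ := primeAbove_spec h1
    generalize primeAbove p = π at *
    have hN' : norm (star π) = p := by rw [QuadraticAlgebra.norm_star, hN]
    have e1 := dser_ite_dvd hV hs (hnz hN) (hX π (Or.inl hN))
    have hV' : ∀ α, ‖(fun α => if π ∣ α then 0 else V α) α‖ ≤ B := by
      intro α
      dsimp only
      split_ifs
      · rw [_root_.norm_zero]; exact (_root_.norm_nonneg _).trans (hV 0)
      · exact hV α
    have e2 := dser_ite_dvd hV' hs (hnz hN') (v := X (star π)) (fun α => by
      have : π ∣ star π * α ↔ π ∣ α := ⟨dvd_of_dvd_star_mul hp h1 hN, fun h => h.mul_left _⟩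
      simp only [this, hX _ (Or.inl hN')]
      split_ifs <;> simp)
    rw [e1, hN, hN'] at e2
    rw [show dser (fun α => if (p : ℤ) ∣ norm α then 0 else V α) s =
      dser (fun α => if star π ∣ α then 0 else if π ∣ α then 0 else V α) s from ?_, e2]
    · push_cast; ring
    · congr 1
      funext α
      have : (p : ℤ) ∣ norm α ↔ star π ∣ α ∨ π ∣ α := by
        constructor
        · intro h
          exact (dvd_or_star_dvd_of_dvd_norm hp hN h).symm
        · rintro (h | h)
          · rw [← hN']; exact map_dvd _ h
          · rw [← hN]; exact map_dvd _ h
      simp only [this]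
      split_ifs <;> first | rfl | tauto
  · subst h3
    have e1 := dser_ite_dvd hV hs (hnz (by rw [norm_lam]; rfl)) (hX lam (Or.inl norm_lam))
    rw [norm_lam] at e1
    have : ∀ α : Eis ℤ, ((3 : ℕ) : ℤ) ∣ norm α ↔ lam ∣ α := fun α =>
      ⟨dvd_lam_of_norm, fun h => by
        have := map_dvd QuadraticAlgebra.norm h
        rw [norm_lam] at this
        exact_mod_cast this⟩
    simp only [this, e1]
    norm_num
  · have h2 : p % 3 = 2 := by
      have : ¬ 3 ∣ p := fun h => h3 ((Nat.prime_dvd_prime_iff_eq Nat.prime_three hp).1 h).symm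
      omega
    have hN : norm (p : Eis ℤ) = p ^ 2 := by
      rw [norm_eq]; simp
    have e1 := dser_ite_dvd hV hs (by exact_mod_cast hp.ne_zero) (hX p (Or.inr hN))
    have : ∀ α : Eis ℤ, (p : ℤ) ∣ norm α ↔ (p : Eis ℤ) ∣ α := fun α =>
      ⟨natCast_dvd_of_dvd_norm hp h2, fun h => by
        have := map_dvd QuadraticAlgebra.norm h
        rw [hN] at this
        exact (dvd_pow_self _ two_ne_zero).trans this⟩
    simp only [this, e1, hN]
    norm_num

end Eis

open scoped ComplexOrder in
/-- Entire functions taking a positive real value at `1/2`. -/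
structure EntirePosHalf (R : ℂ → ℂ) : Prop where
  differentiable : Differentiable ℂ R
  pos : 0 < R (1 / 2)

open scoped ComplexOrder in
lemma EntirePosHalf.mul {R Q : ℂ → ℂ} (hR : EntirePosHalf R) (hQ : EntirePosHalf Q) :
    EntirePosHalf fun s => R s * Q s :=
  ⟨hR.1.mul hQ.1, mul_pos hR.2 hQ.2⟩

open scoped ComplexOrder in
lemma EntirePosHalf.one : EntirePosHalf fun _ => 1 :=
  ⟨differentiable_const _, zero_lt_one⟩

lemma EntirePosHalf.prod {ι : Type*} (S : Finset ι) {R : ι → ℂ → ℂ}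
    (h : ∀ i ∈ S, EntirePosHalf (R i)) : EntirePosHalf fun s => ∏ i ∈ S, R i s := by
  induction S using Finset.induction_on with
  | empty => simpa using EntirePosHalf.one
  | insert i S hi ih =>
    simp only [Finset.prod_insert hi]
    exact (h i (Finset.mem_insert_self _ _)).mul
      (ih fun j hj => h j (Finset.mem_insert_of_mem hj))

lemma differentiable_natCast_cpow_neg {n : ℕ} (hn : n ≠ 0) :
    Differentiable ℂ fun s : ℂ => (n : ℂ) ^ (-s) :=
  fun s => (differentiableAt_id.neg).const_cpow (Or.inl (by exact_mod_cast hn))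

lemma natCast_cpow_neg_half (n : ℕ) :
    (n : ℂ) ^ (-(1 / 2 : ℂ)) = (((n : ℝ) ^ (-(1 / 2 : ℝ)) : ℝ) : ℂ) := by
  rw [Complex.ofReal_cpow (Nat.cast_nonneg n)]
  push_cast
  rfl

lemma natCast_rpow_neg_half_lt_one {n : ℕ} (hn : 1 < n) : (n : ℝ) ^ (-(1 / 2 : ℝ)) < 1 :=
  Real.rpow_lt_one_of_one_lt_of_neg (by exact_mod_cast hn) (by norm_num)

open scoped ComplexOrder in
/-- The typical local factor attached to a prime of degree one. -/
lemma EntirePosHalf.one_sub_natCast_cpow {n : ℕ} (hn : 1 < n) :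
    EntirePosHalf fun s => 1 - (n : ℂ) ^ (-s) := by
  refine ⟨(differentiable_const _).sub (differentiable_natCast_cpow_neg (by omega)), ?_⟩
  rw [natCast_cpow_neg_half]
  have := natCast_rpow_neg_half_lt_one hn
  exact_mod_cast sub_pos.2 this

namespace Eis

lemma eulerFactor_entirePosHalf {X : Eis ℤ → ℂ} {p : ℕ} (hp : p.Prime) (h3 : p ≠ 3)
    (hX : ∀ β, X (star β) = (starRingEnd ℂ) (X β)) (hX1 : ∀ β, ‖X β‖ ≤ 1)
    (hXr : X p = 1) : EntirePosHalf (eulerFactor X p) := by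
  have hE : eulerFactor X p = fun s => eulerFactor X p s := rfl
  simp only [eulerFactor, if_neg h3] at hE
  rw [hE]
  split_ifs with h1
  · constructor
    · exact ((differentiable_const _).sub ((differentiable_natCast_cpow_neg
        hp.ne_zero).const_mul _)).mul ((differentiable_const _).sub
        ((differentiable_natCast_cpow_neg hp.ne_zero).const_mul _))
    · rw [natCast_cpow_neg_half, hX]
      set z := X (primeAbove p)
      set q := (p : ℝ) ^ (-(1 / 2 : ℝ))
      have hq : q < 1 := natCast_rpow_neg_half_lt_one hp.one_lt
      have hq0 : 0 ≤ q := by positivity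
      have e : (1 - z * (q : ℂ)) * (1 - (starRingEnd ℂ) z * (q : ℂ)) =
          ((Complex.normSq (1 - z * q) : ℝ) : ℂ) := by
        rw [← Complex.mul_conj]; simp
      rw [e]
      have : 1 - z * q ≠ 0 := by
        intro h
        have h2 : ‖z * q‖ = 1 := by rw [← sub_eq_zero.1 h]; simp
        rw [_root_.norm_mul, Complex.norm_real, Real.norm_of_nonneg hq0] at h2
        nlinarith [hX1 (primeAbove p), _root_.norm_nonneg (X (primeAbove p))]
      exact_mod_cast Complex.normSq_pos.2 this
  · simpa [hXr] using EntirePosHalf.one_sub_natCast_cpow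
      (show 1 < p ^ 2 from Nat.one_lt_pow two_ne_zero hp.one_lt)

/-- The contribution of the multiples of `β`. -/
lemma tsum_ite_dvd {V : Eis ℤ → ℂ} {s : ℂ} {β : Eis ℤ} (hβ : β ≠ 0) :
    dser (fun α => if β ∣ α then V α else 0) s =
      ((norm β : ℤ) : ℂ) ^ (-s) * dser (fun α => V (β * α)) s := by
  have h : (fun α => (if β ∣ α then V α else 0) * ((norm α : ℤ) : ℂ) ^ (-s)) =
      Set.indicator (Set.range (β * ·)) fun α => V α * ((norm α : ℤ) : ℂ) ^ (-s) := by
    funext α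
    have : α ∈ Set.range (fun α => β * α) ↔ β ∣ α :=
      ⟨fun ⟨x, hx⟩ => ⟨x, hx.symm⟩, fun ⟨x, hx⟩ => ⟨x, hx.symm⟩⟩
    rw [Set.indicator_apply]
    simp only [this]
    split_ifs <;> simp
  rw [dser, h, ← tsum_subtype (Set.range (β * ·)) fun α => V α * ((norm α : ℤ) : ℂ) ^ (-s),
    tsum_range (fun α => V α * ((norm α : ℤ) : ℂ) ^ (-s)) (mul_right_injective₀ hβ), dser,
    ← tsum_mul_left]
  refine tsum_congr fun α => ?_
  rw [norm_mul_cpow]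
  ring

lemma dser_add {V W : Eis ℤ → ℂ} {B C : ℝ} (hV : ∀ α, ‖V α‖ ≤ B) (hW : ∀ α, ‖W α‖ ≤ C) {s : ℂ}
    (hs : 2 ≤ s.re) : dser (fun α => V α + W α) s = dser V s + dser W s := by
  rw [dser, dser, dser, ← (summable_dser hV hs).tsum_add (summable_dser hW hs)]
  exact tsum_congr fun α => by ring

lemma dser_const_mul (c : ℂ) (V : Eis ℤ → ℂ) (s : ℂ) :
    dser (fun α => c * V α) s = c * dser V s := by
  rw [dser, dser, ← tsum_mul_left]
  exact tsum_congr fun α => by ring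

lemma norm_cubicChar_le (p : ℕ) (x : Eis (ZMod p)) : ‖cubicChar p x‖ ≤ 1 := by
  by_cases h : IsUnit x
  · exact (cubicChar_norm h).le
  · rw [MulChar.map_nonunit _ h, _root_.norm_zero]; exact zero_le_one

open scoped ComplexOrder in
lemma exists_dser_w_prime_pow {p k : ℕ} (hp : p.Prime) (hk : k ≠ 0) {v : Eis ℤ → ℂ} {B : ℝ}
    (hv : ∀ α, ‖v α‖ ≤ B) (hvp : ∀ α, v (p * α) = v α) :
    ∃ P Q : ℂ → ℂ, EntirePosHalf P ∧ EntirePosHalf Q ∧ ∀ s : ℂ, 2 ≤ s.re →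
      dser (fun α => w (p ^ k) α * v α) s =
        P s * dser (fun α => cubicChar p (red p α) ^ k * v α) s + kap p k * Q s * dser v s := by
  have hpk : p ^ k ≠ 0 := pow_ne_zero _ hp.ne_zero
  have hB : 0 ≤ B := (_root_.norm_nonneg _).trans (hv 0)
  have hb : ∀ β α, ‖w (p ^ k) (β * α) * v α‖ ≤ ((p ^ k : ℕ) * (p ^ k : ℕ) : ℝ) * B := by
    intro β α
    rw [_root_.norm_mul]
    gcongr
    · exact norm_w_le hpk _
    · exact hv α
  have key : ∀ j ≤ k, ∃ P Q : ℂ → ℂ, (Differentiable ℂ P ∧ 0 ≤ P (1 / 2) ∧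
      (j < k → 0 < P (1 / 2))) ∧ EntirePosHalf Q ∧ ∀ s : ℂ, 2 ≤ s.re →
      dser (fun α => w (p ^ k) (((p ^ j : ℕ) : Eis ℤ) * α) * v α) s =
        P s * dser (fun α => cubicChar p (red p α) ^ k * v α) s + kap p k * Q s * dser v s := by
    intro j hj
    induction hj using Nat.decreasingInduction with
    | self =>
      refine ⟨fun _ => 0, fun _ => 1, ⟨differentiable_const _, le_rfl, fun h => absurd h
        (lt_irrefl _)⟩, EntirePosHalf.one, fun s hs => ?_⟩
      simp only [w_prime_pow_of_dvd (dvd_mul_right _ _), dser_const_mul]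
      ring
    | of_succ j hj ih =>
      obtain ⟨P, Q, ⟨hP, hP0, -⟩, hQ, h⟩ := ih
      have hp2 : p ^ 2 ≠ 0 := pow_ne_zero _ hp.ne_zero
      have hd := differentiable_natCast_cpow_neg hp2
      have hpos : 0 < ((p ^ 2 : ℕ) : ℂ) ^ (-(1 / 2 : ℂ)) := by
        rw [natCast_cpow_neg_half]
        have : (0 : ℝ) < ((p ^ 2 : ℕ) : ℝ) ^ (-(1 / 2 : ℝ)) :=
          Real.rpow_pos_of_pos (by exact_mod_cast hp2.bot_lt) _
        exact_mod_cast this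
      have hpj : (0 : ℂ) < (p : ℂ) ^ j := by
        have : (0 : ℝ) < (p : ℝ) ^ j := pow_pos (by exact_mod_cast hp.pos) _
        exact_mod_cast this
      have h1 : 0 < (p : ℂ) ^ j + ((p ^ 2 : ℕ) : ℂ) ^ (-(1 / 2 : ℂ)) * P (1 / 2) :=
        add_pos_of_pos_of_nonneg hpj (mul_nonneg hpos.le hP0)
      refine ⟨fun s => (p : ℂ) ^ j + ((p ^ 2 : ℕ) : ℂ) ^ (-s) * P s,
        fun s => ((p ^ 2 : ℕ) : ℂ) ^ (-s) * Q s,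
        ⟨(differentiable_const _).add (hd.mul hP), h1.le, fun _ => h1⟩,
        ⟨hd.mul hQ.1, mul_pos hpos hQ.2⟩, fun s hs => ?_⟩
      have e : (fun α => w (p ^ k) (((p ^ j : ℕ) : Eis ℤ) * α) * v α) = fun α =>
          (p : ℂ) ^ j * (cubicChar p (red p α) ^ k * v α) +
          if (p : Eis ℤ) ∣ α then w (p ^ k) (((p ^ j : ℕ) : Eis ℤ) * α) * v α else 0 := by
        funext α
        split_ifs with hα
        · rw [MulChar.map_nonunit, zero_pow hk, zero_mul, mul_zero, zero_add]
          rw [isUnit_red_iff hp, not_not]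
          have := map_dvd QuadraticAlgebra.norm hα
          rw [show QuadraticAlgebra.norm (p : Eis ℤ) = (p : ℤ) ^ 2 by rw [norm_eq]; simp] at this
          exact (dvd_pow_self _ two_ne_zero).trans this
        · rw [w_prime_pow hp hj hα, add_zero, mul_assoc]
      rw [e, dser_add (B := (p : ℝ) ^ j * B) (C := ((p ^ k : ℕ) * (p ^ k : ℕ) : ℝ) * B) ?_ ?_ hs,
        dser_const_mul, tsum_ite_dvd (by exact_mod_cast hp.ne_zero)]
      · have e2 : (fun α => w (p ^ k) (((p ^ j : ℕ) : Eis ℤ) * ((p : Eis ℤ) * α)) *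
            v ((p : Eis ℤ) * α)) =
            fun α => w (p ^ k) (((p ^ (j + 1) : ℕ) : Eis ℤ) * α) * v α := by
          funext α
          rw [hvp, ← mul_assoc, pow_succ, Nat.cast_mul]
        rw [e2, h s hs, show QuadraticAlgebra.norm (p : Eis ℤ) = ((p ^ 2 : ℕ) : ℤ) by
          rw [norm_eq]; simp, Int.cast_natCast]
        ring
      · intro α
        rw [_root_.norm_mul, _root_.norm_mul, _root_.norm_pow, _root_.norm_pow, Complex.norm_natCast]
        gcongr
        calc _ ≤ 1 * ‖v α‖ := by
              gcongr
              exact pow_le_one₀ (_root_.norm_nonneg _) (norm_cubicChar_le _ _)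
          _ ≤ B := by rw [one_mul]; exact hv α
      · intro α
        split_ifs
        · exact hb _ _
        · rw [_root_.norm_zero]; positivity
  obtain ⟨P, Q, ⟨hP, -, hP0⟩, hQ, h⟩ := key 0 (Nat.zero_le _)
  refine ⟨P, Q, ⟨hP, hP0 (Nat.pos_of_ne_zero hk)⟩, hQ, fun s hs => ?_⟩
  simpa using h s hs

lemma cubicChar_pow_eq_one_of_kap_ne_zero {p k : ℕ} (hp : p.Prime) (hk : k ≠ 0)
    (h : kap p k ≠ 0) {β : Eis ℤ} (hβ : IsUnit (red p β)) : cubicChar p (red p β) ^ k = 1 := by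
  have hpk : p ^ k ≠ 0 := pow_ne_zero _ hp.ne_zero
  have hβ' : IsUnit (red (p ^ k) β) := by
    rw [isUnit_prime_pow_iff hp hk, redTo_red]; exact hβ
  have h1 := w_mul_of_isUnit hpk hβ' 0
  rw [mul_zero, chi_prime_pow hp hk, redTo_red] at h1
  exact (mul_right_cancel₀ h (by rw [one_mul]; exact h1)).symm

open scoped ComplexOrder in
lemma exists_dser_w_eq_dser_chi {p k : ℕ} (hp : p.Prime) (h3 : p ≠ 3) (hk : k ≠ 0)
    {v : Eis ℤ → ℂ} {B : ℝ} (hv : ∀ α, ‖v α‖ ≤ B) {X : Eis ℤ → ℂ}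
    (hX : ∀ β : Eis ℤ, (norm β = p ∨ norm β = p ^ 2) → ∀ α, v (β * α) = X β * v α)
    (hXs : ∀ β, X (star β) = (starRingEnd ℂ) (X β)) (hX1 : ∀ β, ‖X β‖ ≤ 1) (hXp : X p = 1) :
    ∃ R Q : ℂ → ℂ, EntirePosHalf R ∧ EntirePosHalf Q ∧ ∀ s : ℂ, 2 ≤ s.re →
      R s * dser (fun α => w (p ^ k) α * v α) s =
        Q s * dser (fun α => cubicChar p (red p α) ^ k * v α) s := by
  obtain ⟨P, Q, hP, hQ, h⟩ := exists_dser_w_prime_pow hp hk hv fun α => by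
    rw [hX p (Or.inr (by rw [norm_eq]; simp)), hXp, one_mul]
  by_cases hkap : kap p k = 0
  · refine ⟨fun _ => 1, P, EntirePosHalf.one, hP, fun s hs => ?_⟩
    rw [h s hs, hkap]
    ring
  · have hE := eulerFactor_entirePosHalf hp h3 hXs hX1 hXp
    refine ⟨eulerFactor X p, fun s => eulerFactor X p s * P s + kap p k * Q s, hE,
      ⟨(hE.1.mul hP.1).add (hQ.1.const_mul _), add_pos_of_pos_of_nonneg (mul_pos hE.2 hP.2)
        (mul_nonneg (kap_nonneg p hp k) hQ.2.le)⟩, fun s hs => ?_⟩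
    have e : (fun α => cubicChar p (red p α) ^ k * v α) =
        fun α => if (p : ℤ) ∣ norm α then 0 else v α := by
      funext α
      split_ifs with hα
      · rw [MulChar.map_nonunit, zero_pow hk, zero_mul]
        rw [isUnit_red_iff hp]; exact not_not.2 hα
      · rw [cubicChar_pow_eq_one_of_kap_ne_zero hp hk hkap ((isUnit_red_iff hp α).2 hα), one_mul]
    rw [h s hs, e, dser_ite_norm hv hs hp hX]
    ring

lemma norm_chi_le {m : ℕ} (hm : m ≠ 0) (x : Eis (ZMod m)) : ‖chi m x‖ ≤ 1 := by
  by_cases h : IsUnit x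
  · exact (chi_norm h).le
  · rw [chi_nonunit hm h, _root_.norm_zero]; exact zero_le_one

lemma chi_red_natCast {m n : ℕ} (h : n.Coprime m) : chi m (red m n) = 1 := by
  apply chi_of_im_eq_zero
  · exact isUnit_red_of_coprime (n := n ^ 2) (by rw [norm_eq]; simp) (h.pow_left 2)
  · simp

lemma exists_dser_w_mul_chi (a : ℕ) (ha : a ≠ 0) (h3 : ¬ 3 ∣ a) : ∀ b : ℕ, b ≠ 0 → a.Coprime b →
    ∃ R Q : ℂ → ℂ, EntirePosHalf R ∧ EntirePosHalf Q ∧ ∀ s : ℂ, 2 ≤ s.re →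
      R s * dser (fun α => w a α * chi b (red b α)) s =
        Q s * dser (fun α => chi (a * b) (red (a * b) α)) s := by
  induction a using Nat.recOnPrimePow with
  | zero => exact absurd rfl ha
  | one =>
    intro b hb _
    refine ⟨fun _ => 1, fun _ => 1, EntirePosHalf.one, EntirePosHalf.one, fun s hs => ?_⟩
    simp only [w_one_left, one_mul]
    rw [one_mul b]
  | prime_pow_mul a p k hp hpa hk ih =>
    intro b hb hab
    have ha0 : a ≠ 0 := right_ne_zero_of_mul ha
    have h3a : ¬ 3 ∣ a := fun h => h3 (h.mul_left _)
    have hp3 : p ≠ 3 := by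
      rintro rfl
      exact h3 ((dvd_pow_self _ hk.ne').mul_right _)
    have hpb : p.Coprime b := Nat.Coprime.coprime_dvd_left
      ((dvd_pow_self _ hk.ne').mul_right _) hab
    have hpa' : p.Coprime a := (Nat.Prime.coprime_iff_not_dvd hp).2 hpa
    have hab' : a.Coprime b := Nat.Coprime.coprime_dvd_left (dvd_mul_left _ _) hab
    have hpk : p ^ k ≠ 0 := pow_ne_zero _ hp.ne_zero
    obtain ⟨R, Q, hR, hQ, h⟩ := ih ha0 h3a (p ^ k * b) (mul_ne_zero hpk hb)
      ((hpa'.symm.pow_right k).mul_right hab')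
    have hcop : ∀ c : ℕ, p.Coprime c → ∀ β : Eis ℤ, (norm β = p ∨ norm β = p ^ 2) →
        IsUnit (red c β) := by
      rintro c hc β (hβ | hβ)
      · exact isUnit_red_of_coprime hβ hc
      · exact isUnit_red_of_coprime (n := p ^ 2) (by rw [hβ]; simp) (hc.pow_left 2)
    obtain ⟨R', Q', hR', hQ', h'⟩ := exists_dser_w_eq_dser_chi hp hp3 hk.ne'
      (v := fun α => w a α * chi b (red b α)) (B := (a * a : ℝ) * 1)
      (X := fun β => chi a (red a β) * chi b (red b β))
      (fun α => by
        rw [_root_.norm_mul]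
        gcongr
        · exact norm_w_le ha0 _
        · exact norm_chi_le hb _)
      (fun β hβ α => by
        rw [w_mul_of_isUnit ha0 (hcop a hpa' β hβ), map_mul, chi_mul]
        ring)
      (fun β => by simp only [map_star, chi_star, map_mul])
      (fun β => by
        rw [_root_.norm_mul]
        exact mul_le_one₀ (norm_chi_le ha0 _) (_root_.norm_nonneg _) (norm_chi_le hb _))
      (by rw [chi_red_natCast hpa', chi_red_natCast hpb, one_mul])
    refine ⟨fun s => R s * R' s, fun s => Q s * Q' s, hR.mul hR', hQ.mul hQ', fun s hs => ?_⟩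
    have e1 : (fun α => w (p ^ k * a) α * chi b (red b α)) =
        fun α => w (p ^ k) α * (w a α * chi b (red b α)) := by
      funext α
      rw [w_coprime_mul hpk ha0 (hpa'.pow_left k), mul_assoc]
    have e2 : (fun α => cubicChar p (red p α) ^ k * (w a α * chi b (red b α))) =
        fun α => w a α * chi (p ^ k * b) (red (p ^ k * b) α) := by
      funext α
      rw [chi_coprime_mul (hpb.pow_left k), redTo_red, redTo_red, chi_prime_pow hp hk.ne',
        redTo_red]
      ring
    have h'' := h' s hs
    have h1 := h s hs
    rw [e2] at h''
    rw [e1, mul_assoc (R s), h'', show p ^ k * a * b = a * (p ^ k * b) by ring]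
    linear_combination Q' s * h1

/-- Passing from the weights `w m` to the character `chi m`. -/
lemma exists_dser_w_eq {m : ℕ} (hm : m ≠ 0) (h3 : ¬ 3 ∣ m) :
    ∃ R Q : ℂ → ℂ, EntirePosHalf R ∧ EntirePosHalf Q ∧ ∀ s : ℂ, 2 ≤ s.re →
      R s * dser (w m) s = Q s * dser (fun α => chi m (red m α)) s := by
  obtain ⟨R, Q, hR, hQ, h⟩ := exists_dser_w_mul_chi m hm h3 1 one_ne_zero (Nat.coprime_one_right m)
  refine ⟨R, Q, hR, hQ, fun s hs => ?_⟩
  have h1 := h s hs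
  rw [mul_one] at h1
  rw [← h1]
  congr 2
  funext α
  simp [chi]

end Eis

namespace Eis

lemma dser_chi_sifted {m : ℕ} (hm : m ≠ 0) {s : ℂ} (hs : 2 ≤ s.re) (T : Finset ℕ)
    (hT : ∀ p ∈ T, p.Prime) :
    dser (fun α => if ∃ p ∈ T, (p : ℤ) ∣ norm α then 0 else chi m (red m α)) s =
      (∏ p ∈ T, eulerFactor (fun β => chi m (red m β)) p s) *
        dser (fun α => chi m (red m α)) s := by
  induction T using Finset.induction_on with
  | empty => simp
  | insert p T hp ih =>
    have hpp := hT p (Finset.mem_insert_self _ _)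
    have hT' : ∀ q ∈ T, q.Prime := fun q hq => hT q (Finset.mem_insert_of_mem hq)
    have hcop : ∀ q ∈ T, ∀ β : Eis ℤ, (norm β = p ∨ norm β = p ^ 2) → ∀ α : Eis ℤ,
        ((q : ℤ) ∣ norm (β * α) ↔ (q : ℤ) ∣ norm α) := by
      intro q hq β hβ α
      rw [map_mul]
      refine ⟨fun h => ?_, fun h => h.mul_left _⟩
      have hqz : Prime (q : ℤ) := Nat.prime_iff_prime_int.1 (hT' q hq)
      refine (hqz.dvd_or_dvd h).resolve_left fun h' => ?_
      have : (q : ℤ) ∣ p := by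
        rcases hβ with hβ | hβ
        · rwa [hβ] at h'
        · rw [hβ] at h'
          exact hqz.dvd_of_dvd_pow h'
      have := (Nat.prime_dvd_prime_iff_eq (hT' q hq) hpp).1 (by exact_mod_cast this)
      exact hp (this ▸ hq)
    rw [Finset.prod_insert hp, mul_assoc, ← ih hT', ← dser_ite_norm (B := 1) ?_ hs hpp ?_]
    · congr 1
      funext α
      simp only [Finset.exists_mem_insert]
      by_cases h1 : (p : ℤ) ∣ norm α
      · rw [if_pos h1, if_pos (Or.inl h1)]
      · rw [if_neg h1]
        exact if_congr (or_iff_right h1) rfl rfl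
    · intro α
      split_ifs
      · rw [_root_.norm_zero]; exact zero_le_one
      · exact norm_chi_le hm _
    · intro β hβ α
      have : (∃ q ∈ T, (q : ℤ) ∣ norm (β * α)) ↔ ∃ q ∈ T, (q : ℤ) ∣ norm α :=
        exists_congr fun q => and_congr_right fun hq => hcop q hq β hβ α
      simp only [this]
      rw [map_mul, chi_mul]
      split_ifs <;> simp

lemma eq_of_norm_eq_one {α : Eis ℤ} (h : norm α = 1) :
    α ∈ ({1, -1, om, -om, om ^ 2, -om ^ 2} : Finset (Eis ℤ)) := by
  rw [norm_eq] at h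
  have h1 : α.re ≤ 1 := by nlinarith [sq_nonneg (α.re - 2 * α.im)]
  have h2 : -1 ≤ α.re := by nlinarith [sq_nonneg (α.re - 2 * α.im)]
  have h3 : α.im ≤ 1 := by nlinarith [sq_nonneg (α.im - 2 * α.re)]
  have h4 : -1 ≤ α.im := by nlinarith [sq_nonneg (α.im - 2 * α.re)]
  have hom : (om ^ 2 : Eis ℤ) = ⟨-1, -1⟩ := by rw [om_sq]
  obtain ⟨a, b⟩ := α
  simp only at h h1 h2 h3 h4
  rw [hom]
  simp only [Finset.mem_insert, Finset.mem_singleton, QuadraticAlgebra.ext_iff]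
  interval_cases a <;> interval_cases b <;> simp_all

lemma chi_red_of_norm_eq_one {m : ℕ} (hm : m % 9 = 1) {α : Eis ℤ} (h : norm α = 1) :
    chi m (red m α) = 1 := by
  have h1 : ∀ x : Eis (ZMod m), chi m (-x) = chi m x := by
    intro x
    rw [← neg_one_mul, chi_mul, chi_of_im_eq_zero isUnit_one.neg (by simp), one_mul]
  have hom : chi m (red m om) = 1 := by rw [red_om, chi_om_eq_one hm]
  have := eq_of_norm_eq_one h
  simp only [Finset.mem_insert, Finset.mem_singleton] at this
  rcases this with rfl | rfl | rfl | rfl | rfl | rfl <;>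
    simp only [map_neg, map_one, h1, chi_one, hom, pow_two, chi_mul, mul_one, map_mul]

lemma exists_tendsto_sifted_dser_chi {m : ℕ} (hm : m % 9 = 1) {s : ℂ} (hs : 2 ≤ s.re) :
    Filter.Tendsto (fun n : ℕ => (∏ p ∈ n.primesBelow,
      eulerFactor (fun β => chi m (red m β)) p s) * dser (fun α => chi m (red m α)) s)
      Filter.atTop (nhds 6) := by
  have hm0 : m ≠ 0 := by rintro rfl; simp at hm
  have h6 : ∑' α : Eis ℤ, (if norm α = 1 then (1 : ℂ) else 0) = 6 := by
    have hom : (om ^ 2 : Eis ℤ) = ⟨-1, -1⟩ := by rw [om_sq]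
    have hn : ∀ α ∈ ({1, -1, om, -om, om ^ 2, -om ^ 2} : Finset (Eis ℤ)), norm α = 1 := by
      intro α hα
      simp only [Finset.mem_insert, Finset.mem_singleton] at hα
      rcases hα with rfl | rfl | rfl | rfl | rfl | rfl <;> simp [norm_eq, hom]
    rw [tsum_eq_sum (s := ({1, -1, om, -om, om ^ 2, -om ^ 2} : Finset (Eis ℤ)))
      fun α hα => if_neg fun h => hα (eq_of_norm_eq_one h),
      Finset.sum_congr rfl fun α hα => if_pos (hn α hα), Finset.sum_const, nsmul_eq_mul, mul_one]
    have : ({1, -1, om, -om, om ^ 2, -om ^ 2} : Finset (Eis ℤ)).card = 6 := by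
      rw [hom]
      repeat rw [Finset.card_insert_of_notMem (by
        simp [QuadraticAlgebra.ext_iff])]
      simp
    rw [this]; norm_num
  rw [← h6]
  simp only [← dser_chi_sifted hm0 hs _ fun p hp => Nat.prime_of_mem_primesBelow hp]
  refine tendsto_tsum_of_dominated_convergence (summable_norm_rpow hs) (fun α => ?_)
    (Filter.Eventually.of_forall fun n α => ?_)
  · refine tendsto_const_nhds.congr' ?_
    by_cases h1 : norm α = 1
    · refine Filter.Eventually.of_forall fun n => ?_
      beta_reduce
      rw [if_pos h1, if_neg, chi_red_of_norm_eq_one hm h1, h1]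
      · simp
      · rintro ⟨p, hp, hd⟩
        rw [h1] at hd
        have := (Nat.prime_of_mem_primesBelow hp)
        exact this.not_dvd_one (by exact_mod_cast hd)
    · have h2 : (norm α).natAbs ≠ 1 := by
        have := Eis.norm_nonneg α
        omega
      filter_upwards [Filter.eventually_gt_atTop (norm α).natAbs.minFac] with n hn
      rw [if_neg h1, if_pos, zero_mul]
      exact ⟨_, Nat.mem_primesBelow.2 ⟨hn, Nat.minFac_prime h2⟩,
        Int.natCast_dvd.2 (Nat.minFac_dvd _)⟩
  · rw [_root_.norm_mul, norm_term_eq hs]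
    refine mul_le_of_le_one_left (Real.rpow_nonneg (by exact_mod_cast Eis.norm_nonneg α) _) ?_
    beta_reduce
    split_ifs
    · rw [_root_.norm_zero]; exact zero_le_one
    · exact norm_chi_le hm0 _

end Eis

namespace NumberField

variable (K : Type*) [Field K] [NumberField K]

/-- The prime ideals containing `p`. -/
def primesAbove (p : ℕ) : Finset (Ideal (𝓞 K)) :=
  (UniqueFactorizationMonoid.normalizedFactors (Ideal.span {(p : 𝓞 K)})).toFinset

variable {K}

lemma mem_primesAbove {p : ℕ} (hp : p ≠ 0) {P : Ideal (𝓞 K)} :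
    P ∈ primesAbove K p ↔ P.IsPrime ∧ P ≠ ⊥ ∧ (p : 𝓞 K) ∈ P := by
  have h0 : Ideal.span {(p : 𝓞 K)} ≠ ⊥ := by
    rw [Ne, Ideal.span_singleton_eq_bot]; exact_mod_cast hp
  rw [primesAbove, Multiset.mem_toFinset, Ideal.mem_normalizedFactors_iff h0,
    Ideal.span_singleton_le_iff_mem]
  refine ⟨fun h => ⟨h.1, ?_, h.2⟩, fun h => ⟨h.1, h.2.2⟩⟩
  rintro rfl
  exact hp (by exact_mod_cast (Ideal.mem_bot.1 h.2))

lemma one_lt_absNorm {P : Ideal (𝓞 K)} (hP : P.IsPrime) (h0 : P ≠ ⊥) : 1 < Ideal.absNorm P := by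
  have h1 : Ideal.absNorm P ≠ 0 := by rwa [Ne, Ideal.absNorm_eq_zero_iff]
  have h2 : Ideal.absNorm P ≠ 1 := by rw [Ne, Ideal.absNorm_eq_one_iff]; exact hP.ne_top
  omega

variable (K)

lemma isBigO_card_absNorm : (fun n : ℕ => ∑ k ∈ Finset.Icc 1 n,
    (Nat.card {I : Ideal (𝓞 K) // Ideal.absNorm I = k} : ℝ)) =O[Filter.atTop]
      fun n : ℕ => (n : ℝ) ^ (1 : ℝ) := by
  have h1 := (Ideal.tendsto_norm_le_div_atTop₀ K).comp (tendsto_natCast_atTop_atTop (R := ℝ))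
  have h2 := h1.isBigO_one ℝ
  simp only [Real.rpow_one]
  have h3 : (fun n : ℕ => ∑ k ∈ Finset.Icc 1 n,
      (Nat.card {I : Ideal (𝓞 K) // Ideal.absNorm I = k} : ℝ)) =ᶠ[Filter.atTop]
      fun n : ℕ => ((fun s : ℝ => (Nat.card {I : nonZeroDivisors (Ideal (𝓞 K)) //
        (Ideal.absNorm (I : Ideal (𝓞 K)) : ℝ) ≤ s} : ℝ) / s) ∘ Nat.cast) n * (n : ℝ) := by
    filter_upwards [Filter.eventually_ne_atTop 0] with n hn
    have hn' : (n : ℝ) ≠ 0 := by exact_mod_cast hn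
    simp only [Function.comp_apply, Nat.cast_le]
    rw [div_mul_cancel₀ _ hn', ← Nat.cast_sum]
    congr 1
    rw [← add_left_inj 1, ← Ideal.card_norm_le_eq_card_norm_le_add_one,
      show Finset.Icc 1 n = Finset.Ioc 0 n from Finset.Icc_succ_left_eq_Ioc _ _,
      show 1 = Nat.card {I : Ideal (𝓞 K) // Ideal.absNorm I = 0} by
        simp [Ideal.absNorm_eq_zero_iff],
      Finset.sum_Ioc_add_eq_sum_Icc (n.zero_le),
      ← Finset.card_preimage_eq_sum_card_image_eq
        (fun k _ ↦ Ideal.finite_setOfPred_absNorm_eq k)]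
    simp [Set.coe_eq_subtype]
  refine h3.trans_isBigO ?_
  simpa using h2.mul (Asymptotics.isBigO_refl (fun n : ℕ => (n : ℝ)) Filter.atTop)

lemma summable_absNorm_rpow {σ : ℝ} (hσ : 1 < σ) :
    Summable fun I : {I : Ideal (𝓞 K) // I ≠ ⊥} => (Ideal.absNorm I.1 : ℝ) ^ (-σ) := by
  have h1 := LSeriesSummable_of_sum_norm_bigO_and_nonneg (isBigO_card_absNorm K)
    (fun n => Nat.cast_nonneg _) zero_le_one (s := σ) (by simpa using hσ)
  let N : {I : Ideal (𝓞 K) // I ≠ ⊥} → ℕ := fun I => Ideal.absNorm I.1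
  have hN : ∀ I, N I ≠ 0 := fun I => by rw [Ne, Ideal.absNorm_eq_zero_iff]; exact I.2
  have hfin : ∀ n, Finite {I // N I = n} := fun n => by
    have : Finite {I : Ideal (𝓞 K) // Ideal.absNorm I = n} :=
      (Ideal.finite_setOfPred_absNorm_eq n).to_subtype
    exact Finite.of_injective (β := {I : Ideal (𝓞 K) // Ideal.absNorm I = n})
      (fun I => ⟨I.1.1, I.2⟩) fun I J h => by
        simpa [Subtype.ext_iff] using h
  rw [← (Equiv.sigmaFiberEquiv N).summable_iff, summable_sigma_of_nonneg fun x => by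
    simp only [Function.comp_apply]; positivity]
  refine ⟨fun n => ?_, ?_⟩
  · have := hfin n
    exact Summable.of_finite
  · refine Summable.of_nonneg_of_le (fun n => tsum_nonneg fun I => by
      simp only [Function.comp_apply]; positivity) (fun n => ?_) h1.norm
    have := Fintype.ofFinite {I // N I = n}
    rw [tsum_fintype]
    rcases eq_or_ne n 0 with rfl | hn
    · have : IsEmpty {I // N I = 0} := ⟨fun I => hN I.1 I.2⟩
      simp
    · rw [LSeries.norm_term_eq, if_neg hn]
      have hc : Nat.card {I // N I = n} = Nat.card {I : Ideal (𝓞 K) // Ideal.absNorm I = n} :=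
        Nat.card_congr
          { toFun := fun I => ⟨I.1.1, I.2⟩
            invFun := fun I => ⟨⟨I.1, fun h => hn (by rw [← I.2, h, Ideal.absNorm_bot])⟩, I.2⟩
            left_inv := fun I => rfl
            right_inv := fun I => rfl }
      have e : ∀ I : {I // N I = n}, ((fun I : {I : Ideal (𝓞 K) // I ≠ ⊥} =>
          (Ideal.absNorm I.1 : ℝ) ^ (-σ)) ∘ Equiv.sigmaFiberEquiv N) ⟨n, I⟩ = (n : ℝ) ^ (-σ) := by
        intro I
        have : Ideal.absNorm I.1.1 = n := I.2
        simp [Equiv.sigmaFiberEquiv, this]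
      rw [Finset.sum_congr rfl fun I _ => e I, Finset.sum_const, Finset.card_univ,
        ← Nat.card_eq_fintype_card, hc, nsmul_eq_mul, Real.rpow_neg (Nat.cast_nonneg n)]
      simp [div_eq_mul_inv]

variable {K}

lemma norm_absNorm_cpow {s : ℂ} (I : {I : Ideal (𝓞 K) // I ≠ ⊥}) :
    ‖(Ideal.absNorm I.1 : ℂ) ^ (-s)‖ = (Ideal.absNorm I.1 : ℝ) ^ (-s.re) := by
  rw [Complex.norm_natCast_cpow_of_pos, Complex.neg_re]
  exact Nat.pos_of_ne_zero (by rw [Ne, Ideal.absNorm_eq_zero_iff]; exact I.2)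

/-- The Dedekind series restricted to the ideals without prime factor in `T`. -/
lemma tsum_sifted_absNorm {s : ℂ} (hs : 1 < s.re) (T : Finset (Ideal (𝓞 K)))
    (hT : ∀ P ∈ T, P.IsPrime ∧ P ≠ ⊥) :
    ∑' I : {I : Ideal (𝓞 K) // I ≠ ⊥}, (if ∃ P ∈ T, P ∣ I.1 then 0 else
      (Ideal.absNorm I.1 : ℂ) ^ (-s)) =
      (∏ P ∈ T, (1 - (Ideal.absNorm P : ℂ) ^ (-s))) * dedekindSeries K s := by
  induction T using Finset.induction_on with
  | empty => simp [dedekindSeries]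
  | insert P T hP ih =>
    have hPP := hT P (Finset.mem_insert_self _ _)
    have hT' : ∀ Q ∈ T, Q.IsPrime ∧ Q ≠ ⊥ := fun Q hQ => hT Q (Finset.mem_insert_of_mem hQ)
    let φ : {I : Ideal (𝓞 K) // I ≠ ⊥} → {I : Ideal (𝓞 K) // I ≠ ⊥} :=
      fun I => ⟨P * I.1, mul_ne_zero hPP.2 I.2⟩
    have hφ : Function.Injective φ := fun I J h =>
      Subtype.ext (mul_left_cancel₀ hPP.2 (Subtype.ext_iff.1 h))
    have hr : ∀ I, I ∈ Set.range φ ↔ P ∣ I.1 := by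
      refine fun I => ⟨fun ⟨J, hJ⟩ => ⟨J.1, by rw [← hJ]⟩, fun ⟨J, hJ⟩ => ⟨⟨J, ?_⟩, ?_⟩⟩
      · rintro rfl
        exact I.2 (by rw [hJ, Ideal.mul_bot])
      · exact Subtype.ext hJ.symm
    have hQ : ∀ Q ∈ T, ∀ I : Ideal (𝓞 K), Q ∣ P * I ↔ Q ∣ I := by
      refine fun Q hQ I => ⟨fun h => ?_, fun h => h.mul_left _⟩
      have hQp : Prime Q := Ideal.prime_of_isPrime (hT' Q hQ).2 (hT' Q hQ).1
      refine (hQp.dvd_or_dvd h).resolve_left fun h' => ?_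
      have hle : P ≤ Q := Ideal.dvd_iff_le.1 h'
      have : P.IsMaximal := hPP.1.isMaximal hPP.2
      exact hP ((this.eq_of_le (hT' Q hQ).1.ne_top hle) ▸ hQ)
    have hsum : Summable fun I : {I : Ideal (𝓞 K) // I ≠ ⊥} => if ∃ P ∈ T, P ∣ I.1 then 0 else
        (Ideal.absNorm I.1 : ℂ) ^ (-s) := by
      refine Summable.of_norm_bounded (summable_absNorm_rpow K hs) fun I => ?_
      split_ifs
      · rw [_root_.norm_zero]; positivity
      · rw [norm_absNorm_cpow]
    rw [Finset.prod_insert hP, mul_assoc, ← ih hT', ← tsum_ite_range_eq hsum hφ fun I => ?_]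
    · refine tsum_congr fun I => ?_
      simp only [Finset.exists_mem_insert, hr]
      by_cases h1 : P ∣ I.1
      · rw [if_pos h1, if_pos (Or.inl h1)]
      · rw [if_neg h1]
        exact if_congr (or_iff_right h1) rfl rfl
    · have : (∃ Q ∈ T, Q ∣ (φ I).1) ↔ ∃ Q ∈ T, Q ∣ I.1 :=
        exists_congr fun Q => and_congr_right fun h => hQ Q h I.1
      simp only [this]
      split_ifs
      · rw [mul_zero]
      · rw [show (φ I).1 = P * I.1 from rfl, map_mul, Nat.cast_mul,
          Complex.natCast_mul_natCast_cpow]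

lemma disjoint_primesAbove {p q : ℕ} (hp : p.Prime) (hq : q.Prime) (hpq : p ≠ q) :
    Disjoint (primesAbove K p) (primesAbove K q) := by
  rw [Finset.disjoint_left]
  intro P hP hQ
  rw [mem_primesAbove hp.ne_zero] at hP
  rw [mem_primesAbove hq.ne_zero] at hQ
  refine hP.1.ne_top ((Ideal.eq_top_iff_one _).2 ?_)
  have h := Nat.isCoprime_iff_coprime.2 ((Nat.coprime_primes hp hq).2 hpq)
  obtain ⟨a, b, hab⟩ := h
  have : (1 : 𝓞 K) = (a : 𝓞 K) * (p : 𝓞 K) + (b : 𝓞 K) * (q : 𝓞 K) := by exact_mod_cast hab.symm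
  rw [this]
  exact P.add_mem (P.mul_mem_left _ hP.2.2) (P.mul_mem_left _ hQ.2.2)

lemma exists_mem_primesAbove {I : Ideal (𝓞 K)} (hI : I ≠ ⊤) (h0 : I ≠ ⊥) :
    ∃ p : ℕ, p.Prime ∧ ∃ P ∈ primesAbove K p, P ∣ I := by
  obtain ⟨P, hP, hle⟩ := Ideal.exists_le_maximal I hI
  have hPb : P ≠ ⊥ := fun h => h0 (le_bot_iff.1 (h ▸ hle))
  have : NeZero P := ⟨hPb⟩
  have hp := Nat.absNorm_under_prime P
  refine ⟨_, hp, P, (mem_primesAbove hp.ne_zero).2 ⟨hP.isPrime, hPb, ?_⟩, Ideal.dvd_iff_le.2 hle⟩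
  exact_mod_cast Int.absNorm_under_mem P

/-- The local factor at `p` of the Dedekind zeta function. -/
def localFactor (K : Type*) [Field K] [NumberField K] (p : ℕ) (s : ℂ) : ℂ :=
  ∏ P ∈ primesAbove K p, (1 - (Ideal.absNorm P : ℂ) ^ (-s))

lemma localFactor_entirePosHalf {p : ℕ} (hp : p ≠ 0) : EntirePosHalf (localFactor K p) := by
  refine EntirePosHalf.prod _ fun P hP => ?_
  rw [mem_primesAbove hp] at hP
  exact EntirePosHalf.one_sub_natCast_cpow (one_lt_absNorm hP.1 hP.2.1)

lemma tendsto_localFactor_mul_dedekindSeries {s : ℂ} (hs : 1 < s.re) :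
    Filter.Tendsto (fun n : ℕ => (∏ p ∈ n.primesBelow, localFactor K p s) * dedekindSeries K s)
      Filter.atTop (nhds 1) := by
  have hd : ∀ n : ℕ, (∏ p ∈ n.primesBelow, localFactor K p s) =
      ∏ P ∈ n.primesBelow.biUnion (primesAbove K), (1 - (Ideal.absNorm P : ℂ) ^ (-s)) := by
    intro n
    rw [Finset.prod_biUnion]
    · rfl
    · exact fun p hp q hq hpq => disjoint_primesAbove (Nat.prime_of_mem_primesBelow hp)
        (Nat.prime_of_mem_primesBelow hq) hpq
  have hT : ∀ n : ℕ, ∀ P ∈ n.primesBelow.biUnion (primesAbove K), P.IsPrime ∧ P ≠ ⊥ := by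
    intro n P hP
    obtain ⟨p, hp, hP⟩ := Finset.mem_biUnion.1 hP
    rw [mem_primesAbove (Nat.prime_of_mem_primesBelow hp).ne_zero] at hP
    exact ⟨hP.1, hP.2.1⟩
  simp only [hd, ← tsum_sifted_absNorm hs _ (hT _)]
  have h1 : ∑' I : {I : Ideal (𝓞 K) // I ≠ ⊥}, (if I.1 = ⊤ then (1 : ℂ) else 0) = 1 := by
    rw [tsum_eq_single ⟨⊤, top_ne_bot⟩, if_pos rfl]
    intro I hI
    exact if_neg fun h => hI (Subtype.ext h)
  rw [← h1]
  refine tendsto_tsum_of_dominated_convergence (summable_absNorm_rpow K hs) (fun I => ?_)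
    (Filter.Eventually.of_forall fun n I => ?_)
  · refine tendsto_const_nhds.congr' ?_
    by_cases hI : I.1 = ⊤
    · refine Filter.Eventually.of_forall fun n => ?_
      beta_reduce
      rw [if_pos hI, if_neg, hI, Ideal.absNorm_top, Nat.cast_one, Complex.one_cpow]
      rintro ⟨P, hP, hd⟩
      rw [hI] at hd
      exact (hT n P hP).1.ne_top (top_le_iff.1 (Ideal.dvd_iff_le.1 hd))
    · obtain ⟨p, hp, P, hP, hd⟩ := exists_mem_primesAbove hI I.2
      filter_upwards [Filter.eventually_gt_atTop p] with n hn
      rw [if_neg hI, if_pos]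
      exact ⟨P, Finset.mem_biUnion.2 ⟨p, Nat.mem_primesBelow.2 ⟨hn, hp⟩, hP⟩, hd⟩
  · split_ifs
    · rw [_root_.norm_zero]; positivity
    · rw [norm_absNorm_cpow]

end NumberField

namespace NumberField

variable {K : Type*} [Field K] [NumberField K]

open Polynomial in
lemma localFactor_eq_prod_monicFactorsMod {θ : 𝓞 K} {p : ℕ} [hp : Fact p.Prime]
    (h : ¬ p ∣ RingOfIntegers.exponent θ) (s : ℂ) :
    localFactor K p s =
      ∏ Q ∈ RingOfIntegers.monicFactorsMod θ p, (1 - ((p : ℂ) ^ (-s)) ^ Q.natDegree) := by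
  have hpz : Prime (p : ℤ) := Nat.prime_iff_prime_int.1 hp.1
  have hmem : ∀ P : Ideal (𝓞 K), P ∈ primesAbove K p ↔
      P ∈ Ideal.primesOver (Ideal.span {(p : ℤ)}) (𝓞 K) := by
    intro P
    rw [mem_primesAbove hp.1.ne_zero]
    constructor
    · rintro ⟨h1, h2, h3⟩
      exact ⟨h1, (Ideal.liesOver_span_iff h1.ne_top hpz).2 (by simpa using h3)⟩
    · rintro ⟨h1, h2⟩
      have h3 := (Ideal.liesOver_span_iff h1.ne_top hpz).1 h2
      refine ⟨h1, ?_, by simpa using h3⟩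
      rintro rfl
      exact hp.1.ne_zero (by exact_mod_cast (Ideal.mem_bot.1 (by simpa using h3) : (p : 𝓞 K) = 0))
  let e := Ideal.primesOverSpanEquivMonicFactorsMod h
  rw [localFactor, ← Finset.prod_coe_sort,
    ← Finset.prod_coe_sort (RingOfIntegers.monicFactorsMod θ p)]
  refine Fintype.prod_equiv ((Equiv.subtypeEquivRight hmem).trans e) _ _ fun P => ?_
  obtain ⟨P, hP⟩ := P
  have hP' := (hmem P).1 hP
  let Q := e ⟨P, hP'⟩
  have h1 := Ideal.inertiaDeg_primesOverSpanEquivMonicFactorsMod_symm_apply' h Q.2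
  have h2 : (e.symm ⟨Q.1, Q.2⟩ : Ideal (𝓞 K)) = P := by
    rw [show (⟨Q.1, Q.2⟩ : RingOfIntegers.monicFactorsMod θ p) = e ⟨P, hP'⟩ from rfl,
      e.symm_apply_apply]
  rw [h2] at h1
  have : P.LiesOver (Ideal.span {(p : ℤ)}) := hP'.2
  have : P.IsPrime := hP'.1
  have h3 := Ideal.absNorm_pow_inertiaDeg (Ideal.span {(p : ℤ)}) P
  have h4 : Ideal.absNorm (Ideal.span {(p : ℤ)}) = p := by simp
  rw [h4, h1] at h3
  rw [← h3, Nat.cast_pow]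
  have h5 : ∀ n : ℕ, ((p : ℂ) ^ n) ^ (-s) = ((p : ℂ) ^ (-s)) ^ n := by
    intro n
    induction n with
    | zero => simp
    | succ n ih =>
      rw [pow_succ, pow_succ, ← ih, ← Nat.cast_pow, Complex.natCast_mul_natCast_cpow]
  rw [h5]
  rfl

lemma not_dvd_exponent {θ : 𝓞 K} {m p : ℕ} [hp : Fact p.Prime]
    (hθ : minpoly ℤ θ = Polynomial.X ^ 3 - Polynomial.C (m : ℤ))
    (hK : Algebra.adjoin ℚ {(θ : K)} = ⊤) (h : ¬ p ∣ 3 * m) :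
    ¬ p ∣ RingOfIntegers.exponent θ := by
  rw [RingOfIntegers.not_dvd_exponent_iff]
  have h1 : Polynomial.aeval θ (Polynomial.derivative (minpoly ℤ θ)) ∈ conductor ℤ θ := by
    have h := conductor_mul_differentIdeal ℤ ℚ K θ hK
    have h' : conductor ℤ θ * differentIdeal ℤ (𝓞 K) ≤ conductor ℤ θ := Ideal.mul_le_left
    rw [h, Ideal.span_singleton_le_iff_mem] at h'
    exact h'
  have h2 := minpoly.aeval ℤ θ
  rw [hθ] at h1 h2
  simp only [Polynomial.derivative_X_pow, map_mul, map_sub, map_pow, Polynomial.aeval_X,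
    map_natCast] at h1 h2
  have h3 : ((3 * m : ℕ) : ℤ) ∈ Ideal.comap (algebraMap ℤ (𝓞 K)) (conductor ℤ θ) := by
    rw [Ideal.mem_comap]
    have h4 := (conductor ℤ θ).mul_mem_left θ h1
    have h5 : θ ^ 3 = m := sub_eq_zero.1 h2
    convert h4 using 1
    push_cast
    rw [← h5]
    simp
    ring
  rw [codisjoint_iff]
  have h6 : IsCoprime ((3 * m : ℕ) : ℤ) p :=
    Nat.isCoprime_iff_coprime.2 ((hp.1.coprime_iff_not_dvd.2 h).symm)
  rw [← Ideal.isCoprime_span_singleton_iff, Ideal.isCoprime_iff_sup_eq] at h6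
  refine top_le_iff.1 (h6 ▸ sup_le_sup_right ?_ _)
  rwa [Ideal.span_singleton_le_iff_mem]

end NumberField

open Polynomial in
lemma Polynomial.irreducible_monic_dvd_prod_iff {F : Type*} [Field F] (s : Multiset F[X])
    (h : ∀ Q ∈ s, Q.Monic ∧ Irreducible Q) (Q : F[X]) :
    Irreducible Q ∧ Q.Monic ∧ Q ∣ s.prod ↔ Q ∈ s := by
  refine ⟨fun ⟨h1, h2, h3⟩ => ?_, fun hQ => ⟨(h Q hQ).2, (h Q hQ).1, Multiset.dvd_prod hQ⟩⟩
  obtain ⟨R, hR, hQR⟩ := h1.prime.exists_mem_multiset_dvd h3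
  rwa [eq_of_monic_of_associated h2 (h R hR).1
    ((h1.dvd_irreducible_iff_associated (h R hR).2).1 hQR)]

open Polynomial in
lemma Polynomial.irreducible_monic_dvd_iff_of_not_isRoot {F : Type*} [Field F] {a : F}
    (h : ∀ x : F, x ^ 3 ≠ a) (Q : F[X]) :
    Irreducible Q ∧ Q.Monic ∧ Q ∣ X ^ 3 - C a ↔ Q = X ^ 3 - C a := by
  have := irreducible_monic_dvd_prod_iff {X ^ 3 - C a} fun Q hQ => by
    rw [Multiset.mem_singleton.1 hQ]
    refine ⟨monic_X_pow_sub_C _ (by norm_num), irreducible_of_degree_le_three_of_not_isRoot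
      (by simp) fun x hx => h x ?_⟩
    simpa [sub_eq_zero] using hx
  simpa using this Q

open Polynomial in
lemma Polynomial.irreducible_monic_dvd_iff_of_primitiveRoot {F : Type*} [Field F] {a z : F}
    (hz : z ^ 2 + z + 1 = 0) (Q : F[X]) :
    Irreducible Q ∧ Q.Monic ∧ Q ∣ X ^ 3 - C (a ^ 3) ↔
      Q = X - C a ∨ Q = X - C (a * z) ∨ Q = X - C (a * z ^ 2) := by
  have := irreducible_monic_dvd_prod_iff {X - C a, X - C (a * z), X - C (a * z ^ 2)}
    fun Q hQ => by
      simp only [Multiset.insert_eq_cons, Multiset.mem_cons, Multiset.mem_singleton] at hQ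
      rcases hQ with rfl | rfl | rfl <;> exact ⟨monic_X_sub_C _, irreducible_X_sub_C _⟩
  have e : X ^ 3 - C (a ^ 3) =
      (({X - C a, X - C (a * z), X - C (a * z ^ 2)} : Multiset F[X])).prod := by
    have hC : (C z : F[X]) ^ 2 + C z + 1 = 0 := by
      rw [← C_pow, ← C_1, ← C_add, ← C_add, hz, C_0]
    simp only [Multiset.insert_eq_cons, Multiset.prod_cons, Multiset.prod_singleton, C_mul, C_pow]
    linear_combination (X ^ 2 * C a - X * C a ^ 2 * C z - C a ^ 3 * (1 - C z)) * hC
  rw [e, this]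
  simp only [Multiset.insert_eq_cons, Multiset.mem_cons, Multiset.mem_singleton]

open Polynomial in
lemma Polynomial.irreducible_monic_dvd_iff_of_cube_injective {F : Type*} [Field F] {a : F}
    (ha : a ≠ 0) (h3 : (3 : F) ≠ 0) (h : ∀ x : F, x ^ 3 = a ^ 3 → x = a)
    (Q : F[X]) :
    Irreducible Q ∧ Q.Monic ∧ Q ∣ X ^ 3 - C (a ^ 3) ↔
      Q = X - C a ∨ Q = X ^ 2 + C a * X + C (a ^ 2) := by
  have hd : (X ^ 2 + C a * X + C (a ^ 2) : F[X]).natDegree = 2 := by compute_degree!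
  have := irreducible_monic_dvd_prod_iff {X - C a, X ^ 2 + C a * X + C (a ^ 2)}
    fun Q hQ => by
      simp only [Multiset.insert_eq_cons, Multiset.mem_cons, Multiset.mem_singleton] at hQ
      rcases hQ with rfl | rfl
      · exact ⟨monic_X_sub_C _, irreducible_X_sub_C _⟩
      · refine ⟨by monicity!, irreducible_of_degree_le_three_of_not_isRoot (by rw [hd]; simp)
          fun x hx => ?_⟩
        simp only [IsRoot.def, eval_add, eval_mul, eval_pow, eval_X, eval_C] at hx
        have hxa := h x (by linear_combination (x - a) * hx)
        subst hxa
        refine mul_ne_zero h3 (pow_ne_zero 2 ha) ?_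
        linear_combination hx
  have e : X ^ 3 - C (a ^ 3) = (({X - C a, X ^ 2 + C a * X + C (a ^ 2)} : Multiset F[X])).prod := by
    simp only [Multiset.insert_eq_cons, Multiset.prod_cons, Multiset.prod_singleton, C_pow]
    ring
  rw [e, this]
  simp only [Multiset.insert_eq_cons, Multiset.mem_cons, Multiset.mem_singleton]

lemma ZMod.exists_cube_eq {p : ℕ} [hp : Fact p.Prime] (h : p % 3 = 2) (m : ZMod p) :
    ∃ a : ZMod p, a ^ 3 = m ∧ ∀ x : ZMod p, x ^ 3 = a ^ 3 → x = a := by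
  obtain ⟨k, hk⟩ : ∃ k, 2 * p - 1 = 3 * (2 * k + 1) := ⟨p / 3, by omega⟩
  have key : ∀ x : ZMod p, (x ^ 3) ^ (2 * k + 1) = x := by
    intro x
    have h1 : 2 * p - 1 = p + (p - 1) := by have := hp.1.two_le; omega
    rw [← pow_mul, ← hk, h1, pow_add, ZMod.pow_card, ← pow_succ',
      Nat.sub_add_cancel hp.1.one_le, ZMod.pow_card]
  refine ⟨m ^ (2 * k + 1), by rw [← pow_mul, mul_comm, pow_mul, key], fun x hx => ?_⟩
  rw [← key x, hx, key]

lemma ZMod.exists_primitive_cube_root {p : ℕ} [hp : Fact p.Prime] {χ : MulChar (ZMod p) ℂ}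
    (hχ : orderOf χ = 3) (h3 : p % 3 = 1) :
    (∃ z : ZMod p, z ^ 2 + z + 1 = 0 ∧ z ≠ 1) ∧ ∀ m : ZMod p, χ m = 1 → ∃ a, a ^ 3 = m := by
  obtain ⟨g, hg⟩ := IsCyclic.exists_generator (α := (ZMod p)ˣ)
  have hord : orderOf g = p - 1 := by
    rw [orderOf_eq_card_of_forall_mem_zpowers hg, Nat.card_eq_fintype_card, ZMod.card_units]
  have hgp : ∀ u : (ZMod p)ˣ, ∃ k : ℕ, g ^ k = u := fun u =>
    (mem_powers_iff_mem_zpowers.2 (hg u))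
  have hχ3 : χ ^ 3 = 1 := hχ ▸ pow_orderOf_eq_one χ
  have hg3 : χ g ^ 3 = 1 := by
    rw [← MulChar.pow_apply_coe, hχ3, MulChar.one_apply_coe]
  have hg1 : χ g ≠ 1 := by
    intro h
    have : χ = 1 := by
      refine MulChar.ext fun u => ?_
      obtain ⟨k, rfl⟩ := hgp u
      rw [Units.val_pow_eq_pow_val, map_pow, h, one_pow, ← Units.val_pow_eq_pow_val,
        MulChar.one_apply_coe]
    rw [this, orderOf_one] at hχ
    omega
  have hog : orderOf (χ g) = 3 := orderOf_eq_prime hg3 hg1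
  refine ⟨⟨(g ^ ((p - 1) / 3) : (ZMod p)ˣ), ?_, ?_⟩, fun m hm => ?_⟩
  · have hz3 : ((g ^ ((p - 1) / 3) : (ZMod p)ˣ) : ZMod p) ^ 3 = 1 := by
      rw [← Units.val_pow_eq_pow_val, ← pow_mul, Nat.div_mul_cancel (by omega), ← hord,
        pow_orderOf_eq_one, Units.val_one]
    have hz1 : ((g ^ ((p - 1) / 3) : (ZMod p)ˣ) : ZMod p) ≠ 1 := by
      rw [Ne, Units.val_eq_one]
      intro h
      have h4 := orderOf_dvd_of_pow_eq_one h
      rw [hord] at h4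
      have := Nat.le_of_dvd (by have := hp.1.two_le; omega) h4
      have := hp.1.two_le; omega
    refine (mul_eq_zero.1 ?_).resolve_left (sub_ne_zero.2 hz1)
    linear_combination hz3
  · rw [Ne, Units.val_eq_one]
    intro h
    have h4 := orderOf_dvd_of_pow_eq_one h
    rw [hord] at h4
    have := Nat.le_of_dvd (by have := hp.1.two_le; omega) h4
    have := hp.1.two_le; omega
  · have hu : IsUnit m := by
      by_contra h
      rw [χ.map_nonunit h] at hm
      exact zero_ne_one hm
    obtain ⟨u, rfl⟩ := hu
    obtain ⟨k, rfl⟩ := hgp u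
    rw [Units.val_pow_eq_pow_val, map_pow] at hm
    obtain ⟨j, rfl⟩ := hog ▸ orderOf_dvd_of_pow_eq_one hm
    exact ⟨(g : ZMod p) ^ j, by rw [Units.val_pow_eq_pow_val, ← pow_mul, mul_comm]⟩

namespace NumberField

open Eis

variable {K : Type*} [Field K] [NumberField K]

lemma chi_red_primeAbove {m p : ℕ} [hp : Fact p.Prime] (hm : m % 3 = 1) (h1 : p % 3 = 1) :
    ∃ χ : MulChar (ZMod p) ℂ, orderOf χ = 3 ∧ chi m (red m (primeAbove p)) = χ m := by
  obtain ⟨χ, -, h2, h3⟩ := primeAbove_spec h1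
  refine ⟨χ, h2, ?_⟩
  have hm0 : m ≠ 0 := by omega
  conv_rhs => rw [← Nat.prod_factorization_pow_eq_self hm0]
  rw [chi_red, Finsupp.prod, Nat.cast_prod, map_prod, Nat.support_factorization]
  refine Finset.prod_congr rfl fun q hq => ?_
  rw [h3 q (Nat.prime_of_mem_primeFactors hq), Nat.cast_pow, map_pow]
  rintro rfl
  have := Nat.dvd_of_mem_primeFactors hq
  omega

/-- The local factors of a pure cubic field away from its discriminant. -/
lemma localFactor_eq {θ : 𝓞 K} {m p : ℕ} [hp : Fact p.Prime]
    (hθ : minpoly ℤ θ = Polynomial.X ^ 3 - Polynomial.C (m : ℤ))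
    (hK : Algebra.adjoin ℚ {(θ : K)} = ⊤) (hm : m % 3 = 1) (h : ¬ p ∣ 3 * m) (s : ℂ) :
    localFactor K p s =
      (1 - (p : ℂ) ^ (-s)) * eulerFactor (fun β => chi m (red m β)) p s := by
  have hp3 : p ≠ 3 := by rintro rfl; exact h (dvd_mul_right 3 m)
  have hpm : ¬ p ∣ m := fun h' => h (h'.mul_left 3)
  have hmap : (minpoly ℤ θ).map (Int.castRingHom (ZMod p)) =
      Polynomial.X ^ 3 - Polynomial.C (m : ZMod p) := by
    rw [hθ]; simp
  have hm0 : (m : ZMod p) ≠ 0 := by rwa [Ne, ZMod.natCast_eq_zero_iff]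
  have hmem : ∀ Q, Q ∈ RingOfIntegers.monicFactorsMod θ p ↔ Irreducible Q ∧ Q.Monic ∧
      Q ∣ Polynomial.X ^ 3 - Polynomial.C (m : ZMod p) := by
    intro Q
    rw [RingOfIntegers.monicFactorsMod, Multiset.mem_toFinset, Polynomial.mem_normalizedFactors_iff,
      hmap]
    rw [hmap]
    exact (Polynomial.monic_X_pow_sub_C _ (by norm_num)).ne_zero
  rw [localFactor_eq_prod_monicFactorsMod (not_dvd_exponent hθ hK h)]
  set q := (p : ℂ) ^ (-s) with hq
  have hcases : p % 3 = 1 ∨ p % 3 = 2 := by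
    have : ¬ 3 ∣ p := fun h' => hp3 ((Nat.prime_dvd_prime_iff_eq Nat.prime_three hp.1).1 h').symm
    omega
  rcases hcases with h1 | h2
  · obtain ⟨χ, hχ, hχm⟩ := chi_red_primeAbove hm h1
    obtain ⟨⟨z, hz, hz1⟩, hcube⟩ := ZMod.exists_primitive_cube_root hχ h1
    rw [eulerFactor, if_pos h1, ← hq]
    simp only [Eis.map_star, chi_star, hχm]
    by_cases hc : χ (m : ZMod p) = 1
    · obtain ⟨a, ha⟩ := hcube _ hc
      have ha0 : a ≠ 0 := by rintro rfl; exact hm0 (by rw [← ha]; simp)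
      have hz0 : z ≠ 0 := by rintro rfl; simp at hz
      have hz2 : z ^ 2 ≠ 1 := by
        intro h'
        exact hz1 (by linear_combination (z - 1) * hz - z * h')
      have e : RingOfIntegers.monicFactorsMod θ p = {Polynomial.X - Polynomial.C a,
          Polynomial.X - Polynomial.C (a * z), Polynomial.X - Polynomial.C (a * z ^ 2)} := by
        refine Finset.ext fun Q => ?_
        rw [hmem, ← ha]
        simp only [Finset.mem_insert, Finset.mem_singleton]
        exact Polynomial.irreducible_monic_dvd_iff_of_primitiveRoot hz Q
      rw [e, Finset.prod_insert, Finset.prod_pair, hc]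
      · simp only [Polynomial.natDegree_X_sub_C, map_one]
        ring
      · rw [Ne, sub_right_inj, Polynomial.C_inj]
        exact fun h' => hz1 (mul_left_cancel₀ (mul_ne_zero ha0 hz0) (by linear_combination -h'))
      · simp only [Finset.mem_insert, Finset.mem_singleton, sub_right_inj, Polynomial.C_inj]
        rintro (h' | h')
        · exact hz1 (mul_left_cancel₀ ha0 (by linear_combination -h'))
        · exact hz2 (mul_left_cancel₀ ha0 (by linear_combination -h'))
    · have e : RingOfIntegers.monicFactorsMod θ p =
          {Polynomial.X ^ 3 - Polynomial.C (m : ZMod p)} := by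
        refine Finset.ext fun Q => ?_
        rw [hmem]
        rw [Finset.mem_singleton]
        refine Polynomial.irreducible_monic_dvd_iff_of_not_isRoot (fun x hx => hc ?_) Q
        rw [← hx, map_pow, ← MulChar.pow_apply' _ (by norm_num), ← hχ, pow_orderOf_eq_one,
          MulChar.one_apply]
        rw [isUnit_iff_ne_zero]
        rintro rfl
        exact hm0 (by rw [← hx]; simp)
      have hc3 : χ (m : ZMod p) ^ 3 = 1 := by
        rw [← MulChar.pow_apply' _ (by norm_num), ← hχ, pow_orderOf_eq_one,
          MulChar.one_apply (isUnit_iff_ne_zero.2 hm0)]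
      have hc2 : χ (m : ZMod p) ^ 2 + χ (m : ZMod p) + 1 = 0 :=
        (mul_eq_zero.1 (by linear_combination hc3)).resolve_left (sub_ne_zero.2 hc)
      have hconj : (starRingEnd ℂ) (χ (m : ZMod p)) = χ (m : ZMod p) ^ 2 := by
        have hn : ‖χ (m : ZMod p)‖ = 1 := Complex.norm_eq_one_of_pow_eq_one hc3 (by norm_num)
        rw [← Complex.inv_eq_conj hn]
        refine inv_eq_of_mul_eq_one_right ?_
        linear_combination hc3
      rw [e, Finset.prod_singleton, Polynomial.natDegree_X_pow_sub_C, hconj]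
      linear_combination (-(1 - q) * (q ^ 2 * (χ (m : ZMod p) - 1) - q)) * hc2
  · obtain ⟨a, ha, hinj⟩ := ZMod.exists_cube_eq h2 (m : ZMod p)
    have ha0 : a ≠ 0 := by rintro rfl; exact hm0 (by rw [← ha]; simp)
    have h3 : (3 : ZMod p) ≠ 0 := by
      rw [show (3 : ZMod p) = ((3 : ℕ) : ZMod p) by simp, Ne, ZMod.natCast_eq_zero_iff]
      exact fun h' => hp3 ((Nat.prime_dvd_prime_iff_eq hp.1 Nat.prime_three).1 h')
    have hd : (Polynomial.X ^ 2 + Polynomial.C a * Polynomial.X + Polynomial.C (a ^ 2) :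
        Polynomial (ZMod p)).natDegree = 2 := by compute_degree!
    have e : RingOfIntegers.monicFactorsMod θ p = {Polynomial.X - Polynomial.C a,
        Polynomial.X ^ 2 + Polynomial.C a * Polynomial.X + Polynomial.C (a ^ 2)} := by
      refine Finset.ext fun Q => ?_
      rw [hmem, ← ha]
      simp only [Finset.mem_insert, Finset.mem_singleton]
      exact Polynomial.irreducible_monic_dvd_iff_of_cube_injective ha0 h3 hinj Q
    rw [e, Finset.prod_pair, Polynomial.natDegree_X_sub_C, hd, eulerFactor, if_neg (by omega),
      if_neg hp3, chi_red_natCast ((Nat.Prime.coprime_iff_not_dvd hp.1).2 hpm), pow_one, one_mul,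
      sq p, Nat.cast_mul, Complex.natCast_mul_natCast_cpow, ← hq, sq]
    intro h'
    have := congrArg Polynomial.natDegree h'
    rw [hd, Polynomial.natDegree_X_sub_C] at this
    omega

/-- The Euler factors of `chi m` at the primes dividing `m`. -/
lemma eulerFactor_chi_of_dvd {m p : ℕ} (hm : m ≠ 0) (hp : p.Prime) (hp3 : p ≠ 3) (h : p ∣ m)
    (s : ℂ) : eulerFactor (fun β => chi m (red m β)) p s = 1 := by
  have hz : ∀ x : Eis ℤ, (p : ℤ) ∣ norm x → chi m (red m x) = 0 := by
    intro x hx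
    rw [chi_red]
    refine Finset.prod_eq_zero (Nat.mem_primeFactors.2 ⟨hp, h, hm⟩) ?_
    rw [MulChar.map_nonunit _ (fun h' => (isUnit_red_iff hp x).1 h' hx), zero_pow]
    exact (hp.factorization_pos_of_dvd hm h).ne'
  have := Fact.mk hp
  rw [eulerFactor]
  split_ifs with h1
  · obtain ⟨-, hn, -⟩ := primeAbove_spec h1
    rw [hz _ (by rw [hn]), hz _ (by rw [QuadraticAlgebra.norm_star, hn])]
    ring
  · rw [hz _ (by rw [norm_eq]; simp), zero_mul, sub_zero]

lemma eulerFactor_chi_three {m : ℕ} (hm : m % 9 = 1) (s : ℂ) :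
    eulerFactor (fun β => chi m (red m β)) 3 s = 1 - (3 : ℂ) ^ (-s) := by
  rw [eulerFactor, if_neg (by norm_num), if_pos rfl, chi_lam_eq_one hm, one_mul]

end NumberField

namespace NumberField

open Eis

variable {K : Type*} [Field K] [NumberField K]

lemma prod_primesBelow_ite_dvd {N n : ℕ} (hN : N ≠ 0) (hn : N < n) (f : ℕ → ℂ) :
    ∏ p ∈ n.primesBelow, (if p ∣ N then f p else 1) = ∏ p ∈ N.primeFactors, f p := by
  rw [← Finset.prod_filter]
  refine Finset.prod_congr (Finset.ext fun p => ?_) fun _ _ => rfl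
  rw [Finset.mem_filter, Nat.mem_primesBelow, Nat.mem_primeFactors]
  exact ⟨fun h => ⟨h.1.2, h.2, hN⟩, fun h => ⟨⟨(Nat.le_of_dvd (Nat.pos_of_ne_zero hN) h.2.1).trans_lt
    hn, h.1⟩, h.2.1⟩⟩

lemma one_sub_natCast_cpow_ne_zero {n : ℕ} (hn : 1 < n) {s : ℂ} (hs : 0 < s.re) :
    1 - (n : ℂ) ^ (-s) ≠ 0 := by
  intro h
  have h1 := congrArg Norm.norm (sub_eq_zero.1 h)
  rw [NormOneClass.norm_one, Complex.norm_natCast_cpow_of_pos (by omega), Complex.neg_re] at h1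
  have := Real.rpow_lt_one_of_one_lt_of_neg (x := n) (z := -s.re) (by exact_mod_cast hn)
    (by linarith)
  linarith

lemma riemannZeta_mul_dser_chi {θ : 𝓞 K} {m : ℕ}
    (hθ : minpoly ℤ θ = Polynomial.X ^ 3 - Polynomial.C (m : ℤ))
    (hK : Algebra.adjoin ℚ {(θ : K)} = ⊤) (hm : m % 9 = 1) {s : ℂ} (hs : 2 ≤ s.re) :
    riemannZeta s * (∏ p ∈ (3 * m).primeFactors, (1 - (p : ℂ) ^ (-s)) *
        eulerFactor (fun β => chi m (red m β)) p s) * dser (fun α => chi m (red m α)) s =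
      6 * (∏ p ∈ (3 * m).primeFactors, localFactor K p s) * dedekindSeries K s := by
  have hs1 : 1 < s.re := by linarith
  set e : ℕ → ℂ := fun p => eulerFactor (fun β => chi m (red m β)) p s
  have h1 := riemannZeta_eulerProduct hs1
  have h2 := tendsto_localFactor_mul_dedekindSeries (K := K) hs1
  have h3 := exists_tendsto_sifted_dser_chi hm hs
  have h4 := ((h1.mul h2).mul_const (∏ p ∈ (3 * m).primeFactors, (1 - (p : ℂ) ^ (-s)) * e p)).mul_const
    (dser (fun α => chi m (red m α)) s)
  have h5 := (h3.mul_const (∏ p ∈ (3 * m).primeFactors, localFactor K p s)).mul_const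
    (dedekindSeries K s)
  rw [mul_one] at h4
  refine tendsto_nhds_unique (h4.congr' ?_) h5
  filter_upwards [Filter.eventually_gt_atTop (3 * m)] with n hn
  have h3m : 3 * m ≠ 0 := by omega
  rw [← prod_primesBelow_ite_dvd h3m hn, ← prod_primesBelow_ite_dvd h3m hn]
  have key : (∏ p ∈ n.primesBelow, (1 - (p : ℂ) ^ (-s))⁻¹) * (∏ p ∈ n.primesBelow, localFactor K p s) *
      (∏ p ∈ n.primesBelow, if p ∣ 3 * m then (1 - (p : ℂ) ^ (-s)) * e p else 1) =
      (∏ p ∈ n.primesBelow, e p) *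
        ∏ p ∈ n.primesBelow, if p ∣ 3 * m then localFactor K p s else 1 := by
    simp only [← Finset.prod_mul_distrib]
    refine Finset.prod_congr rfl fun p hp => ?_
    have hp' := Nat.prime_of_mem_primesBelow hp
    have := Fact.mk hp'
    have h0 : 1 - (p : ℂ) ^ (-s) ≠ 0 := one_sub_natCast_cpow_ne_zero hp'.one_lt (by linarith)
    split_ifs with h
    · field_simp
    · rw [localFactor_eq hθ hK (by omega) h]
      change _ = e p * 1
      field_simp
      rfl
  linear_combination (dedekindSeries K s * dser (fun α => chi m (red m α)) s) * key

/-- The Dedekind zeta function of a pure cubic field and the Dirichlet series of the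
coefficients `w m`. -/
lemma exists_riemannZeta_mul_dser_w_eq {θ : 𝓞 K} {m : ℕ}
    (hθ : minpoly ℤ θ = Polynomial.X ^ 3 - Polynomial.C (m : ℤ))
    (hK : Algebra.adjoin ℚ {(θ : K)} = ⊤) (hm : m % 9 = 1) :
    ∃ U V : ℂ → ℂ, EntirePosHalf U ∧ EntirePosHalf V ∧ ∀ s : ℂ, 2 ≤ s.re →
      U s * (riemannZeta s * dser (w m) s) = V s * dedekindSeries K s := by
  have h3m : ¬ 3 ∣ m := by omega
  have hm0 : m ≠ 0 := by omega
  obtain ⟨R, Q, hR, hQ, h⟩ := exists_dser_w_eq hm0 h3m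
  open scoped ComplexOrder in
  have hsix : EntirePosHalf fun _ => 6 := ⟨differentiable_const _, Nat.ofNat_pos⟩
  have hp : ∀ p ∈ (3 * m).primeFactors, p.Prime := fun p => Nat.prime_of_mem_primeFactors
  have hE : ∀ p ∈ (3 * m).primeFactors, EntirePosHalf (eulerFactor (fun β => chi m (red m β)) p) := by
    intro p hp
    have hpp := Nat.prime_of_mem_primeFactors hp
    rcases eq_or_ne p 3 with rfl | hp3
    · have e : eulerFactor (fun β => chi m (red m β)) 3 = fun s => 1 - ((3 : ℕ) : ℂ) ^ (-s) :=
        funext fun s => by exact_mod_cast eulerFactor_chi_three hm s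
      rw [e]
      exact EntirePosHalf.one_sub_natCast_cpow (by norm_num)
    · have hpm : p ∣ m := (hpp.dvd_mul.1 (Nat.dvd_of_mem_primeFactors hp)).resolve_left
        fun h' => hp3 ((Nat.prime_dvd_prime_iff_eq hpp Nat.prime_three).1 h')
      have e : eulerFactor (fun β => chi m (red m β)) p = fun s => 1 :=
        funext fun s => eulerFactor_chi_of_dvd hm0 hpp hp3 hpm s
      rw [e]
      exact EntirePosHalf.one
  refine ⟨_, _, hR.mul (EntirePosHalf.prod _ fun p hpm =>
    (EntirePosHalf.one_sub_natCast_cpow (hp p hpm).one_lt).mul (hE p hpm)),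
    hQ.mul (hsix.mul (EntirePosHalf.prod _ fun p hpm =>
      localFactor_entirePosHalf (K := K) (hp p hpm).ne_zero)), fun s hs => ?_⟩
  have h1 := riemannZeta_mul_dser_chi hθ hK hm hs
  have h2 := h s hs
  linear_combination (riemannZeta s * ∏ p ∈ (3 * m).primeFactors, ((1 - (p : ℂ) ^ (-s)) *
        eulerFactor (fun β => chi m (red m β)) p s)) * h2 + Q s * h1

end NumberField

namespace ZetaHalf

open Filter Topology MeasureTheory Asymptotics

/-- The fractional part, restricted to `t > 1`. -/
def fractTail : ℝ → ℂ := Set.indicator (Set.Ioi 1) fun t => ((Int.fract t : ℝ) : ℂ)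

lemma norm_fractTail_le (t : ℝ) : ‖fractTail t‖ ≤ 1 := by
  rw [fractTail, Set.indicator_apply]
  split_ifs
  · rw [Complex.norm_real, Real.norm_of_nonneg (Int.fract_nonneg t)]
    exact (Int.fract_lt_one t).le
  · simp

lemma measurable_fractTail : Measurable fractTail :=
  (Complex.measurable_ofReal.comp measurable_fract).indicator measurableSet_Ioi

lemma differentiableAt_mellin_fractTail {s : ℂ} (hs : s.re < 0) :
    DifferentiableAt ℂ (mellin fractTail) s := by
  refine mellin_differentiableAt_of_isBigO_rpow (a := 0) (b := s.re - 1) ?_ ?_ hs ?_ (by linarith)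
  · refine LocallyIntegrable.locallyIntegrableOn ?_ _
    exact (locallyIntegrable_const (1 : ℝ)).mono measurable_fractTail.aestronglyMeasurable
      (Eventually.of_forall fun t => by simpa using norm_fractTail_le t)
  · exact IsBigO.of_bound 1 (Eventually.of_forall fun t => by simpa using norm_fractTail_le t)
  · refine EventuallyEq.trans_isBigO (f₂ := fun _ => (0 : ℂ)) ?_ (isBigO_zero _ _)
    filter_upwards [nhdsWithin_le_nhds (Iio_mem_nhds (zero_lt_one' ℝ))] with t ht
    exact Set.indicator_of_notMem (fun h => lt_asymm (Set.mem_Ioi.1 h) ht) _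

lemma mellin_fractTail (s : ℂ) :
    mellin fractTail (-s) =
      ∫ t in Set.Ioi (1 : ℝ), (t : ℂ) ^ (-(s + 1)) * ((Int.fract t : ℝ) : ℂ) := by
  have h : (fun t : ℝ => (t : ℂ) ^ (-s - 1) • fractTail t) = Set.indicator (Set.Ioi 1)
      fun t : ℝ => (t : ℂ) ^ (-(s + 1)) * ((Int.fract t : ℝ) : ℂ) := by
    funext t
    rw [fractTail, Set.indicator_apply, Set.indicator_apply, neg_add']
    split_ifs <;> simp
  rw [mellin, h, setIntegral_indicator measurableSet_Ioi,
    Set.inter_eq_right.2 (Set.Ioi_subset_Ioi zero_le_one)]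

lemma riemannZeta_eq_of_one_lt_re {s : ℂ} (hs : 1 < s.re) :
    riemannZeta s = s / (s - 1) - s * mellin fractTail (-s) := by
  have h0 : (0 : ℝ) < s.re := by linarith
  have hI : IntegrableOn (fun t : ℝ => (t : ℂ) ^ (-s)) (Set.Ioi 1) :=
    integrableOn_Ioi_cpow_of_lt (by simpa using hs) zero_lt_one
  have hJ : IntegrableOn (fun t : ℝ => (t : ℂ) ^ (-(s + 1)) * ((Int.fract t : ℝ) : ℂ))
      (Set.Ioi 1) := by
    have : IntegrableOn (fun t : ℝ => (t : ℂ) ^ (-(s + 1))) (Set.Ioi 1) :=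
      integrableOn_Ioi_cpow_of_lt (by simp; linarith) zero_lt_one
    refine Integrable.mul_bdd (c := 1) this
      (Complex.measurable_ofReal.comp measurable_fract).aestronglyMeasurable
      (Eventually.of_forall fun t => ?_)
    rw [Complex.norm_real, Real.norm_of_nonneg (Int.fract_nonneg t)]
    exact (Int.fract_lt_one t).le
  have h1 := LSeries_eq_mul_integral_of_nonneg (fun _ => 1) zero_le_one hs
    (by simpa using isBigO_refl _ _) fun _ => zero_le_one (α := ℝ)
  have h2 : LSeries (fun _ => ((1 : ℝ) : ℂ)) s = riemannZeta s := by
    rw [← LSeries_one_eq_riemannZeta hs]; congr 1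
  have h3 : ∫ t in Set.Ioi (1 : ℝ), (∑ k ∈ Finset.Icc 1 ⌊t⌋₊, ((1 : ℝ) : ℂ)) * (t : ℂ) ^ (-(s + 1))
      = ∫ t in Set.Ioi (1 : ℝ), ((t : ℂ) ^ (-s) -
        (t : ℂ) ^ (-(s + 1)) * ((Int.fract t : ℝ) : ℂ)) := by
    refine setIntegral_congr_fun measurableSet_Ioi fun t ht => ?_
    have ht0 : (0 : ℝ) < t := zero_lt_one.trans ht
    have ht0' : (t : ℂ) ≠ 0 := by exact_mod_cast ht0.ne'
    have e : ((⌊t⌋₊ : ℕ) : ℂ) = (t : ℂ) - ((Int.fract t : ℝ) : ℂ) := by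
      have : ((⌊t⌋₊ : ℕ) : ℝ) = t - Int.fract t := by
        rw [Int.self_sub_fract, ← natCast_floor_eq_intCast_floor ht0.le]
      rw [← Complex.ofReal_sub, ← this]; simp
    have e2 : (t : ℂ) ^ (-s) = t * (t : ℂ) ^ (-(s + 1)) := by
      rw [show -s = 1 + -(s + 1) by ring, Complex.cpow_add _ _ ht0', Complex.cpow_one]
    simp only [Finset.sum_const, Nat.card_Icc, Complex.ofReal_one, nsmul_eq_mul, mul_one,
      add_tsub_cancel_right, e, e2]
    ring
  rw [← h2, h1, h3, integral_sub hI hJ, mellin_fractTail,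
    integral_Ioi_cpow_of_lt (by simpa using hs) zero_lt_one]
  have : s - 1 ≠ 0 := by
    intro h; rw [sub_eq_zero.1 h] at hs; simp at hs
  have h' : -s + 1 ≠ 0 := by
    intro h; apply this; linear_combination -h
  simp only [Complex.ofReal_one, Complex.one_cpow]
  rw [mul_sub]
  congr 1
  field_simp
  ring

lemma riemannZeta₁_eq {s : ℂ} (hs : 0 < s.re) :
    riemannZeta₁ s = s - s * (s - 1) * mellin fractTail (-s) := by
  have hU : IsOpen {s : ℂ | 0 < s.re} := isOpen_lt continuous_const Complex.continuous_re
  have hf : AnalyticOnNhd ℂ riemannZeta₁ {s : ℂ | 0 < s.re} :=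
    differentiable_riemannZeta₁.differentiableOn.analyticOnNhd hU
  have hg : AnalyticOnNhd ℂ (fun s => s - s * (s - 1) * mellin fractTail (-s))
      {s : ℂ | 0 < s.re} := by
    refine DifferentiableOn.analyticOnNhd (fun s hs => DifferentiableAt.differentiableWithinAt ?_) hU
    have : DifferentiableAt ℂ (fun s => mellin fractTail (-s)) s :=
      (differentiableAt_mellin_fractTail (s := -s) (by simpa using hs)).comp s
        differentiableAt_id.neg
    fun_prop
  refine hf.eqOn_of_preconnected_of_eventuallyEq hg
    (convex_halfSpace_re_gt 0).isPreconnected (z₀ := 2) (by simp) ?_ hs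
  have : {s : ℂ | 1 < s.re} ∈ 𝓝 (2 : ℂ) :=
    (isOpen_lt continuous_const Complex.continuous_re).mem_nhds (by simp)
  filter_upwards [this] with z hz
  have hz1 : z ≠ 1 := by rintro rfl; simp at hz
  have h := riemannZeta_eq_of_one_lt_re hz
  rw [riemannZeta_eq_inv_sub_mul hz1] at h
  have : z - 1 ≠ 0 := sub_ne_zero.2 hz1
  field_simp at h
  linear_combination h

/-- The Riemann zeta function is negative at its central point. -/
lemma riemannZeta_half : ∃ r : ℝ, r < 0 ∧ riemannZeta (1 / 2) = (r : ℂ) := by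
  refine ⟨-1 - (∫ t in Set.Ioi (1 : ℝ), t ^ (-(3 / 2) : ℝ) * Int.fract t) / 2, ?_, ?_⟩
  · have : 0 ≤ ∫ t in Set.Ioi (1 : ℝ), t ^ (-(3 / 2) : ℝ) * Int.fract t :=
      setIntegral_nonneg measurableSet_Ioi fun t ht =>
        mul_nonneg (Real.rpow_nonneg (zero_le_one.trans (le_of_lt ht)) _) (Int.fract_nonneg t)
    linarith
  · have e : mellin fractTail (-(1 / 2)) =
        ((∫ t in Set.Ioi (1 : ℝ), t ^ (-(3 / 2) : ℝ) * Int.fract t : ℝ) : ℂ) := by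
      rw [mellin_fractTail, ← integral_complex_ofReal]
      refine setIntegral_congr_fun measurableSet_Ioi fun t ht => ?_
      rw [Complex.ofReal_mul, Complex.ofReal_cpow (zero_le_one.trans (le_of_lt ht))]
      norm_num
    rw [riemannZeta_eq_inv_sub_mul (by norm_num), riemannZeta₁_eq (by norm_num), e]
    push_cast
    ring

end ZetaHalf

namespace PureCubic

open Polynomial

lemma pow_three_ne {l m : ℕ} (hl : l.Prime) (hm : m.factorization l = 1) (b : ℚ) :
    b ^ 3 ≠ (m : ℚ) := by
  intro h
  have := Fact.mk hl
  have hm0 : m ≠ 0 := by rintro rfl; simp at hm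
  have h2 := congrArg (padicValRat l) h
  rw [padicValRat.pow, padicValRat.of_nat, ← Nat.factorization_def _ hl, hm] at h2
  push_cast at h2
  omega

/-- The pure cubic field generated by a cube root of `m`. -/
abbrev Fld (m : ℕ) : Type := AdjoinRoot (X ^ 3 - C (m : ℚ))

lemma irreducible {l m : ℕ} (hl : l.Prime) (hm : m.factorization l = 1) :
    Irreducible (X ^ 3 - C (m : ℚ)) :=
  X_pow_sub_C_irreducible_of_prime Nat.prime_three (pow_three_ne hl hm)

section

lemma monic (m : ℕ) : (X ^ 3 - C (m : ℚ)).Monic := monic_X_pow_sub_C _ three_ne_zero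

variable {m : ℕ} [hirr : Fact (Irreducible (X ^ 3 - C (m : ℚ)))]

instance : NumberField (Fld m) where
  to_charZero := charZero_of_injective_algebraMap (algebraMap ℚ (Fld m)).injective
  to_finiteDimensional := (AdjoinRoot.powerBasis hirr.1.ne_zero).finite

lemma finrank_eq : Module.finrank ℚ (Fld m) = 3 := by
  rw [(AdjoinRoot.powerBasis hirr.1.ne_zero).finrank, AdjoinRoot.powerBasis_dim,
    natDegree_X_pow_sub_C]

lemma root_pow : (AdjoinRoot.root (X ^ 3 - C (m : ℚ))) ^ 3 = (m : Fld m) := by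
  have := AdjoinRoot.eval₂_root (X ^ 3 - C (m : ℚ))
  simpa [sub_eq_zero] using this

variable (m) in
/-- The cube root of `m` as an algebraic integer. -/
def cbrt : NumberField.RingOfIntegers (Fld m) :=
  ⟨AdjoinRoot.root (X ^ 3 - C (m : ℚ)), ⟨X ^ 3 - C (m : ℤ),
    monic_X_pow_sub_C _ three_ne_zero, by simp [root_pow]⟩⟩

lemma cbrt_pow : (cbrt m) ^ 3 = (m : NumberField.RingOfIntegers (Fld m)) := by
  apply NumberField.RingOfIntegers.ext
  simp only [map_pow, map_natCast]
  exact root_pow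

lemma minpoly_cbrt : minpoly ℤ (cbrt m) = X ^ 3 - C (m : ℤ) := by
  have h := minpoly.isIntegrallyClosed_eq_field_fractions ℚ (Fld m)
    (NumberField.RingOfIntegers.isIntegral (cbrt m))
  have h2 : minpoly ℚ (algebraMap (NumberField.RingOfIntegers (Fld m)) (Fld m) (cbrt m)) =
      X ^ 3 - C (m : ℚ) := by
    refine (AdjoinRoot.minpoly_root hirr.1.ne_zero).trans ?_
    rw [(monic m).leadingCoeff]
    simp
  apply Polynomial.map_injective (algebraMap ℤ ℚ) (algebraMap ℤ ℚ).injective_int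
  rw [← h, h2]
  simp

lemma adjoin_cbrt : Algebra.adjoin ℚ {((cbrt m : NumberField.RingOfIntegers (Fld m)) : Fld m)} = ⊤ :=
  AdjoinRoot.adjoinRoot_eq_top

lemma not_isGalois (hm : m ≠ 0) : ¬ IsGalois ℚ (Fld m) := by
  intro hG
  set θ : Fld m := AdjoinRoot.root (X ^ 3 - C (m : ℚ)) with hθ
  have hθ0 : θ ≠ 0 := by
    intro h
    have := root_pow (m := m)
    rw [← hθ, h] at this
    have h' : (m : Fld m) = 0 := by rw [← this]; simp
    exact hm (by exact_mod_cast h')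
  have hcard : 1 < Nat.card (Fld m ≃ₐ[ℚ] Fld m) := by
    rw [IsGalois.card_aut_eq_finrank, finrank_eq]; norm_num
  have : Finite (Fld m ≃ₐ[ℚ] Fld m) := inferInstance
  have : Nontrivial (Fld m ≃ₐ[ℚ] Fld m) := Finite.one_lt_card_iff_nontrivial.1 hcard
  obtain ⟨σ, hσ⟩ := exists_ne (1 : Fld m ≃ₐ[ℚ] Fld m)
  have hσθ : σ θ ≠ θ := by
    intro h
    apply hσ
    have e : (σ : Fld m →ₐ[ℚ] Fld m) = AlgHom.id ℚ _ := AdjoinRoot.algHom_ext h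
    ext x
    exact congrArg (fun f : Fld m →ₐ[ℚ] Fld m => f x) e
  have h3 : (σ θ) ^ 3 = θ ^ 3 := by
    rw [← map_pow, root_pow, map_natCast]
  set z := σ θ / θ with hz
  have hz1 : z ≠ 1 := fun h => hσθ ((div_eq_one_iff_eq hθ0).1 h)
  have hz3 : z ^ 3 = 1 := by
    rw [hz, div_pow, h3, div_self (pow_ne_zero _ hθ0)]
  have hz2 : z ^ 2 + z + 1 = 0 := by
    have : (z - 1) * (z ^ 2 + z + 1) = 0 := by linear_combination hz3
    exact (mul_eq_zero.1 this).resolve_left (sub_ne_zero.2 hz1)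
  have hInt : IsIntegral ℚ z := Algebra.IsIntegral.isIntegral z
  have hd := minpoly.degree_dvd hInt
  rw [finrank_eq] at hd
  have hle : (minpoly ℚ z).natDegree ≤ 2 := by
    have hp : (X ^ 2 + X + 1 : ℚ[X]) ≠ 0 := by
      intro h
      have := congrArg (eval 0) h
      simp at this
    have := natDegree_le_of_dvd (minpoly.dvd ℚ z (p := X ^ 2 + X + 1) (by simp [hz2])) hp
    refine this.trans ?_
    compute_degree
  have h1 : (minpoly ℚ z).natDegree = 1 := by
    rcases (Nat.dvd_prime Nat.prime_three).1 hd with h | h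
    · exact h
    · omega
  obtain ⟨q, hq⟩ := minpoly.natDegree_eq_one_iff.1 h1
  rw [← hq] at hz2
  have : q ^ 2 + q + 1 = 0 := (algebraMap ℚ (Fld m)).injective (by simpa using hz2)
  nlinarith [sq_nonneg (q + 1 / 2)]

open NumberField in
lemma dvd_discr {l : ℕ} (hl : l.Prime) (hlm : l ∣ m) (hl2 : ¬ l ^ 2 ∣ m) :
    (l : ℤ) ∣ discr (Fld m) := by
  obtain ⟨k, hk⟩ := hlm
  have hkO : (m : 𝓞 (Fld m)) = l * k := by exact_mod_cast congrArg (Nat.cast : ℕ → 𝓞 (Fld m)) hk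
  have hk1 : ¬ l ∣ k := fun ⟨j, hj⟩ => hl2 ⟨j, by rw [hk, hj]; ring⟩
  have hcop : IsCoprime (l : ℤ) (k : ℤ) :=
    Nat.isCoprime_iff_coprime.2 ((Nat.Prime.coprime_iff_not_dvd hl).2 hk1)
  have hnl : Ideal.absNorm (Ideal.span {(l : 𝓞 (Fld m))}) = l ^ 3 := by
    have h := Algebra.norm_algebraMap (S := 𝓞 (Fld m)) (l : ℤ)
    rw [RingOfIntegers.rank, finrank_eq] at h
    rw [Ideal.absNorm_span_singleton, ← Int.natAbs_natCast l, ← Int.natAbs_pow, ← h]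
    simp
  obtain ⟨P, hPmax, hP⟩ := Ideal.exists_le_maximal (Ideal.span {(l : 𝓞 (Fld m))})
    (by
      rw [Ne, ← Ideal.absNorm_eq_one_iff, hnl]
      exact fun h => hl.ne_one (by simpa using h))
  have hlP : (l : 𝓞 (Fld m)) ∈ P := hP (Ideal.mem_span_singleton_self _)
  have hθP : cbrt m ∈ P := by
    refine hPmax.isPrime.mem_of_pow_mem 3 ?_
    rw [cbrt_pow, hkO]
    exact P.mul_mem_right _ hlP
  have hPk : IsCoprime (P ^ 3) (Ideal.span {(k : 𝓞 (Fld m))}) := by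
    refine IsCoprime.pow_left ?_
    rw [Ideal.isCoprime_iff_exists]
    obtain ⟨a, b, hab⟩ := hcop
    refine ⟨a * l, P.mul_mem_left _ hlP, b * k, Ideal.mul_mem_left _ _
      (Ideal.mem_span_singleton_self _), ?_⟩
    exact_mod_cast congrArg (Int.cast : ℤ → 𝓞 (Fld m)) hab
  have hdvd : P ^ 3 ∣ Ideal.span {(l : 𝓞 (Fld m))} := by
    refine hPk.dvd_of_dvd_mul_right ?_
    rw [Ideal.span_singleton_mul_span_singleton, ← hkO, ← cbrt_pow,
      ← Ideal.span_singleton_pow]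
    exact pow_dvd_pow_of_dvd (Ideal.dvd_span_singleton.2 hθP) 3
  have hlZ : (Ideal.span {(l : ℤ)}).IsMaximal :=
    PrincipalIdealRing.isMaximal_of_irreducible (Nat.prime_iff_prime_int.1 hl).irreducible
  have hdiff : P ^ (3 - 1) ∣ differentIdeal ℤ (𝓞 (Fld m)) := by
    refine pow_sub_one_dvd_differentIdeal ℤ (p := Ideal.span {(l : ℤ)}) P 3 ?_ ?_
    · simpa using hl.ne_zero
    · simpa [Ideal.map_span] using hdvd
  have hnorm := Ideal.absNorm_dvd_absNorm_of_le (Ideal.dvd_iff_le.1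
    ((dvd_pow_self P two_ne_zero).trans hdiff))
  rw [absNorm_differentIdeal (Fld m)] at hnorm
  have hPl : Ideal.absNorm P ∣ l ^ 3 := hnl ▸ Ideal.absNorm_dvd_absNorm_of_le hP
  obtain ⟨j, -, hj⟩ := (Nat.dvd_prime_pow hl).1 hPl
  have hj0 : j ≠ 0 := by
    rintro rfl
    exact hPmax.ne_top (Ideal.absNorm_eq_one_iff.1 (by simpa using hj))
  exact Int.natCast_dvd.2 ((dvd_pow_self l hj0).trans (hj ▸ hnorm))

end

end PureCubic

open Filter Topology in
/-- Comparison of the continuation of the Dedekind zeta function with the completed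
`L`-series, evaluated at the central point. -/
lemma IsDedekindZeta.half_neg {K : Type*} [Field K] [NumberField K] {g : ℂ → ℂ}
    (hg : IsDedekindZeta K g) {m : ℕ} (hm : m ≠ 0) (h0 : Eis.w m 0 = 0)
    (hpos : 0 < ∫ t in Set.Ioi (1 : ℝ), t ^ (-1 / 2 : ℝ) * (Eis.wTheta m t).re)
    {U V : ℂ → ℂ} (hU : EntirePosHalf U) (hV : EntirePosHalf V)
    (h : ∀ s : ℂ, 2 ≤ s.re →
      U s * (riemannZeta s * Eis.dser (Eis.w m) s) = V s * dedekindSeries K s) :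
    ∃ r : ℝ, r < 0 ∧ g (1 / 2) = (r : ℂ) := by
  have hr := Eis.rate_pos hm
  have hrC : (Eis.rate m : ℂ) ≠ 0 := by exact_mod_cast hr.ne'
  set D : ℂ → ℂ := fun s =>
    mellin (Eis.wTheta m) s * (Complex.Gamma s)⁻¹ * (Eis.rate m : ℂ) ^ s with hD
  have hDd : Differentiable ℂ D :=
    ((Eis.differentiable_mellin_wTheta hm h0).mul Complex.differentiable_one_div_Gamma).mul
      (differentiable_id.const_cpow (Or.inl hrC))
  have hDs : ∀ s : ℂ, 2 ≤ s.re → D s = Eis.dser (Eis.w m) s := by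
    intro s hs
    have hG : Complex.Gamma s ≠ 0 := Complex.Gamma_ne_zero_of_re_pos (by linarith)
    have hc : (Eis.rate m : ℂ) ^ s ≠ 0 := by simp [Complex.cpow_eq_zero_iff, hrC]
    simp only [hD]
    rw [Eis.mellin_wTheta hm h0 hs, Complex.cpow_neg, ← Eis.dser]
    field_simp
  have hopen : IsOpen ({(1 : ℂ)}ᶜ : Set ℂ) := isOpen_compl_singleton
  have hF : AnalyticOnNhd ℂ (fun s => U s * (riemannZeta s * D s)) {(1 : ℂ)}ᶜ :=
    DifferentiableOn.analyticOnNhd (hU.differentiable.differentiableOn.mul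
      (differentiableOn_riemannZeta.mul hDd.differentiableOn)) hopen
  have hH : AnalyticOnNhd ℂ (fun s => V s * g s) {(1 : ℂ)}ᶜ :=
    DifferentiableOn.analyticOnNhd (hV.differentiable.differentiableOn.mul hg.1) hopen
  have hconn : IsPreconnected ({(1 : ℂ)}ᶜ : Set ℂ) :=
    (isConnected_compl_singleton_of_one_lt_rank (by simp) 1).isPreconnected
  have key : U (1 / 2) * (riemannZeta (1 / 2) * D (1 / 2)) = V (1 / 2) * g (1 / 2) := by
    refine hF.eqOn_of_preconnected_of_eventuallyEq hH hconn (z₀ := 3) (by simp) ?_ (by simp)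
    have : {s : ℂ | 2 < s.re} ∈ 𝓝 (3 : ℂ) :=
      (isOpen_lt continuous_const Complex.continuous_re).mem_nhds (by simp; norm_num)
    filter_upwards [this] with s hs
    have hs' : 2 < s.re := hs
    rw [hDs s hs'.le, h s hs'.le, hg.2 s (by linarith)]
  have real_of_pos : ∀ {R : ℂ → ℂ}, EntirePosHalf R → ∃ x : ℝ, 0 < x ∧ R (1 / 2) = x := by
    intro R hR
    obtain ⟨h1, h2⟩ := Complex.pos_iff.1 hR.pos
    exact ⟨_, h1, Complex.ext rfl (by simpa using h2.symm)⟩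
  obtain ⟨u, hu, hu'⟩ := real_of_pos hU
  obtain ⟨v, hv, hv'⟩ := real_of_pos hV
  obtain ⟨z, hz, hz'⟩ := ZetaHalf.riemannZeta_half
  have hG : Complex.Gamma (1 / 2) = ((Real.Gamma (1 / 2) : ℝ) : ℂ) := by
    rw [← Complex.Gamma_ofReal]; norm_num
  have hc : (Eis.rate m : ℂ) ^ (1 / 2 : ℂ) = ((Eis.rate m ^ (1 / 2 : ℝ) : ℝ) : ℂ) := by
    rw [Complex.ofReal_cpow hr.le]; norm_num
  set I := ∫ t in Set.Ioi (1 : ℝ), t ^ (-1 / 2 : ℝ) * (Eis.wTheta m t).re with hI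
  have hDh : D (1 / 2) =
      ((2 * I * (Real.Gamma (1 / 2))⁻¹ * Eis.rate m ^ (1 / 2 : ℝ) : ℝ) : ℂ) := by
    simp only [hD]
    rw [Eis.mellin_wTheta_half hm h0, hG, hc, ← hI]
    push_cast
    ring
  have hd : 0 < 2 * I * (Real.Gamma (1 / 2))⁻¹ * Eis.rate m ^ (1 / 2 : ℝ) := by
    have := Real.Gamma_pos_of_pos (one_half_pos (α := ℝ))
    positivity
  set d := 2 * I * (Real.Gamma (1 / 2))⁻¹ * Eis.rate m ^ (1 / 2 : ℝ)
  refine ⟨u * (z * d) / v, div_neg_of_neg_of_pos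
    (mul_neg_of_pos_of_neg hu (mul_neg_of_neg_of_pos hz hd)) hv, ?_⟩
  rw [hu', hv', hz', hDh] at key
  have hvC : (v : ℂ) ≠ 0 := by exact_mod_cast hv.ne'
  push_cast
  rw [eq_div_iff hvC, key, mul_comm]

/-- There are infinitely many non-Galois cubic fields whose Dedekind zeta function has
negative central value. -/
theorem negative_central_value_of_infinitely_many_nonGalois_cubic_fields :
    ∀ B : ℝ, ∃ (K : Type) (_ : Field K) (_ : NumberField K),
      Module.finrank ℚ K = 3 ∧
      B < |(NumberField.discr K : ℝ)| ∧
      ¬ IsGalois ℚ K ∧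
      ∀ g : ℂ → ℂ, IsDedekindZeta K g →
        ∃ r : ℝ, r < 0 ∧ g (1 / 2) = (r : ℂ) := by
  intro B
  obtain ⟨n, hn⟩ := exists_nat_gt B
  obtain ⟨l, hnl, hl, hlmod⟩ := Nat.forall_exists_prime_gt_and_modEq n (q := 9) (a := 2)
    (by norm_num) (by norm_num)
  have hl9 : l % 9 = 2 := hlmod
  obtain ⟨m, hm, hpos⟩ := Eis.exists_good_integral_pos hl hl9
  have hm0 : m ≠ 0 := by have := hm.mod_nine; omega
  have hirr := Fact.mk (PureCubic.irreducible hl (hm.factorization hl))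
  refine ⟨PureCubic.Fld m, inferInstance, inferInstance, PureCubic.finrank_eq, ?_,
    PureCubic.not_isGalois hm0, fun g hg => ?_⟩
  · have hdvd := PureCubic.dvd_discr (m := m) hl hm.dvd hm.not_sq_dvd
    have h1 := Nat.le_of_dvd (Int.natAbs_pos.2 (NumberField.discr_ne_zero (PureCubic.Fld m)))
      (Int.natCast_dvd.1 hdvd)
    have h2 : (n : ℝ) ≤ ((NumberField.discr (PureCubic.Fld m)).natAbs : ℝ) := by
      exact_mod_cast hnl.le.trans h1
    rw [Nat.cast_natAbs, Int.cast_abs] at h2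
    exact hn.trans_le h2
  · obtain ⟨U, V, hU, hV, h⟩ := NumberField.exists_riemannZeta_mul_dser_w_eq
      PureCubic.minpoly_cbrt PureCubic.adjoin_cbrt hm.mod_nine
    exact hg.half_neg hm0 (hm.w_zero hl hl9) hpos hU hV h
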